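/- arXiv:2302.05824 — 2 statements merged into one kernel-verified Lean document; each statement's English description precedes it below -/
import Mathlib

section
/- Let α,β,γ,δ>-1 and a∈(-1,1). Then there exist constants C>0 and N such that for every ψ∈W_AC(a,1) and every integer n≥N, |∫_a^1 (x-a)^γ (1-x)^δ P_n^{(α,β)}(x) ψ(x) dx| ≤ C ‖ψ‖_{W_AC(a,1)} · n^{-min{2δ-α+2, γ+3/2, 3/2}}. -/
open MeasureTheory Set

/-- Jacobi polynomial via Rodrigues' formula. -/
noncomputable def jacobiP (a b : ℝ) (n : ℕ) (x : ℝ) : ℝ :=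
  ((-1 : ℝ) ^ n / (2 ^ n * (n.factorial : ℝ))) * (1 - x) ^ (-a) * (1 + x) ^ (-b) *
    iteratedDeriv n (fun y => (1 - y) ^ ((n : ℝ) + a) * (1 + y) ^ ((n : ℝ) + b)) x

/-- ψ is absolutely continuous on [a,b] with integrable derivative (FTC characterization). -/
def IsWAC (a b : ℝ) (psi : ℝ → ℝ) : Prop :=
  MeasureTheory.IntegrableOn (deriv psi) (Set.Ioo a b) ∧
  ∀ x ∈ Set.Icc a b, psi x = psi a + ∫ t in a..x, deriv psi t

/-- The W_AC norm: ‖ψ‖_∞ + ‖ψ'‖_{L¹}. -/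
noncomputable def wacNorm (a b : ℝ) (psi : ℝ → ℝ) : ℝ :=
  (⨆ x : Set.Icc a b, |psi (x : ℝ)|) + ∫ t in a..b, |deriv psi t|


noncomputable def gb (r : ℝ) : ℕ → ℝ
  | 0 => 1
  | k + 1 => gb r k * (r - k) / (k + 1)

lemma gb_succ (r : ℝ) (k : ℕ) : (k + 1) * gb r (k + 1) = gb r k * (r - k) := by
  have : (k : ℝ) + 1 ≠ 0 := by positivity
  rw [gb]; field_simp

noncomputable def JJ (α β : ℝ) (n : ℕ) (x : ℝ) : ℝ :=
  ∑ k ∈ Finset.range (n + 1),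
    gb (n + α) (n - k) * gb (n + β) k * (((x - 1) / 2) ^ k * ((x + 1) / 2) ^ (n - k))

lemma term_deriv (c : ℝ) (k m : ℕ) (x : ℝ) :
    HasDerivAt (fun x : ℝ => c * (((x - 1) / 2) ^ k * ((x + 1) / 2) ^ m))
      (c * (k * ((x - 1) / 2) ^ (k - 1) * ((x + 1) / 2) ^ m
        + m * (((x - 1) / 2) ^ k * ((x + 1) / 2) ^ (m - 1))) / 2) x := by
  have h1 : HasDerivAt (fun x : ℝ => (x - 1) / 2) (1 / 2) x :=
    ((hasDerivAt_id x).sub_const 1).div_const 2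
  have h2 : HasDerivAt (fun x : ℝ => (x + 1) / 2) (1 / 2) x :=
    ((hasDerivAt_id x).add_const 1).div_const 2
  refine (((h1.fun_pow k).fun_mul (h2.fun_pow m)).const_mul c).congr_deriv ?_
  ring

noncomputable def JJ' (α β : ℝ) (n : ℕ) (x : ℝ) : ℝ :=
  ∑ k ∈ Finset.range (n + 1),
    gb (n + α) (n - k) * gb (n + β) k *
      (k * ((x - 1) / 2) ^ (k - 1) * ((x + 1) / 2) ^ (n - k)
        + (n - k : ℕ) * (((x - 1) / 2) ^ k * ((x + 1) / 2) ^ (n - k - 1))) / 2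

lemma JJ_hasDeriv (α β : ℝ) (n : ℕ) (x : ℝ) : HasDerivAt (JJ α β n) (JJ' α β n x) x := by
  unfold JJ JJ'
  exact HasDerivAt.fun_sum fun k _ => term_deriv _ _ _ _

lemma gb_rel1 (α : ℝ) (n k : ℕ) (hk : k ≤ n) :
    ((n : ℝ) + 1 - k) * gb (((n + 1 : ℕ) : ℝ) + α) (n + 1 - k)
      = (α + 1 + k) * gb (n + (α + 1)) (n - k) := by
  have h := gb_succ (((n + 1 : ℕ) : ℝ) + α) (n - k)
  rw [show n + 1 - k = n - k + 1 by omega]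
  rw [Nat.cast_sub hk] at h
  have e : (n : ℝ) + (α + 1) = ((n + 1 : ℕ) : ℝ) + α := by push_cast; ring
  rw [e]
  push_cast at *
  linarith

lemma gb_rel2 (β : ℝ) (n k : ℕ) :
    ((k : ℝ) + 1) * gb (((n + 1 : ℕ) : ℝ) + β) (k + 1)
      = (β + 1 + n - k) * gb (n + (β + 1)) k := by
  have h := gb_succ (((n + 1 : ℕ) : ℝ) + β) k
  have e : (n : ℝ) + (β + 1) = ((n + 1 : ℕ) : ℝ) + β := by push_cast; ring
  rw [e]
  push_cast at *
  linarith

lemma JJ'_succ (α β : ℝ) (n : ℕ) (x : ℝ) :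
    JJ' α β (n + 1) x = (n + α + β + 2) / 2 * JJ (α + 1) (β + 1) n x := by
  unfold JJ' JJ
  simp only [mul_add, add_div, Finset.sum_add_distrib]
  rw [Finset.sum_range_succ' _ (n + 1), Finset.sum_range_succ _ (n + 1), Finset.mul_sum]
  simp only [Nat.cast_zero, zero_mul, mul_zero, zero_div, add_zero, Nat.sub_self, zero_mul]
  rw [← Finset.sum_add_distrib]
  refine Finset.sum_congr rfl fun k hk => ?_
  have hk : k ≤ n := by simpa [Nat.lt_succ_iff] using hk
  have r1 := gb_rel1 α n k hk
  have r2 := gb_rel2 β n k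
  have r1' := gb_rel1 α n k hk
  have e1 : n + 1 - (k + 1) = n - k := by omega
  have e2 : n + 1 - k - 1 = n - k := by omega
  have e3 : gb (((n + 1 : ℕ) : ℝ) + β) k = gb (n + (β + 1)) k := by congr 1; push_cast; ring
  have e4 : gb (((n + 1 : ℕ) : ℝ) + α) (n - k) = gb (n + (α + 1)) (n - k) := by
    congr 1; push_cast; ring
  rw [e1, e2, e3, e4, Nat.cast_sub (by omega : k ≤ n + 1)]
  simp only [Nat.add_sub_cancel]
  push_cast at *
  set A := ((x - 1) / 2) ^ k
  set B := ((x + 1) / 2) ^ (n - k)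
  linear_combination (gb (n + (α + 1)) (n - k) * A * B / 2) * r2
    + (gb (n + (β + 1)) k * A * B / 2) * r1

lemma JJ_rel (α β : ℝ) (n : ℕ) (x : ℝ) :
    (1 - x ^ 2) * JJ' (α + 1) (β + 1) n x = -2 * (n + 1) * JJ α β (n + 1) x
      + ((α + 1) * (1 + x) - (β + 1) * (1 - x)) * JJ (α + 1) (β + 1) n x := by
  have key : (n + 1) * JJ α β (n + 1) x = ∑ k ∈ Finset.range (n + 1),
      gb (n + (α + 1)) (n - k) * gb (n + (β + 1)) k *
      ((α + 1 + k) * (((x - 1) / 2) ^ k * ((x + 1) / 2) ^ (n + 1 - k))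
       + (β + 1 + n - k) * (((x - 1) / 2) ^ (k + 1) * ((x + 1) / 2) ^ (n - k))) := by
    have s1 : (n + 1) * JJ α β (n + 1) x =
      (∑ k ∈ Finset.range (n + 1 + 1), ((n : ℝ) + 1 - k) * (
        gb ((n + 1 : ℕ) + α) (n + 1 - k) * gb ((n + 1 : ℕ) + β) k *
          (((x - 1) / 2) ^ k * ((x + 1) / 2) ^ (n + 1 - k)))) +
      (∑ k ∈ Finset.range (n + 1 + 1), (k : ℝ) * (
        gb ((n + 1 : ℕ) + α) (n + 1 - k) * gb ((n + 1 : ℕ) + β) k *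
          (((x - 1) / 2) ^ k * ((x + 1) / 2) ^ (n + 1 - k)))) := by
      unfold JJ
      rw [Finset.mul_sum, ← Finset.sum_add_distrib]
      refine Finset.sum_congr rfl fun k hk => ?_
      ring
    rw [s1, Finset.sum_range_succ _ (n + 1), Finset.sum_range_succ' _ (n + 1)]
    rw [show (n : ℝ) + 1 - ((n + 1 : ℕ) : ℝ) = 0 by push_cast; ring]
    simp only [Nat.cast_zero, zero_mul, add_zero]
    rw [← Finset.sum_add_distrib]
    refine Finset.sum_congr rfl fun k hk => ?_
    have hk : k ≤ n := by simpa [Nat.lt_succ_iff] using hk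
    have r1 := gb_rel1 α n k hk
    have r2 := gb_rel2 β n k
    have e1 : n + 1 - (k + 1) = n - k := by omega
    have e3 : gb (((n + 1 : ℕ) : ℝ) + β) k = gb (n + (β + 1)) k := by congr 1; push_cast; ring
    have e4 : gb (((n + 1 : ℕ) : ℝ) + α) (n - k) = gb (n + (α + 1)) (n - k) := by
      congr 1; push_cast; ring
    rw [e1, e3, e4]
    push_cast at *
    set A := ((x - 1) / 2) ^ k
    set A' := ((x - 1) / 2) ^ (k + 1)
    set B := ((x + 1) / 2) ^ (n - k)
    set B' := ((x + 1) / 2) ^ (n + 1 - k)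
    linear_combination (gb (n + (α + 1)) (n - k) * A' * B) * r2
      + (gb (n + (β + 1)) k * A * B') * r1
  have : -2 * ((n : ℝ) + 1) * JJ α β (n + 1) x = -2 * ((n + 1) * JJ α β (n + 1) x) := by ring
  rw [this, key]
  unfold JJ' JJ
  rw [Finset.mul_sum, Finset.mul_sum, Finset.mul_sum, ← Finset.sum_add_distrib]
  refine Finset.sum_congr rfl fun k hk => ?_
  have hk : k ≤ n := by simpa [Nat.lt_succ_iff] using hk
  have p1 : (k : ℝ) * ((x - 1) / 2) ^ (k - 1) * ((x - 1) / 2) = k * ((x - 1) / 2) ^ k := by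
    rcases k with _ | k
    · simp
    · simp only [Nat.add_sub_cancel]; ring
  have p2 : ((n - k : ℕ) : ℝ) * ((x + 1) / 2) ^ (n - k - 1) * ((x + 1) / 2)
      = (n - k : ℕ) * ((x + 1) / 2) ^ (n - k) := by
    rcases n - k with _ | k
    · simp
    · simp only [Nat.add_sub_cancel]; ring
  rw [Nat.cast_sub hk] at *
  rw [show n + 1 - k = n - k + 1 by omega, pow_succ _ (n - k), pow_succ _ k]
  set A := ((x - 1) / 2) ^ k
  set B := ((x + 1) / 2) ^ (n - k)
  set G := gb (n + (α + 1)) (n - k) * gb (n + (β + 1)) k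
  linear_combination (- G * B * (1 + x)) * p1 + (G * A * (1 - x)) * p2

lemma w_deriv (α β x : ℝ) (hx : x ∈ Ioo (-1 : ℝ) 1) :
    HasDerivAt (fun x : ℝ => (1 - x) ^ (α + 1) * (1 + x) ^ (β + 1))
      ((1 - x) ^ α * (1 + x) ^ β * (-(α + 1) * (1 + x) + (β + 1) * (1 - x))) x := by
  have h1 : HasDerivAt (fun x : ℝ => 1 - x) (-1) x := by
    simpa using (hasDerivAt_id x).const_sub 1
  have h2 : HasDerivAt (fun x : ℝ => 1 + x) 1 x := by
    simpa using (hasDerivAt_id x).const_add 1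
  have p1 : 0 < 1 - x := by linarith [hx.2]
  have p2 : 0 < 1 + x := by linarith [hx.1]
  refine ((h1.rpow_const (p := α + 1) (Or.inl p1.ne')).fun_mul
    (h2.rpow_const (p := β + 1) (Or.inl p2.ne'))).congr_deriv ?_
  rw [Real.rpow_add_one p1.ne', Real.rpow_add_one p2.ne']
  simp only [add_sub_cancel_right]
  ring

/-- `d/dx [w_{α+1,β+1} P_n^{(α+1,β+1)}] = -2(n+1) w_{α,β} P_{n+1}^{(α,β)}`. -/
lemma wJJ_deriv (α β : ℝ) (n : ℕ) (x : ℝ) (hx : x ∈ Ioo (-1 : ℝ) 1) :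
    HasDerivAt (fun x : ℝ => (1 - x) ^ (α + 1) * (1 + x) ^ (β + 1) * JJ (α + 1) (β + 1) n x)
      (-2 * (n + 1) * ((1 - x) ^ α * (1 + x) ^ β * JJ α β (n + 1) x)) x := by
  have p1 : 0 < 1 - x := by linarith [hx.2]
  have p2 : 0 < 1 + x := by linarith [hx.1]
  refine ((w_deriv α β x hx).fun_mul (JJ_hasDeriv (α + 1) (β + 1) n x)).congr_deriv ?_
  rw [Real.rpow_add_one p1.ne', Real.rpow_add_one p2.ne']
  linear_combination ((1 - x) ^ α * (1 + x) ^ β) * JJ_rel α β n x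

lemma iter_eq (n : ℕ) : ∀ (α β x : ℝ), x ∈ Ioo (-1 : ℝ) 1 →
    iteratedDeriv n (fun y : ℝ => (1 - y) ^ ((n : ℝ) + α) * (1 + y) ^ ((n : ℝ) + β)) x
      = (-1) ^ n * (2 ^ n * (n.factorial : ℝ)) * ((1 - x) ^ α * (1 + x) ^ β * JJ α β n x) := by
  induction n with
  | zero => intro α β x hx; simp [JJ, gb]
  | succ n ih =>
    intro α β x hx
    rw [iteratedDeriv_succ]
    have e : (fun y : ℝ => (1 - y) ^ (((n + 1 : ℕ) : ℝ) + α) * (1 + y) ^ (((n + 1 : ℕ) : ℝ) + β))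
      = (fun y : ℝ => (1 - y) ^ ((n : ℝ) + (α + 1)) * (1 + y) ^ ((n : ℝ) + (β + 1))) := by
      funext y
      rw [show ((n + 1 : ℕ) : ℝ) + α = n + (α + 1) by push_cast; ring,
        show ((n + 1 : ℕ) : ℝ) + β = n + (β + 1) by push_cast; ring]
    rw [e]
    have ev : iteratedDeriv n
        (fun y : ℝ => (1 - y) ^ ((n : ℝ) + (α + 1)) * (1 + y) ^ ((n : ℝ) + (β + 1))) =ᶠ[nhds x]
        fun x => (-1) ^ n * (2 ^ n * (n.factorial : ℝ)) *
          ((1 - x) ^ (α + 1) * (1 + x) ^ (β + 1) * JJ (α + 1) (β + 1) n x) := by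
      filter_upwards [isOpen_Ioo.mem_nhds hx] with y hy
      exact ih (α + 1) (β + 1) y hy
    rw [ev.deriv_eq, ((wJJ_deriv α β n x hx).const_mul _).deriv, Nat.factorial_succ]
    push_cast
    ring

lemma jacobiP_eq (α β : ℝ) (n : ℕ) (x : ℝ) (hx : x ∈ Ioo (-1 : ℝ) 1) :
    ((-1 : ℝ) ^ n / (2 ^ n * (n.factorial : ℝ))) * (1 - x) ^ (-α) * (1 + x) ^ (-β) *
    iteratedDeriv n (fun y => (1 - y) ^ ((n : ℝ) + α) * (1 + y) ^ ((n : ℝ) + β)) x = JJ α β n x := by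
  rw [iter_eq n α β x hx]
  have p1 : 0 < 1 - x := by linarith [hx.2]
  have p2 : 0 < 1 + x := by linarith [hx.1]
  rw [Real.rpow_neg p1.le, Real.rpow_neg p2.le]
  have q1 := (Real.rpow_pos_of_pos p1 α).ne'
  have q2 := (Real.rpow_pos_of_pos p2 β).ne'
  have q3 : (n.factorial : ℝ) ≠ 0 := by positivity
  have q4 : ((-1 : ℝ) ^ n) * (-1) ^ n = 1 := by rw [← mul_pow]; simp
  field_simp
  linear_combination JJ α β n x * q4

open Filter

lemma gb_prod (r : ℝ) (k : ℕ) : gb r k = (∏ i ∈ Finset.range k, (r - i)) / k.factorial := by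
  induction k with
  | zero => simp [gb]
  | succ k ih =>
    rw [gb, ih, Finset.prod_range_succ, Nat.factorial_succ]
    have : (k.factorial : ℝ) ≠ 0 := by positivity
    have : (k : ℝ) + 1 ≠ 0 := by positivity
    push_cast
    field_simp

lemma gb_diag (α : ℝ) (n : ℕ) :
    gb (n + α) n = (∏ i ∈ Finset.range n, (α + 1 + i)) / n.factorial := by
  rw [gb_prod, ← Finset.prod_range_reflect]
  congr 1
  refine Finset.prod_congr rfl fun i hi => ?_
  have hi : i < n := by simpa using hi
  rw [Nat.cast_sub (by omega), Nat.cast_sub (by omega)]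
  push_cast; ring

lemma gb_diag_pos (α : ℝ) (hα : -1 < α) (n : ℕ) : 0 < gb (n + α) n := by
  rw [gb_diag]
  refine div_pos (Finset.prod_pos fun i _ => ?_) (by positivity)
  have : (0 : ℝ) ≤ i := by positivity
  linarith

lemma gb_diag_bound (α : ℝ) (hα : -1 < α) :
    ∃ C : ℝ, 0 < C ∧ ∀ᶠ n : ℕ in atTop, gb (n + α) n ≤ C * (n : ℝ) ^ α := by
  have hG : 0 < Real.Gamma (α + 1) := Real.Gamma_pos_of_pos (by linarith)
  refine ⟨2 / Real.Gamma (α + 1), by positivity, ?_⟩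
  have ht := Real.GammaSeq_tendsto_Gamma (α + 1)
  have he := ht.eventually (lt_mem_nhds (by linarith : Real.Gamma (α + 1) / 2 < Real.Gamma (α + 1)))
  filter_upwards [he, eventually_gt_atTop 0] with n hn hn0
  have hnR : (0 : ℝ) < n := by exact_mod_cast hn0
  rw [Real.GammaSeq, Finset.prod_range_succ, Real.rpow_add_one hnR.ne'] at hn
  rw [gb_diag]
  have hp : 0 < ∏ i ∈ Finset.range n, (α + 1 + i) := by
    refine Finset.prod_pos fun i _ => ?_
    have : (0 : ℝ) ≤ i := by positivity
    linarith
  have hf : (0 : ℝ) < n.factorial := by positivity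
  have hx : 0 < (n : ℝ) ^ α := by positivity
  have hq : 0 < α + 1 + n := by linarith
  generalize (∏ i ∈ Finset.range n, (α + 1 + (i : ℝ))) = p at *
  generalize (n.factorial : ℝ) = f at *
  generalize (n : ℝ) ^ α = y at *
  generalize Real.Gamma (α + 1) = g at *
  rw [lt_div_iff₀ (by positivity)] at hn
  rw [div_mul_eq_mul_div, div_le_div_iff₀ hf hG]
  have h1 : g / 2 * (p * n) ≤ y * n * f := by
    refine le_trans ?_ hn.le
    gcongr
    linarith
  have h2 : g / 2 * p ≤ y * f := by
    have : (g / 2 * p) * n ≤ (y * f) * n := by linarith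
    exact le_of_mul_le_mul_right this hnR
  linarith

lemma gb_offdiag (α : ℝ) (hα : -1 < α) (n k : ℕ) (hk : k ≤ n) :
    |gb (n + α) (n - k)| ≤ gb (n + α) n * (n / (α + 1)) ^ k := by
  have h1 : 0 < α + 1 := by linarith
  induction k with
  | zero => simp [abs_of_pos (gb_diag_pos α hα n)]
  | succ k ih =>
    have ih := ih (by omega)
    have h := gb_succ (n + α) (n - (k + 1))
    rw [show n - (k + 1) + 1 = n - k by omega, Nat.cast_sub hk] at h
    push_cast at h
    have hkR : (k : ℝ) + 1 ≤ n := by exact_mod_cast hk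
    have hk0 : (0 : ℝ) ≤ k := by positivity
    have e : gb (n + α) (n - (k + 1)) = gb (n + α) (n - k) * (((n : ℝ) - k) / (α + 1 + k)) := by
      have : α + 1 + k ≠ 0 := by positivity
      field_simp
      linear_combination -h
    rw [e, abs_mul, pow_succ, ← mul_assoc]
    have hh : |((n : ℝ) - k) / (α + 1 + k)| ≤ n / (α + 1) := by
      rw [abs_of_nonneg (div_nonneg (by linarith) (by linarith))]
      exact div_le_div₀ (by linarith) (by linarith) h1 (by linarith)
    have hp := (gb_diag_pos α hα n).le
    have hp2 : 0 ≤ gb (n + α) n * (n / (α + 1)) ^ k := by positivity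
    gcongr

lemma gb_beta (β : ℝ) (n k : ℕ) (hk : k ≤ n) :
    |gb (n + β) k| ≤ (n + |β|) ^ k / k.factorial := by
  rw [gb_prod, abs_div, Finset.abs_prod, abs_of_nonneg (by positivity : (0 : ℝ) ≤ k.factorial)]
  gcongr
  calc _ ≤ ∏ i ∈ Finset.range k, ((n : ℝ) + |β|) := by
        refine Finset.prod_le_prod (fun _ _ => abs_nonneg _) fun i hi => ?_
        have hi : i < k := by simpa using hi
        have : (i : ℝ) ≤ n := by exact_mod_cast (by omega : i ≤ n)
        have h0 : (0 : ℝ) ≤ i := by positivity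
        rw [abs_le]
        constructor <;> cases abs_cases β <;> linarith
    _ = _ := by simp

/-- Edge bound. -/
lemma edge_bound (α β K : ℝ) (hα : -1 < α) :
    ∃ C : ℝ, 0 < C ∧ ∀ᶠ n : ℕ in atTop, ∀ x : ℝ, -1 ≤ x → x ≤ 1 → (1 - x) * (n : ℝ) ^ 2 ≤ K →
      |JJ α β n x| ≤ C * (n : ℝ) ^ α := by
  obtain ⟨C, hC, hb⟩ := gb_diag_bound α hα
  have h1 : 0 < α + 1 := by linarith
  refine ⟨C * Real.exp (K * (1 + |β|) / (2 * (α + 1))), by positivity, ?_⟩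
  filter_upwards [hb, eventually_ge_atTop 1] with n hn hn1 x hx1 hx2 hxK
  have hnR : (1 : ℝ) ≤ n := by exact_mod_cast hn1
  set q : ℝ := n / (α + 1) * (n + |β|) * ((1 - x) / 2) with hq
  have hq0 : 0 ≤ q := by
    have : 0 ≤ 1 - x := by linarith
    positivity
  have hqK : q ≤ K * (1 + |β|) / (2 * (α + 1)) := by
    rw [hq, le_div_iff₀ (by positivity)]
    have : n / (α + 1) * (n + |β|) * ((1 - x) / 2) * (2 * (α + 1)) = (1 - x) * (n * (n + |β|)) := by
      field_simp
    rw [this]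
    have h2 : (n : ℝ) * (n + |β|) ≤ n ^ 2 * (1 + |β|) := by nlinarith [abs_nonneg β, mul_nonneg (abs_nonneg β) (sub_nonneg.2 hnR)]
    calc _ ≤ (1 - x) * (n ^ 2 * (1 + |β|)) := by
          apply mul_le_mul_of_nonneg_left h2; linarith
      _ = ((1 - x) * n ^ 2) * (1 + |β|) := by ring
      _ ≤ _ := by gcongr
  calc |JJ α β n x| ≤ ∑ k ∈ Finset.range (n + 1), gb (n + α) n * (q ^ k / k.factorial) := by
        unfold JJ
        refine (Finset.abs_sum_le_sum_abs _ _).trans (Finset.sum_le_sum fun k hk => ?_)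
        have hk : k ≤ n := by simpa [Nat.lt_succ_iff] using hk
        rw [abs_mul, abs_mul, abs_mul, abs_pow, abs_pow]
        have a1 : |(x - 1) / 2| = (1 - x) / 2 := by
          rw [abs_of_nonpos (by linarith)]; ring
        have a2 : |(x + 1) / 2| ≤ 1 := by rw [abs_le]; constructor <;> linarith
        rw [a1]
        have a3 : |(x + 1) / 2| ^ (n - k) ≤ 1 := pow_le_one₀ (abs_nonneg _) a2
        have hx0 : 0 ≤ (1 - x) / 2 := by linarith
        have hgp := gb_diag_pos α hα n
        calc _ ≤ (gb (n + α) n * (n / (α + 1)) ^ k) * ((n + |β|) ^ k / k.factorial) *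
              (((1 - x) / 2) ^ k * 1) := by
              gcongr
              · exact gb_offdiag α hα n k hk
              · exact gb_beta β n k hk
          _ = _ := by rw [hq, mul_pow, mul_pow]; ring
    _ = gb (n + α) n * ∑ k ∈ Finset.range (n + 1), (q ^ k / k.factorial) := by
        rw [Finset.mul_sum]
    _ ≤ (C * (n : ℝ) ^ α) * Real.exp (K * (1 + |β|) / (2 * (α + 1))) := by
        gcongr
        · exact (Real.sum_le_exp_of_nonneg hq0 _).trans (Real.exp_le_exp.2 hqK)
    _ = _ := by ring

noncomputable def ell (α β x : ℝ) : ℝ := (α + 1 / 2) * (1 + x) - (β + 1 / 2) * (1 - x)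

noncomputable def rr (α β x : ℝ) : ℝ := (1 - x) ^ (α + 1 / 2) * (1 + x) ^ (β + 1 / 2)

noncomputable def EE (α β : ℝ) (n : ℕ) (x : ℝ) : ℝ :=
  rr α β x * (2 * ((n : ℝ) + 1) * JJ α β (n + 1) x ^ 2
    + (n + α + β + 2) / 2 * (1 - x ^ 2) * JJ (α + 1) (β + 1) n x ^ 2
    - ell α β x * (JJ α β (n + 1) x * JJ (α + 1) (β + 1) n x))

lemma EE_deriv (α β : ℝ) (n : ℕ) (x : ℝ) (hx : x ∈ Ioo (-1 : ℝ) 1) :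
    HasDerivAt (EE α β n) (-((1 - x) ^ (α - 1 / 2) * (1 + x) ^ (β - 1 / 2)) *
      (((α + β + 1) * (1 - x ^ 2) + ell α β x * x) *
        (JJ α β (n + 1) x * JJ (α + 1) (β + 1) n x))) x := by
  have p1 : 0 < 1 - x := by linarith [hx.2]
  have p2 : 0 < 1 + x := by linarith [hx.1]
  have hr : HasDerivAt (rr α β) ((1 - x) ^ (α - 1 / 2) * (1 + x) ^ (β - 1 / 2) *
      (-(α - 1 / 2 + 1) * (1 + x) + (β - 1 / 2 + 1) * (1 - x))) x := by
    have := w_deriv (α - 1 / 2) (β - 1 / 2) x hx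
    rw [show α - 1 / 2 + 1 = α + 1 / 2 by ring, show β - 1 / 2 + 1 = β + 1 / 2 by ring] at *
    exact this
  have hy : HasDerivAt (JJ α β (n + 1)) ((n + α + β + 2) / 2 * JJ (α + 1) (β + 1) n x) x := by
    rw [← JJ'_succ]; exact JJ_hasDeriv _ _ _ _
  have hz := JJ_hasDeriv (α + 1) (β + 1) n x
  have hl : HasDerivAt (ell α β) (α + β + 1) x := by
    unfold ell
    refine ((((hasDerivAt_id x).const_add 1).const_mul (α + 1 / 2)).fun_sub
      (((hasDerivAt_id x).const_sub 1).const_mul (β + 1 / 2))).congr_deriv ?_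
    ring
  have hq : HasDerivAt (fun x : ℝ => (n + α + β + 2) / 2 * (1 - x ^ 2))
      ((n + α + β + 2) / 2 * (-(2 * x))) x := by
    refine (((hasDerivAt_pow 2 x).const_sub 1).const_mul _).congr_deriv ?_
    push_cast; ring
  have hr0 : rr α β x = (1 - x) ^ (α - 1 / 2) * (1 + x) ^ (β - 1 / 2) * (1 - x ^ 2) := by
    unfold rr
    rw [show α + 1 / 2 = α - 1 / 2 + 1 by ring, show β + 1 / 2 = β - 1 / 2 + 1 by ring,
      Real.rpow_add_one p1.ne', Real.rpow_add_one p2.ne']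
    ring
  refine (hr.fun_mul ((((hy.fun_pow 2).const_mul (2 * ((n : ℝ) + 1))).fun_add
    (hq.fun_mul (hz.fun_pow 2))).fun_sub (hl.fun_mul (hy.fun_mul hz)))).congr_deriv ?_
  rw [hr0]
  have hrel := JJ_rel α β n x
  generalize (1 - x) ^ (α - 1 / 2) * (1 + x) ^ (β - 1 / 2) = r at *
  generalize JJ α β (n + 1) x = y at *
  generalize JJ (α + 1) (β + 1) n x = z at *
  generalize JJ' (α + 1) (β + 1) n x = z' at *
  simp only [ell]
  push_cast
  simp only [pow_one]
  linear_combination (r * (2 * ((n + α + β + 2) / 2) * (1 - x ^ 2) * z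
    - ((α + 1 / 2) * (1 + x) - (β + 1 / 2) * (1 - x)) * y)) * hrel

noncomputable def LL (α β : ℝ) : ℝ := 3 * (|α| + |β| + 1)

lemma LL_pos (α β : ℝ) : 0 < LL α β := by unfold LL; positivity

lemma ell_bound (α β x : ℝ) (h1 : -1 < x) (h2 : x < 1) :
    |ell α β x| ≤ LL α β ∧ |(α + β + 1) * (1 - x ^ 2) + ell α β x * x| ≤ LL α β := by
  have ha := abs_nonneg α
  have hb := abs_nonneg β
  have e1 : |ell α β x| ≤ 2 * (|α| + |β| + 1) := by
    unfold ell
    have a1 : |(α + 1 / 2) * (1 + x)| ≤ (|α| + 1 / 2) * 2 := by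
      rw [abs_mul]
      gcongr
      · exact (abs_add_le _ _).trans (by norm_num)
      · rw [abs_le]; constructor <;> linarith
    have a2 : |(β + 1 / 2) * (1 - x)| ≤ (|β| + 1 / 2) * 2 := by
      rw [abs_mul]
      gcongr
      · exact (abs_add_le _ _).trans (by norm_num)
      · rw [abs_le]; constructor <;> linarith
    have := abs_sub ((α + 1 / 2) * (1 + x)) ((β + 1 / 2) * (1 - x))
    linarith
  refine ⟨by unfold LL; linarith, ?_⟩
  have e2 : |(α + β + 1) * (1 - x ^ 2)| ≤ (|α| + |β| + 1) * 1 := by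
    rw [abs_mul]
    gcongr
    · have := abs_add_le (α + β) 1
      have := abs_add_le α β
      simp only [abs_one] at *
      linarith
    · rw [abs_le]; constructor <;> nlinarith
  have e3 : |ell α β x * x| ≤ 2 * (|α| + |β| + 1) * 1 := by
    rw [abs_mul]
    gcongr
    rw [abs_le]; constructor <;> linarith
  have := abs_add_le ((α + β + 1) * (1 - x ^ 2)) (ell α β x * x)
  unfold LL; linarith

/-- Pointwise lower bounds for the energy. -/
lemma EE_lower (α β b : ℝ) (hb : 0 < b) (hb2 : b ≤ 2) (n : ℕ) (x v : ℝ)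
    (hx1 : b ≤ 1 + x) (hx2 : x < 1) (hv : 0 < v) (hvx : v ^ 2 = 1 - x)
    (hn : ((n : ℝ) + 1) / 4 ≤ (n + α + β + 2) / 2)
    (hK : 4 * LL α β / b ≤ ((n : ℝ) + 1) * v) :
    rr α β x * (((n : ℝ) + 1) * JJ α β (n + 1) x ^ 2) ≤ EE α β n x ∧
    rr α β x * (b / 4 * (((n : ℝ) + 1) * v) * |JJ α β (n + 1) x * JJ (α + 1) (β + 1) n x|)
      ≤ EE α β n x := by
  have p1 : 0 < 1 - x := by linarith
  have p2 : 0 < 1 + x := by linarith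
  have hr : 0 ≤ rr α β x := by unfold rr; positivity
  obtain ⟨hl, -⟩ := ell_bound α β x (by linarith) hx2
  have hL := LL_pos α β
  have hM : (0 : ℝ) < (n : ℝ) + 1 := by positivity
  unfold EE
  generalize JJ α β (n + 1) x = y at *
  generalize JJ (α + 1) (β + 1) n x = z at *
  generalize ((n : ℝ) + α + β + 2) / 2 = κ at *
  generalize ell α β x = l at *
  generalize LL α β = L at *
  generalize (n : ℝ) + 1 = M at *
  have t1 : M / 4 * (v ^ 2 * b) * z ^ 2 ≤ κ * (1 - x ^ 2) * z ^ 2 := by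
    have : 1 - x ^ 2 = v ^ 2 * (1 + x) := by rw [hvx]; ring
    rw [this]
    have : 0 ≤ κ := by linarith
    gcongr
  have t2 : b / 2 * (M * v) * |y * z| ≤ 2 * M * y ^ 2 + M / 4 * (v ^ 2 * b) * z ^ 2 := by
    rw [abs_mul]
    have h1 : 0 ≤ M * (b / 4) * (|y| - v * |z|) ^ 2 := by positivity
    have h2 : 0 ≤ M * (2 - b / 4) * y ^ 2 := by
      have : 0 ≤ 2 - b / 4 := by linarith
      positivity
    have h3 : (|y| - v * |z|) ^ 2 = y ^ 2 - 2 * v * (|y| * |z|) + v ^ 2 * z ^ 2 := by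
      rw [sub_sq, mul_pow, sq_abs, sq_abs]; ring
    rw [h3] at h1
    linarith
  have t3 : 2 * L * |y * z| ≤ b / 2 * (M * v) * |y * z| := by
    have : 2 * L ≤ b / 2 * (M * v) := by
      rw [div_le_iff₀ hb] at hK; linarith
    gcongr
  have t4 : l * (y * z) ≤ L * |y * z| := by
    calc _ ≤ |l * (y * z)| := le_abs_self _
      _ = |l| * |y * z| := abs_mul _ _
      _ ≤ _ := by gcongr
  constructor
  · gcongr
    have : 0 ≤ M / 4 * (v ^ 2 * b) * z ^ 2 := by positivity
    linarith
  · gcongr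
    linarith

lemma rpow_bdd (b p t : ℝ) (hb : 0 < b) (h1 : b ≤ t) (h2 : t ≤ 2) : t ^ p ≤ b ^ p + 2 ^ p := by
  have q1 : 0 < b ^ p := by positivity
  have q2 : (0 : ℝ) < 2 ^ p := by positivity
  rcases le_total 0 p with hp | hp
  · have := Real.rpow_le_rpow (by linarith) h2 hp
    linarith
  · have := Real.rpow_le_rpow_of_nonpos hb h1 hp
    linarith

lemma EE_mono (α β a : ℝ) (n : ℕ) (ha : -1 < a) (x₀ x : ℝ) (hax : a ≤ x) (hx : x ≤ x₀)
    (hx₀ : x₀ < 1) (hn : ((n : ℝ) + 1) / 4 ≤ (n + α + β + 2) / 2)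
    (hK : 4 * LL α β / (1 + a) ≤ ((n : ℝ) + 1) * √(1 - x₀)) :
    EE α β n x ≤ EE α β n x₀ *
      Real.exp (2 * (4 * LL α β / (1 + a) ^ 2) / ((n + 1) * √(1 - x₀))) := by
  set D := 4 * LL α β / (1 + a) ^ 2 with hD
  have hb : 0 < 1 + a := by linarith
  have hL := LL_pos α β
  have hD0 : 0 < D := by positivity
  have hM : (0 : ℝ) < (n : ℝ) + 1 := by positivity
  let h : ℝ → ℝ := fun t => 2 * D / ((n + 1) * √(1 - t))
  have hlow : ∀ t ∈ Icc a x₀, 0 ≤ EE α β n t ∧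
      (1 - t) ^ (α - 1 / 2) * (1 + t) ^ (β - 1 / 2) *
      (LL α β * |JJ α β (n + 1) t * JJ (α + 1) (β + 1) n t|) ≤
        D / (((n : ℝ) + 1) * (√(1 - t) * (1 - t))) * EE α β n t := by
    intro t ht
    have p1 : 0 < 1 - t := by linarith [ht.2]
    have p2 : 0 < 1 + t := by linarith [ht.1]
    have hv : 0 < √(1 - t) := Real.sqrt_pos.2 p1
    have hv2 : √(1 - t) ^ 2 = 1 - t := Real.sq_sqrt p1.le
    have := EE_lower α β (1 + a) hb (by linarith [ht.1]) n t (√(1 - t)) (by linarith [ht.1])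
      (by linarith [ht.2]) hv hv2 hn (hK.trans (by
        have : √(1 - x₀) ≤ √(1 - t) := Real.sqrt_le_sqrt (by linarith [ht.2])
        gcongr))
    have hr : 0 ≤ rr α β t := by unfold rr; positivity
    have hr0 : rr α β t = (1 - t) ^ (α - 1 / 2) * (1 + t) ^ (β - 1 / 2) * ((1 - t) * (1 + t)) := by
      unfold rr
      rw [show α + 1 / 2 = α - 1 / 2 + 1 by ring, show β + 1 / 2 = β - 1 / 2 + 1 by ring,
        Real.rpow_add_one p1.ne', Real.rpow_add_one p2.ne']
      ring
    refine ⟨le_trans (by positivity) this.1, ?_⟩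
    have h2 := this.2
    rw [hr0] at h2
    have hr1 : 0 ≤ (1 - t) ^ (α - 1 / 2) * (1 + t) ^ (β - 1 / 2) := by positivity
    generalize (1 - t) ^ (α - 1 / 2) * (1 + t) ^ (β - 1 / 2) = r at *
    have hA := abs_nonneg (JJ α β (n + 1) t * JJ (α + 1) (β + 1) n t)
    generalize |JJ α β (n + 1) t * JJ (α + 1) (β + 1) n t| = A at *
    have h3 : r * ((1 - t) * (1 + a)) * ((1 + a) / 4 * (((n : ℝ) + 1) * √(1 - t)) * A)
        ≤ EE α β n t := by
      refine le_trans ?_ h2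
      gcongr
      exact ht.1
    calc r * (LL α β * A) = D / (((n : ℝ) + 1) * (√(1 - t) * (1 - t))) *
          (r * ((1 - t) * (1 + a)) * ((1 + a) / 4 * (((n : ℝ) + 1) * √(1 - t)) * A)) := by
          rw [hD]; field_simp
      _ ≤ _ := by gcongr
  have hder : ∀ t ∈ Icc a x₀, HasDerivAt (fun t => EE α β n t * Real.exp (h t))
      ((-((1 - t) ^ (α - 1 / 2) * (1 + t) ^ (β - 1 / 2)) *
      (((α + β + 1) * (1 - t ^ 2) + ell α β t * t) *
        (JJ α β (n + 1) t * JJ (α + 1) (β + 1) n t)) +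
        D / (((n : ℝ) + 1) * (√(1 - t) * (1 - t))) * EE α β n t) * Real.exp (h t)) t := by
    intro t ht
    have p1 : 0 < 1 - t := by linarith [ht.2]
    have hv : 0 < √(1 - t) := Real.sqrt_pos.2 p1
    have hs : HasDerivAt (fun t : ℝ => √(1 - t)) (-1 / (2 * √(1 - t))) t :=
      HasDerivAt.sqrt (by simpa using (hasDerivAt_id t).const_sub 1) p1.ne'
    have hh : HasDerivAt h (D / (((n : ℝ) + 1) * (√(1 - t) * (1 - t)))) t := by
      refine ((hs.const_mul ((n : ℝ) + 1)).fun_inv (by positivity)).const_mul (2 * D)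
        |>.congr_deriv ?_
      have hv2 : √(1 - t) ^ 2 = 1 - t := Real.sq_sqrt p1.le
      rw [← hv2]
      simp only [Real.sqrt_sq hv.le]
      field_simp
    refine ((EE_deriv α β n t ⟨by linarith [ht.1], by linarith [ht.2]⟩).fun_mul hh.exp).congr_deriv ?_
    ring
  have hmono : MonotoneOn (fun t => EE α β n t * Real.exp (h t)) (Icc a x₀) := by
    refine monotoneOn_of_deriv_nonneg (convex_Icc _ _)
      (fun t ht => (hder t ht).continuousAt.continuousWithinAt)
      (fun t ht => (hder t (interior_subset ht)).differentiableAt.differentiableWithinAt) ?_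
    intro t ht
    have ht := interior_subset ht
    rw [(hder t ht).deriv]
    refine mul_nonneg ?_ (Real.exp_pos _).le
    obtain ⟨-, hl⟩ := hlow t ht
    have p1 : 0 < 1 - t := by linarith [ht.2]
    have p2 : 0 < 1 + t := by linarith [ht.1]
    have h2 := (ell_bound α β t (by linarith) (by linarith)).2
    have hr1 : 0 ≤ (1 - t) ^ (α - 1 / 2) * (1 + t) ^ (β - 1 / 2) := by positivity
    have : (1 - t) ^ (α - 1 / 2) * (1 + t) ^ (β - 1 / 2) *
      (((α + β + 1) * (1 - t ^ 2) + ell α β t * t) *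
        (JJ α β (n + 1) t * JJ (α + 1) (β + 1) n t)) ≤ (1 - t) ^ (α - 1 / 2) * (1 + t) ^ (β - 1 / 2) *
      (LL α β * |JJ α β (n + 1) t * JJ (α + 1) (β + 1) n t|) := by
      refine mul_le_mul_of_nonneg_left ?_ hr1
      refine (le_abs_self _).trans ?_
      rw [abs_mul]
      gcongr
    linarith
  have := hmono ⟨hax, hx⟩ ⟨hax.trans hx, le_rfl⟩ hx
  refine le_trans ?_ this
  have h0 := (hlow x ⟨hax, hx⟩).1
  refine le_mul_of_one_le_right h0 (Real.one_le_exp ?_)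
  simp only [h]
  positivity

lemma EE_start (b K L M y z κ l u R P C1 C2 : ℝ) (hM : 0 < M) (hK : 0 < K)
    (hL : 0 < L) (hR : 0 ≤ R) (hP : 0 < P) (hC1 : 0 < C1) (hC2 : 0 < C2)
    (hy : |y| ≤ C1 * P) (hz : |z| ≤ C2 * (P * M)) (hκ : κ ≤ 2 * M)
    (hl : |l| ≤ L) (hu : u ≤ 2 * (K / M ^ 2)) (hu0 : 0 ≤ u) (hR2 : R * (P ^ 2 * M) ≤ b) :
    R * (2 * M * y ^ 2 + κ * u * z ^ 2 - l * (y * z)) ≤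
      b * (2 * C1 ^ 2 + 4 * K * C2 ^ 2 + L * C1 * C2) := by
  have h1 : y ^ 2 ≤ (C1 * P) ^ 2 := by rw [← sq_abs y]; gcongr
  have h2 : z ^ 2 ≤ (C2 * (P * M)) ^ 2 := by rw [← sq_abs z]; gcongr
  have h3 : -(l * (y * z)) ≤ L * ((C1 * P) * (C2 * (P * M))) := by
    refine (neg_le_abs _).trans ?_
    rw [abs_mul, abs_mul]
    gcongr
  calc R * (2 * M * y ^ 2 + κ * u * z ^ 2 - l * (y * z))
      ≤ R * (2 * M * (C1 * P) ^ 2 + 2 * M * (2 * (K / M ^ 2)) * (C2 * (P * M)) ^ 2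
          + L * ((C1 * P) * (C2 * (P * M)))) := by
        gcongr
        have : 2 * M * y ^ 2 ≤ 2 * M * (C1 * P) ^ 2 := by gcongr
        have : κ * u * z ^ 2 ≤ 2 * M * (2 * (K / M ^ 2)) * (C2 * (P * M)) ^ 2 := by gcongr
        linarith
    _ = R * (P ^ 2 * M) * (2 * C1 ^ 2 + 4 * K * C2 ^ 2 + L * C1 * C2) := by
        field_simp; ring
    _ ≤ _ := by gcongr

set_option maxHeartbeats 1000000 in
lemma bulk1 (α β a : ℝ) (hα : -1 < α) (ha : a ∈ Ioo (-1 : ℝ) 1) :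
    ∃ K : ℝ, 0 < K ∧ ∃ C : ℝ, 0 < C ∧ ∀ᶠ n : ℕ in atTop, ∀ x : ℝ, a ≤ x → x < 1 →
      K ≤ (1 - x) * ((n : ℝ) + 1) ^ 2 →
      |JJ α β (n + 1) x| ≤ C * ((n : ℝ) + 1) ^ (-(1 / 2) : ℝ) * (1 - x) ^ (-(α / 2 + 1 / 4)) := by
  have hb : 0 < 1 + a := by linarith [ha.1]
  have hL := LL_pos α β
  set k := 4 * LL α β / (1 + a) with hk
  have hk0 : 0 < k := by positivity
  set K := k ^ 2 with hK
  have hK0 : 0 < K := by positivity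
  obtain ⟨C1, hC1, e1⟩ := edge_bound α β K hα
  obtain ⟨C2, hC2, e2⟩ := edge_bound (α + 1) (β + 1) K (by linarith)
  set R := (1 + a) ^ (β + 1 / 2) + 2 ^ (β + 1 / 2) with hR
  set S := (1 + a) ^ (-(β + 1 / 2)) + 2 ^ (-(β + 1 / 2)) with hS
  have hR0 : 0 < R := by positivity
  have hS0 : 0 < S := by positivity
  set F := (K ^ (α + 1 / 2) * R * (2 * C1 ^ 2 + 4 * K * C2 ^ 2 + LL α β * C1 * C2)) *
    Real.exp (2 * (4 * LL α β / (1 + a) ^ 2) / k) with hF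
  have hF0 : 0 < F := by positivity
  refine ⟨K, hK0, √(S * F), Real.sqrt_pos.2 (by positivity), ?_⟩
  have t1 : Tendsto (fun n : ℕ => (n : ℝ)) atTop atTop := tendsto_natCast_atTop_atTop
  filter_upwards [(tendsto_add_atTop_nat 1).eventually e1, e2,
    t1.eventually_ge_atTop (2 * (|α| + |β| + 1)), t1.eventually_ge_atTop 1] with n hn1 hn2 hn3 hn5 x hax hx1 hxK
  set M : ℝ := (n : ℝ) + 1 with hM
  have hM0 : 0 < M := by linarith
  have hab1 := neg_abs_le α
  have hab2 := neg_abs_le β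
  have hab3 := le_abs_self α
  have hab4 := le_abs_self β
  set x₀ := 1 - K / M ^ 2 with hx₀
  have hKM : 0 < K / M ^ 2 := by positivity
  have hxx : x ≤ x₀ := by
    rw [hx₀]
    have : K / M ^ 2 ≤ 1 - x := by rw [div_le_iff₀ (by positivity)]; exact hxK
    linarith
  have hx₀1 : x₀ < 1 := by rw [hx₀]; linarith
  have hs : √(1 - x₀) = k / M := by
    rw [hx₀, hK, sub_sub_cancel, ← div_pow, Real.sqrt_sq (by positivity)]
  have hMs : M * √(1 - x₀) = k := by rw [hs]; field_simp
  have hnκ : M / 4 ≤ (n + α + β + 2) / 2 := by linarith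
  have hmono := EE_mono α β a n ha.1 x₀ x hax hxx hx₀1 hnκ (by rw [← hM, hMs])
  rw [← hM, hMs] at hmono
  have p1 : 0 < 1 - x := by linarith
  have p2 : 0 < 1 + x := by linarith
  have hv : 0 < √(1 - x) := Real.sqrt_pos.2 p1
  have hlow := (EE_lower α β (1 + a) hb (by linarith [ha.2]) n x (√(1 - x)) (by linarith)
      hx1 hv (Real.sq_sqrt p1.le) hnκ (by
        rw [← hk, ← hM, ← hMs]
        have : √(1 - x₀) ≤ √(1 - x) := Real.sqrt_le_sqrt (by linarith)
        gcongr)).1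
  have hstart : EE α β n x₀ ≤
      K ^ (α + 1 / 2) * R * (2 * C1 ^ 2 + 4 * K * C2 ^ 2 + LL α β * C1 * C2) := by
    have q1 : -1 ≤ x₀ := by linarith
    have q2 : 0 < 1 + x₀ := by linarith
    unfold EE
    have e0 : 1 - x₀ = K / M ^ 2 := by rw [hx₀]; ring
    have ez : (1 - x₀) * (n : ℝ) ^ 2 ≤ K := by
      rw [e0, div_mul_eq_mul_div, div_le_iff₀ (by positivity)]
      gcongr
      linarith
    have ey : (1 - x₀) * ((n + 1 : ℕ) : ℝ) ^ 2 ≤ K := by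
      push_cast
      rw [← hM, e0]
      apply le_of_eq
      field_simp
    refine EE_start _ K (LL α β) M _ _ _ _ _ _ (M ^ α) C1 C2 hM0 hK0 hL ?_ (by positivity)
      hC1 hC2 ?_ ?_ (by linarith) (ell_bound α β x₀ (by linarith) hx₀1).1 ?_ ?_ ?_
    · have : 0 < 1 - x₀ := by linarith
      unfold rr; positivity
    · have := hn1 x₀ q1 hx₀1.le ey
      push_cast at this
      exact this
    · refine (hn2 x₀ q1 hx₀1.le ez).trans ?_
      rw [← Real.rpow_add_one hM0.ne']
      gcongr
      · linarith
      · linarith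
    · rw [show 1 - x₀ ^ 2 = (1 - x₀) * (1 + x₀) by ring, e0, mul_comm]
      gcongr
      linarith
    · rw [show 1 - x₀ ^ 2 = (1 - x₀) * (1 + x₀) by ring, e0]
      positivity
    · unfold rr
      rw [e0, Real.div_rpow hK0.le (by positivity)]
      have r1 := rpow_bdd (1 + a) (β + 1 / 2) (1 + x₀) hb (by linarith) (by linarith)
      have r2 : (M ^ α) ^ 2 * M = (M ^ 2) ^ (α + 1 / 2) := by
        rw [← Real.rpow_natCast, ← Real.rpow_natCast, ← Real.rpow_mul hM0.le, ← Real.rpow_mul hM0.le,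
          ← Real.rpow_add_one hM0.ne']
        congr 1; push_cast; ring
      rw [r2]
      calc _ = K ^ (α + 1 / 2) * (1 + x₀) ^ (β + 1 / 2) := by field_simp
        _ ≤ _ := by gcongr
  have hmain : rr α β x * (M * JJ α β (n + 1) x ^ 2) ≤ F := by
    refine hlow.trans (hmono.trans ?_)
    rw [hF]
    gcongr
  have hrlow : (1 - x) ^ (α + 1 / 2) ≤ S * rr α β x := by
    unfold rr
    have r1 := rpow_bdd (1 + a) (-(β + 1 / 2)) (1 + x) hb (by linarith) (by linarith)
    rw [Real.rpow_neg p2.le] at r1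
    have r3 : 1 ≤ S * (1 + x) ^ (β + 1 / 2) := by
      rwa [inv_le_iff_one_le_mul₀ (by positivity)] at r1
    calc _ ≤ (1 - x) ^ (α + 1 / 2) * (S * (1 + x) ^ (β + 1 / 2)) :=
          le_mul_of_one_le_right (by positivity) r3
      _ = _ := by ring
  have hfin : (1 - x) ^ (α + 1 / 2) * M * JJ α β (n + 1) x ^ 2 ≤ S * F := by
    calc _ ≤ S * rr α β x * M * JJ α β (n + 1) x ^ 2 := by gcongr
      _ = S * (rr α β x * (M * JJ α β (n + 1) x ^ 2)) := by ring
      _ ≤ _ := by gcongr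
  refine abs_le_of_sq_le_sq ?_ (by positivity)
  rw [mul_pow, mul_pow, Real.sq_sqrt (by positivity)]
  have w1 : (M ^ (-(1 / 2) : ℝ)) ^ 2 = M⁻¹ := by
    rw [← Real.rpow_natCast, ← Real.rpow_mul hM0.le, ← Real.rpow_neg_one]
    congr 1; push_cast; ring
  have w2 : ((1 - x) ^ (-(α / 2 + 1 / 4))) ^ 2 = ((1 - x) ^ (α + 1 / 2))⁻¹ := by
    rw [← Real.rpow_natCast, ← Real.rpow_mul p1.le, ← Real.rpow_neg p1.le]
    congr 1; push_cast; ring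
  rw [w1, w2]
  have hpp : 0 < (1 - x) ^ (α + 1 / 2) := by positivity
  rw [mul_assoc, ← mul_inv, ← div_eq_mul_inv, le_div_iff₀ (by positivity)]
  linarith

/-- Bulk bound, uniform on `c ≤ n²(1-x)`, `x ∈ [a,1)`, with an index shift `j`. -/
lemma bulk (α β a c : ℝ) (hα : -1 < α) (ha : a ∈ Ioo (-1 : ℝ) 1) (hc : 0 < c) :
    ∃ C : ℝ, 0 < C ∧ ∀ᶠ n : ℕ in atTop, ∀ x : ℝ, a ≤ x → x < 1 →
      c ≤ (1 - x) * (n : ℝ) ^ 2 →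
      |JJ α β n x| ≤ C * (n : ℝ) ^ (-(1 / 2) : ℝ) * (1 - x) ^ (-(α / 2 + 1 / 4)) := by
  obtain ⟨K, hK, C, hC, h⟩ := bulk1 α β a hα ha
  obtain ⟨C1, hC1, e1⟩ := edge_bound α β K hα
  set p := α / 2 + 1 / 4 with hp
  set T := c ^ p + K ^ p with hT
  have hT0 : 0 < T := by positivity
  refine ⟨max C (C1 * T), lt_max_of_lt_left hC, ?_⟩
  obtain ⟨N, hN⟩ := eventually_atTop.1 h
  filter_upwards [e1, eventually_ge_atTop (N + 1)] with n hn1 hn2 x hax hx1 hxc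
  have p1 : 0 < 1 - x := by linarith
  obtain ⟨m, rfl⟩ : ∃ m, n = m + 1 := ⟨n - 1, by omega⟩
  have hM0 : (0 : ℝ) < ((m + 1 : ℕ) : ℝ) := by positivity
  rcases le_total K ((1 - x) * ((m + 1 : ℕ) : ℝ) ^ 2) with h1 | h1
  · have := hN m (by omega) x hax hx1 (by push_cast at h1; exact h1)
    push_cast
    refine this.trans ?_
    gcongr
    exact le_max_left _ _
  · refine (hn1 x (by linarith [ha.1]) hx1.le h1).trans ?_
    generalize ((m + 1 : ℕ) : ℝ) = M at *
    have e : M ^ α = M ^ (-(1 / 2) : ℝ) * (1 - x) ^ (-p) * ((1 - x) * M ^ 2) ^ p := by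
      rw [Real.mul_rpow p1.le (by positivity), Real.rpow_neg p1.le, ← Real.rpow_natCast,
        ← Real.rpow_mul hM0.le]
      have : (1 - x) ^ p ≠ 0 := by positivity
      field_simp
      rw [← Real.rpow_add hM0]
      congr 1; rw [hp]; push_cast; ring
    have hle : ((1 - x) * M ^ 2) ^ p ≤ T := by
      have q1 : 0 < c ^ p := by positivity
      have q2 : 0 < K ^ p := by positivity
      rcases le_total 0 p with hp | hp
      · have := Real.rpow_le_rpow (by positivity) h1 hp
        linarith
      · have := Real.rpow_le_rpow_of_nonpos hc hxc hp
        linarith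
    rw [e]
    calc _ ≤ C1 * (M ^ (-(1 / 2) : ℝ) * (1 - x) ^ (-p) * T) := by gcongr
      _ = (C1 * T) * M ^ (-(1 / 2) : ℝ) * (1 - x) ^ (-p) := by ring
      _ ≤ _ := by gcongr; exact le_max_right _ _

lemma bulk_shift (α β a : ℝ) (hα : -1 < α) (ha : a ∈ Ioo (-1 : ℝ) 1) (j : ℕ) :
    ∃ C : ℝ, 0 < C ∧ ∀ᶠ m : ℕ in atTop, ∀ x : ℝ, a ≤ x → x < 1 →
      1 ≤ (1 - x) * ((m : ℝ) + 2) ^ 2 →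
      |(1 - x) ^ α * (1 + x) ^ β * JJ α β (m + j) x| ≤
        C * ((m : ℝ) + 2) ^ (-(1 / 2) : ℝ) * (1 - x) ^ (α / 2 - 1 / 4) := by
  obtain ⟨C, hC, h⟩ := bulk α β a (1 / 9) hα ha (by norm_num)
  have hb : 0 < 1 + a := by linarith [ha.1]
  set R := (1 + a) ^ β + 2 ^ β with hR
  have hR0 : 0 < R := by positivity
  refine ⟨C * R * 3 ^ (1 / 2 : ℝ), by positivity, ?_⟩
  filter_upwards [(tendsto_add_atTop_nat j).eventually h, eventually_ge_atTop 1] with m hm hm1 x hax hx1 hx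
  have hmR : (1 : ℝ) ≤ m := by exact_mod_cast hm1
  have hj : (0 : ℝ) ≤ j := by positivity
  have p1 : 0 < 1 - x := by linarith
  have p2 : 0 < 1 + x := by linarith
  have hM : ((m : ℝ) + 2) / 3 ≤ ((m + j : ℕ) : ℝ) := by push_cast; linarith
  have hm2 := hm x hax hx1 (by
    have : (1 - x) * (((m : ℝ) + 2) / 3) ^ 2 ≤ (1 - x) * ((m + j : ℕ) : ℝ) ^ 2 := by gcongr
    refine le_trans ?_ this
    rw [div_pow]
    linarith)
  have r1 := rpow_bdd (1 + a) β (1 + x) hb (by linarith) (by linarith)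
  have r2 : ((m + j : ℕ) : ℝ) ^ (-(1 / 2) : ℝ) ≤ ((m : ℝ) + 2) ^ (-(1 / 2) : ℝ) * 3 ^ (1 / 2 : ℝ) := by
    refine (Real.rpow_le_rpow_of_nonpos (by positivity) hM (by norm_num)).trans (le_of_eq ?_)
    rw [Real.div_rpow (by positivity) (by norm_num), Real.rpow_neg (by norm_num : (0 : ℝ) ≤ 3)]
    field_simp
  have r3 : (1 - x) ^ α * (1 - x) ^ (-(α / 2 + 1 / 4)) = (1 - x) ^ (α / 2 - 1 / 4) := by
    rw [← Real.rpow_add p1]; congr 1; ring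
  rw [abs_mul, abs_of_pos (by positivity : 0 < (1 - x) ^ α * (1 + x) ^ β)]
  calc _ ≤ (1 - x) ^ α * R * (C * (((m : ℝ) + 2) ^ (-(1 / 2) : ℝ) * 3 ^ (1 / 2 : ℝ)) *
        (1 - x) ^ (-(α / 2 + 1 / 4))) := by
        gcongr
        refine hm2.trans ?_
        gcongr
    _ = C * R * 3 ^ (1 / 2 : ℝ) * ((m : ℝ) + 2) ^ (-(1 / 2) : ℝ) *
        ((1 - x) ^ α * (1 - x) ^ (-(α / 2 + 1 / 4))) := by ring
    _ = _ := by rw [r3]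

/-- Antiderivatives of the weighted Jacobi polynomial with bounds. -/
lemma antideriv (α β a : ℝ) (hα : -1 < α) (ha : a ∈ Ioo (-1 : ℝ) 1) :
    ∃ C : ℝ, 0 < C ∧ ∀ᶠ n : ℕ in atTop, ∃ R1 R2 : ℝ → ℝ,
      (∀ x ∈ Ioo (-1 : ℝ) 1, HasDerivAt R1 ((1 - x) ^ α * (1 + x) ^ β * JJ α β n x) x) ∧
      (∀ x ∈ Ioo (-1 : ℝ) 1, HasDerivAt R2 (R1 x) x) ∧
      ∀ x : ℝ, a ≤ x → x < 1 → 1 ≤ (1 - x) * (n : ℝ) ^ 2 →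
        |(1 - x) ^ α * (1 + x) ^ β * JJ α β n x| ≤
          C * (n : ℝ) ^ (-(1 / 2) : ℝ) * (1 - x) ^ (α / 2 - 1 / 4) ∧
        |R1 x| ≤ C * (n : ℝ) ^ (-(3 / 2) : ℝ) * (1 - x) ^ (α / 2 + 1 / 4) ∧
        |R2 x| ≤ C * (n : ℝ) ^ (-(5 / 2) : ℝ) * (1 - x) ^ (α / 2 + 3 / 4) := by
  obtain ⟨C0, hC0, h0⟩ := bulk_shift α β a hα ha 2
  obtain ⟨C1, hC1, h1⟩ := bulk_shift (α + 1) (β + 1) a (by linarith) ha 1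
  obtain ⟨C2, hC2, h2⟩ := bulk_shift (α + 1 + 1) (β + 1 + 1) a (by linarith) ha 0
  refine ⟨C0 + C1 + C2, by positivity, ?_⟩
  have hall := (h0.and (h1.and h2)).and (eventually_ge_atTop 1)
  obtain ⟨N, hN⟩ := eventually_atTop.1 hall
  filter_upwards [eventually_ge_atTop (N + 2)] with n hn
  obtain ⟨m, rfl⟩ : ∃ m, n = m + 2 := ⟨n - 2, by omega⟩
  obtain ⟨⟨g0, g1, g2⟩, hm1⟩ := hN m (by omega)
  have hmR : (1 : ℝ) ≤ m := by exact_mod_cast hm1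
  have d1 : ((m : ℝ) + 2) ≠ 0 := by positivity
  have d2 : ((m : ℝ) + 1) ≠ 0 := by positivity
  refine ⟨fun x => (-(1 / (2 * ((m : ℝ) + 2)))) *
      ((1 - x) ^ (α + 1) * (1 + x) ^ (β + 1) * JJ (α + 1) (β + 1) (m + 1) x),
    fun x => (1 / (2 * ((m : ℝ) + 2)) * (1 / (2 * ((m : ℝ) + 1)))) *
      ((1 - x) ^ (α + 1 + 1) * (1 + x) ^ (β + 1 + 1) * JJ (α + 1 + 1) (β + 1 + 1) m x), ?_, ?_, ?_⟩
  · intro x hx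
    refine ((wJJ_deriv α β (m + 1) x hx).const_mul _).congr_deriv ?_
    push_cast
    rw [show m + 1 + 1 = m + 2 by ring]
    have : (m : ℝ) + 1 + 1 = m + 2 := by ring
    rw [this]
    field_simp
  · intro x hx
    refine ((wJJ_deriv (α + 1) (β + 1) m x hx).const_mul _).congr_deriv ?_
    field_simp
  · intro x hax hx1 hx
    push_cast at hx ⊢
    have p1 : 0 < 1 - x := by linarith
    have b0 := g0 x hax hx1 hx
    have b1 := g1 x hax hx1 hx
    have b2 := g2 x hax hx1 hx
    have hM : (0 : ℝ) < (m : ℝ) + 2 := by positivity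
    rw [show (α + 1) / 2 - 1 / 4 = α / 2 + 1 / 4 by ring] at b1
    rw [show (α + 1 + 1) / 2 - 1 / 4 = α / 2 + 3 / 4 by ring, add_zero] at b2
    have i1 : |-(1 / (2 * ((m : ℝ) + 2)))| ≤ ((m : ℝ) + 2) ^ (-1 : ℝ) := by
      rw [abs_neg, abs_of_pos (by positivity), Real.rpow_neg_one, one_div]
      gcongr
      linarith
    have i2 : |1 / (2 * ((m : ℝ) + 2)) * (1 / (2 * ((m : ℝ) + 1)))| ≤ ((m : ℝ) + 2) ^ (-2 : ℝ) := by
      rw [abs_of_pos (by positivity), Real.rpow_neg hM.le, Real.rpow_two, div_mul_div_comm, one_mul,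
        one_div]
      gcongr
      nlinarith
    refine ⟨b0.trans ?_, ?_, ?_⟩
    · gcongr; linarith
    · rw [abs_mul]
      calc _ ≤ ((m : ℝ) + 2) ^ (-1 : ℝ) *
            (C1 * ((m : ℝ) + 2) ^ (-(1 / 2) : ℝ) * (1 - x) ^ (α / 2 + 1 / 4)) := by gcongr
        _ = C1 * (((m : ℝ) + 2) ^ (-1 : ℝ) * ((m : ℝ) + 2) ^ (-(1 / 2) : ℝ)) *
            (1 - x) ^ (α / 2 + 1 / 4) := by ring
        _ = C1 * ((m : ℝ) + 2) ^ (-(3 / 2) : ℝ) * (1 - x) ^ (α / 2 + 1 / 4) := by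
            rw [← Real.rpow_add hM]; norm_num
        _ ≤ _ := by gcongr; linarith
    · rw [abs_mul]
      calc _ ≤ ((m : ℝ) + 2) ^ (-2 : ℝ) *
            (C2 * ((m : ℝ) + 2) ^ (-(1 / 2) : ℝ) * (1 - x) ^ (α / 2 + 3 / 4)) := by gcongr
        _ = C2 * (((m : ℝ) + 2) ^ (-2 : ℝ) * ((m : ℝ) + 2) ^ (-(1 / 2) : ℝ)) *
            (1 - x) ^ (α / 2 + 3 / 4) := by ring
        _ = C2 * ((m : ℝ) + 2) ^ (-(5 / 2) : ℝ) * (1 - x) ^ (α / 2 + 3 / 4) := by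
            rw [← Real.rpow_add hM]; norm_num
        _ ≤ _ := by gcongr; linarith

lemma comb (f : ℝ → ℝ) (a e b S T : ℝ) (hae : a ≤ e) (heb : e ≤ b)
    (hf : IntervalIntegrable f volume a b)
    (hS : ∀ c d, a ≤ c → c ≤ d → d ≤ e → |∫ t in c..d, f t| ≤ S)
    (hT : ∀ c d, e ≤ c → c ≤ d → d ≤ b → |∫ t in c..d, f t| ≤ T) :
    ∀ c d, a ≤ c → c ≤ d → d ≤ b → |∫ t in c..d, f t| ≤ S + T := by
  intro c d hac hcd hdb
  have S0 : 0 ≤ S := (abs_nonneg _).trans (hS a a le_rfl le_rfl hae)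
  have T0 : 0 ≤ T := (abs_nonneg _).trans (hT e e le_rfl le_rfl heb)
  rcases le_total d e with h | h
  · linarith [hS c d hac hcd h]
  rcases le_total e c with h' | h'
  · linarith [hT c d h' hcd hdb]
  have i1 : IntervalIntegrable f volume c e := hf.mono_set (by
    rw [uIcc_of_le h', uIcc_of_le (by linarith)]; exact Icc_subset_Icc hac heb)
  have i2 : IntervalIntegrable f volume e d := hf.mono_set (by
    rw [uIcc_of_le h, uIcc_of_le (by linarith)]; exact Icc_subset_Icc hae hdb)
  rw [← intervalIntegral.integral_add_adjacent_intervals i1 i2]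
  have := hS c e hac h' le_rfl
  have := hT e d le_rfl h hdb
  exact (abs_add_le _ _).trans (by linarith)

lemma ii_left (a γ c d : ℝ) (hγ : -1 < γ) :
    IntervalIntegrable (fun t : ℝ => (t - a) ^ γ) volume c d := by
  have := (intervalIntegral.intervalIntegrable_rpow' (a := c - a) (b := d - a) hγ).comp_sub_right a
  simpa using this

lemma ii_right (δ c d : ℝ) (hδ : -1 < δ) :
    IntervalIntegrable (fun t : ℝ => (1 - t) ^ δ) volume c d := by
  have := (intervalIntegral.intervalIntegrable_rpow' (a := 1 - c) (b := 1 - d) hδ).comp_sub_left 1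
  simpa using this

lemma int_left (a γ c d : ℝ) (h : -1 < γ ∨ γ ≠ -1 ∧ (0 : ℝ) ∉ uIcc (c - a) (d - a)) :
    ∫ t in c..d, (t - a) ^ γ = ((d - a) ^ (γ + 1) - (c - a) ^ (γ + 1)) / (γ + 1) := by
  rw [intervalIntegral.integral_comp_sub_right (fun t : ℝ => t ^ γ), integral_rpow h]

lemma int_right (δ c d : ℝ) (h : -1 < δ ∨ δ ≠ -1 ∧ (0 : ℝ) ∉ uIcc (1 - d) (1 - c)) :
    ∫ t in c..d, (1 - t) ^ δ = ((1 - c) ^ (δ + 1) - (1 - d) ^ (δ + 1)) / (δ + 1) := by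
  rw [intervalIntegral.integral_comp_sub_left (fun t : ℝ => t ^ δ), integral_rpow h]

lemma abs_int_le (f g : ℝ → ℝ) (c d : ℝ) (h : c ≤ d) (hfg : ∀ t ∈ Ioo c d, |f t| ≤ g t)
    (hg : IntervalIntegrable g volume c d) : |∫ t in c..d, f t| ≤ ∫ t in c..d, g t := by
  rw [← Real.norm_eq_abs]
  refine intervalIntegral.norm_integral_le_of_norm_le h ?_ hg
  have : ∀ᵐ t : ℝ, t ≠ d := by simp [ae_iff, measure_singleton]
  filter_upwards [this] with t ht1 ht
  exact hfg t ⟨ht.1, lt_of_le_of_ne ht.2 ht1⟩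

lemma small_left (f : ℝ → ℝ) (a γ A ε c d : ℝ) (hγ : -1 < γ) (hA : 0 ≤ A) (hac : a ≤ c)
    (hcd : c ≤ d) (hd : d ≤ a + ε) (hf : ∀ t ∈ Ioo c d, |f t| ≤ A * (t - a) ^ γ) :
    |∫ t in c..d, f t| ≤ A * (ε ^ (γ + 1) / (γ + 1)) := by
  refine (abs_int_le f _ c d hcd hf ((ii_left a γ c d hγ).const_mul A)).trans ?_
  rw [intervalIntegral.integral_const_mul, int_left _ _ _ _ (Or.inl hγ)]
  have h1 : 0 < γ + 1 := by linarith
  have h2 : 0 ≤ (c - a) ^ (γ + 1) := Real.rpow_nonneg (by linarith) _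
  have h3 : (d - a) ^ (γ + 1) ≤ ε ^ (γ + 1) :=
    Real.rpow_le_rpow (by linarith) (by linarith) h1.le
  gcongr
  linarith

lemma small_right (f : ℝ → ℝ) (δ A ε c d : ℝ) (hδ : -1 < δ) (hA : 0 ≤ A) (hd : d ≤ 1)
    (hcd : c ≤ d) (hc : 1 - ε ≤ c) (hf : ∀ t ∈ Ioo c d, |f t| ≤ A * (1 - t) ^ δ) :
    |∫ t in c..d, f t| ≤ A * (ε ^ (δ + 1) / (δ + 1)) := by
  refine (abs_int_le f _ c d hcd hf ((ii_right δ c d hδ).const_mul A)).trans ?_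
  rw [intervalIntegral.integral_const_mul, int_right _ _ _ (Or.inl hδ)]
  have h1 : 0 < δ + 1 := by linarith
  have h2 : 0 ≤ (1 - d) ^ (δ + 1) := Real.rpow_nonneg (by linarith) _
  have h3 : (1 - c) ^ (δ + 1) ≤ ε ^ (δ + 1) :=
    Real.rpow_le_rpow (by linarith) (by linarith) h1.le
  gcongr
  linarith

/-- Away from the left endpoint: one integration by parts. -/
lemma large_left (φ φ' Q R : ℝ → ℝ) (a γ B A ε c d : ℝ) (hγ : -1 < γ) (hB : 0 ≤ B) (hA : 0 ≤ A)
    (hε : 0 < ε) (hc : a + ε ≤ c) (hcd : c ≤ d) (hd : d ≤ a + 2)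
    (hφ : ∀ t ∈ Icc c d, HasDerivAt φ (φ' t) t) (hφc : ContinuousOn φ' (Icc c d))
    (hφB : ∀ t ∈ Icc c d, |φ t| ≤ B) (hφB' : ∀ t ∈ Icc c d, |φ' t| ≤ B)
    (hR : ∀ t ∈ Icc c d, HasDerivAt R (Q t) t) (hQ : ContinuousOn Q (Icc c d))
    (hRA : ∀ t ∈ Icc c d, |R t| ≤ A) :
    |∫ t in c..d, (t - a) ^ γ * φ t * Q t| ≤
      A * B * (4 * (ε ^ γ + 2 ^ γ) + 2 ^ (γ + 1) / (γ + 1)) := by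
  have hpos : ∀ t ∈ Icc c d, 0 < t - a := fun t ht => by linarith [ht.1]
  have hder : ∀ t ∈ Icc c d, HasDerivAt (fun t => (t - a) ^ γ * φ t)
      (γ * (t - a) ^ (γ - 1) * φ t + (t - a) ^ γ * φ' t) t := by
    intro t ht
    have h1 : HasDerivAt (fun t : ℝ => t - a) 1 t := (hasDerivAt_id t).sub_const a
    refine ((h1.rpow_const (p := γ) (Or.inl (hpos t ht).ne')).fun_mul (hφ t ht)).congr_deriv ?_
    ring
  have hcφ : ContinuousOn φ (Icc c d) := fun t ht => (hφ t ht).continuousAt.continuousWithinAt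
  have hcR : ContinuousOn R (Icc c d) := fun t ht => (hR t ht).continuousAt.continuousWithinAt
  have hcp : ∀ p : ℝ, ContinuousOn (fun t : ℝ => (t - a) ^ p) (Icc c d) := fun p =>
    ContinuousOn.rpow_const (by fun_prop) (fun t ht => Or.inl (hpos t ht).ne')
  have hcu' : ContinuousOn (fun t => γ * (t - a) ^ (γ - 1) * φ t + (t - a) ^ γ * φ' t) (Icc c d) :=
    ((continuousOn_const.mul (hcp _)).mul hcφ).add ((hcp _).mul hφc)
  rw [← uIcc_of_le hcd] at hder hR hcu' hQ
  rw [intervalIntegral.integral_mul_deriv_eq_deriv_mul hder hR hcu'.intervalIntegrable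
    hQ.intervalIntegrable]
  have hu : ∀ t ∈ Icc c d, (t - a) ^ γ ≤ ε ^ γ + 2 ^ γ := fun t ht =>
    rpow_bdd ε γ (t - a) hε (by linarith [ht.1]) (by linarith [ht.2])
  have hbd : ∀ t ∈ Icc c d, |(t - a) ^ γ * φ t * R t| ≤ A * B * (ε ^ γ + 2 ^ γ) := by
    intro t ht
    have := hpos t ht
    rw [abs_mul, abs_mul, abs_of_pos (by positivity : 0 < (t - a) ^ γ)]
    calc _ ≤ (ε ^ γ + 2 ^ γ) * B * A := by
          gcongr
          · exact hu t ht
          · exact hφB t ht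
          · exact hRA t ht
      _ = _ := by ring
  have hIntg : |∫ t in c..d, (γ * (t - a) ^ (γ - 1) * φ t + (t - a) ^ γ * φ' t) * R t| ≤
      A * B * (2 * (ε ^ γ + 2 ^ γ) + 2 ^ (γ + 1) / (γ + 1)) := by
    have hi1 : IntervalIntegrable (fun t : ℝ => |γ| * (t - a) ^ (γ - 1)) volume c d := by
      apply ContinuousOn.intervalIntegrable
      rw [uIcc_of_le hcd]
      exact continuousOn_const.mul (hcp _)
    have hi2 := ii_left a γ c d hγ
    refine (abs_int_le _ (fun t => A * B * (|γ| * (t - a) ^ (γ - 1) + (t - a) ^ γ)) c d hcd ?_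
      ((hi1.add hi2).const_mul _)).trans ?_
    · intro t ht
      have ht := Ioo_subset_Icc_self ht
      have := hpos t ht
      rw [abs_mul]
      have h1 : |γ * (t - a) ^ (γ - 1) * φ t| ≤ |γ| * (t - a) ^ (γ - 1) * B := by
        rw [abs_mul, abs_mul, abs_of_pos (by positivity : 0 < (t - a) ^ (γ - 1))]
        gcongr; exact hφB t ht
      have h2 : |(t - a) ^ γ * φ' t| ≤ (t - a) ^ γ * B := by
        rw [abs_mul, abs_of_pos (by positivity : 0 < (t - a) ^ γ)]
        gcongr; exact hφB' t ht
      have h3 := abs_add_le (γ * (t - a) ^ (γ - 1) * φ t) ((t - a) ^ γ * φ' t)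
      calc _ ≤ (|γ| * (t - a) ^ (γ - 1) * B + (t - a) ^ γ * B) * A := by
            gcongr
            · linarith
            · exact hRA t ht
        _ = _ := by ring
    · rw [intervalIntegral.integral_const_mul, intervalIntegral.integral_add hi1 hi2,
        intervalIntegral.integral_const_mul, int_left a γ _ _ (Or.inl hγ)]
      have hc' := hpos c ⟨le_rfl, hcd⟩
      have hd' := hpos d ⟨hcd, le_rfl⟩
      have k1 : |γ| * ∫ t in c..d, (t - a) ^ (γ - 1) ≤ 2 * (ε ^ γ + 2 ^ γ) := by
        rcases eq_or_ne γ 0 with h0 | h0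
        · simp [h0]
        · rw [int_left a (γ - 1) _ _ (Or.inr ⟨by intro h; apply h0; linarith, by
            rw [uIcc_of_le (by linarith)]; intro h; linarith [h.1]⟩), sub_add_cancel]
          have u1 := hu c ⟨le_rfl, hcd⟩
          have u2 := hu d ⟨hcd, le_rfl⟩
          have v1 : 0 < (c - a) ^ γ := by positivity
          have v2 : 0 < (d - a) ^ γ := by positivity
          refine (le_abs_self _).trans ?_
          rw [abs_mul, abs_abs, abs_div, mul_div_cancel₀ _ (abs_ne_zero.2 h0)]
          rw [abs_le]; constructor <;> linarith
      have k2 : ((d - a) ^ (γ + 1) - (c - a) ^ (γ + 1)) / (γ + 1) ≤ 2 ^ (γ + 1) / (γ + 1) := by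
        have h1 : 0 < γ + 1 := by linarith
        have h2 : 0 ≤ (c - a) ^ (γ + 1) := Real.rpow_nonneg (by linarith) _
        have h3 : (d - a) ^ (γ + 1) ≤ 2 ^ (γ + 1) :=
          Real.rpow_le_rpow (by linarith) (by linarith) h1.le
        gcongr
        linarith
      gcongr
  have e1 := hbd d ⟨hcd, le_rfl⟩
  have e2 := hbd c ⟨le_rfl, hcd⟩
  rw [abs_le] at *
  constructor <;> linarith [e1.1, e1.2, e2.1, e2.2, hIntg.1, hIntg.2]

lemma inv_sq_rpow (n p : ℝ) (hn : 1 ≤ n) : ((n ^ 2)⁻¹) ^ p = n ^ (-2 * p) := by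
  have h0 : 0 < n := by linarith
  rw [← Real.rpow_natCast, ← Real.rpow_neg h0.le, ← Real.rpow_mul h0.le]
  norm_num

lemma u_half (n u : ℝ) (hn : 1 ≤ n) (hu : 1 ≤ u * n ^ 2) : u ^ (-(1 / 2) : ℝ) ≤ n := by
  have h0 : 0 < n := by linarith
  have h1 : (n ^ 2)⁻¹ ≤ u := by
    rw [inv_le_iff_one_le_mul₀ (by positivity)]; exact hu
  have h2 := Real.rpow_le_rpow_of_nonpos (by positivity) h1 (by norm_num : (-(1 / 2) : ℝ) ≤ 0)
  rw [inv_sq_rpow n _ hn] at h2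
  norm_num at h2 ⊢
  exact h2

lemma u_pos (n u : ℝ) (hu : 1 ≤ u * n ^ 2) : 0 < u := by
  by_contra h
  nlinarith [mul_nonneg (neg_nonneg.2 (not_lt.1 h)) (sq_nonneg n)]

lemma int_e (e : ℝ) : ∃ K : ℝ, 0 < K ∧ ∀ n c d : ℝ, 1 ≤ n → -1 ≤ c → c ≤ d →
    1 ≤ (1 - d) * n ^ 2 →
    ∫ t in c..d, (1 - t) ^ (e - 3 / 2) ≤ K * (n * (1 + n ^ (-2 * e))) := by
  rcases lt_or_ge e (1 / 4) with he | he
  · refine ⟨1 / (1 / 2 - e), by apply one_div_pos.2; linarith, ?_⟩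
    intro n c d hn hc hcd hd
    have h0 : 0 < n := by linarith
    have hp := u_pos _ _ hd
    rw [int_right _ _ _ (Or.inr ⟨by intro h; linarith, by
      rw [uIcc_of_le (by linarith)]; intro h; linarith [h.1]⟩)]
    have e1 : e - 3 / 2 + 1 = -(1 / 2 - e) := by ring
    rw [e1, div_neg, ← neg_div, neg_sub]
    have h1 : (n ^ 2)⁻¹ ≤ 1 - d := by
      rw [inv_le_iff_one_le_mul₀ (by positivity)]; exact hd
    have h2 := Real.rpow_le_rpow_of_nonpos (by positivity) h1 (by linarith : (-(1 / 2 - e) : ℝ) ≤ 0)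
    rw [inv_sq_rpow n _ hn] at h2
    have h3 : n ^ (-2 * -(1 / 2 - e)) = n * n ^ (-2 * e) := by
      rw [show -2 * -(1 / 2 - e) = 1 + -2 * e by ring, Real.rpow_add h0, Real.rpow_one]
    have h4 : 0 ≤ (1 - c) ^ (-(1 / 2 - e)) := Real.rpow_nonneg (by linarith) _
    rw [div_eq_mul_inv, mul_comm, ← one_div]
    have : 0 < 1 / (1 / 2 - e) := by apply one_div_pos.2; linarith
    gcongr
    linarith
  · refine ⟨2 ^ (e - 1 / 4) * (2 ^ (1 / 4 : ℝ) / (1 / 4)), by positivity, ?_⟩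
    intro n c d hn hc hcd hd
    have h0 : 0 < n := by linarith
    have hp := u_pos _ _ hd
    have hb : |∫ t in c..d, (1 - t) ^ (e - 3 / 2)| ≤
        ∫ t in c..d, 2 ^ (e - 1 / 4) * n * (1 - t) ^ (-(3 / 4) : ℝ) := by
      apply abs_int_le _ _ _ _ hcd _ ((ii_right _ _ _ (by norm_num)).const_mul _)
      intro t ht
      have hu : 0 < 1 - t := by linarith [ht.2]
      rw [abs_of_pos (by positivity)]
      rw [show e - 3 / 2 = (e - 1 / 4) + -(1 / 2) + -(3 / 4) by ring, Real.rpow_add hu,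
        Real.rpow_add hu]
      have k1 : (1 - t) ^ (e - 1 / 4) ≤ 2 ^ (e - 1 / 4) :=
        Real.rpow_le_rpow hu.le (by linarith [ht.1]) (by linarith)
      have k2 := u_half n (1 - t) hn (hd.trans (by gcongr; linarith [ht.2]))
      gcongr
    refine (le_abs_self _).trans (hb.trans ?_)
    rw [intervalIntegral.integral_const_mul, int_right _ _ _ (Or.inl (by norm_num)),
      show (-(3 / 4) + 1 : ℝ) = 1 / 4 by norm_num]
    have h3 : (1 - c) ^ (1 / 4 : ℝ) ≤ 2 ^ (1 / 4 : ℝ) :=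
      Real.rpow_le_rpow (by linarith) (by linarith) (by norm_num)
    have h4 : 0 ≤ (1 - d) ^ (1 / 4 : ℝ) := Real.rpow_nonneg (by linarith) _
    have h5 : 0 < n ^ (-2 * e) := by positivity
    calc _ ≤ 2 ^ (e - 1 / 4) * n * (2 ^ (1 / 4 : ℝ) / (1 / 4)) := by
            gcongr; linarith
      _ = 2 ^ (e - 1 / 4) * (2 ^ (1 / 4 : ℝ) / (1 / 4)) * (n * 1) := by ring
      _ ≤ _ := by gcongr; linarith

/-- Away from the right endpoint: two integrations by parts. -/
lemma large_right (σ α : ℝ) : ∃ K : ℝ, 0 < K ∧ ∀ (f f' f'' Q R1 R2 : ℝ → ℝ) (A B n c d : ℝ),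
    0 ≤ A → 0 ≤ B → 1 ≤ n → -1 ≤ c → c ≤ d → 1 ≤ (1 - d) * n ^ 2 →
    (∀ t ∈ Icc c d, HasDerivAt f (f' t) t) → (∀ t ∈ Icc c d, HasDerivAt f' (f'' t) t) →
    ContinuousOn f'' (Icc c d) →
    (∀ t ∈ Icc c d, |f t| ≤ B * (1 - t) ^ σ) →
    (∀ t ∈ Icc c d, |f' t| ≤ B * (1 - t) ^ (σ - 1)) →
    (∀ t ∈ Icc c d, |f'' t| ≤ B * (1 - t) ^ (σ - 2)) →
    (∀ t ∈ Icc c d, HasDerivAt R1 (Q t) t) → (∀ t ∈ Icc c d, HasDerivAt R2 (R1 t) t) →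
    ContinuousOn Q (Icc c d) →
    (∀ t ∈ Icc c d, |R1 t| ≤ A * n ^ (-(3 / 2) : ℝ) * (1 - t) ^ (α / 2 + 1 / 4)) →
    (∀ t ∈ Icc c d, |R2 t| ≤ A * n ^ (-(5 / 2) : ℝ) * (1 - t) ^ (α / 2 + 3 / 4)) →
    |∫ t in c..d, f t * Q t| ≤
      A * B * K * (n ^ (-(3 / 2) : ℝ) * (1 + n ^ (-2 * (σ + α / 2 + 1 / 4)))) := by
  set e := σ + α / 2 + 1 / 4 with he
  obtain ⟨K, hK, hKe⟩ := int_e e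
  refine ⟨4 * (1 + 2 ^ e) + K, by positivity, ?_⟩
  intro f f' f'' Q R1 R2 A B n c d hA hB hn hc hcd hd hf hf' hcf'' bf bf' bf'' hR1 hR2 hcQ bR1 bR2
  have h0 : 0 < n := by linarith
  have hp := u_pos _ _ hd
  have hpos : ∀ t ∈ Icc c d, 0 < 1 - t := fun t ht => by linarith [ht.2]
  have hun : ∀ t ∈ Icc c d, 1 ≤ (1 - t) * n ^ 2 := fun t ht =>
    hd.trans (by gcongr; exact ht.2)
  have hcf' : ContinuousOn f' (Icc c d) := fun t ht => (hf' t ht).continuousAt.continuousWithinAt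
  have hcR1 : ContinuousOn R1 (Icc c d) := fun t ht => (hR1 t ht).continuousAt.continuousWithinAt
  have nn : n ^ (-(5 / 2) : ℝ) * n = n ^ (-(3 / 2) : ℝ) := by
    nth_rewrite 2 [← Real.rpow_one n]
    rw [← Real.rpow_add h0]; norm_num
  have hue : ∀ t ∈ Icc c d, (1 - t) ^ e ≤ (1 + 2 ^ e) * (1 + n ^ (-2 * e)) := by
    intro t ht
    have h1 : (n ^ 2)⁻¹ ≤ 1 - t := by
      rw [inv_le_iff_one_le_mul₀ (by positivity)]; exact hun t ht
    have := rpow_bdd _ e _ (by positivity) h1 (by linarith [ht.1])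
    rw [inv_sq_rpow n _ hn] at this
    have p1 : 0 < n ^ (-2 * e) := by positivity
    have p2 : (0:ℝ) < 2 ^ e := by positivity
    nlinarith [mul_pos p1 p2]
  have b1 : ∀ t ∈ Icc c d, |f t * R1 t| ≤
      A * B * n ^ (-(3 / 2) : ℝ) * ((1 + 2 ^ e) * (1 + n ^ (-2 * e))) := by
    intro t ht
    have hu := hpos t ht
    rw [abs_mul]
    calc _ ≤ (B * (1 - t) ^ σ) * (A * n ^ (-(3 / 2) : ℝ) * (1 - t) ^ (α / 2 + 1 / 4)) := by
            gcongr
            · exact bf t ht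
            · exact bR1 t ht
      _ = A * B * n ^ (-(3 / 2) : ℝ) * (1 - t) ^ e := by
            rw [show e = σ + (α / 2 + 1 / 4) by rw [he]; ring, Real.rpow_add hu σ]; ring
      _ ≤ _ := by gcongr; exact hue t ht
  have b2 : ∀ t ∈ Icc c d, |f' t * R2 t| ≤
      A * B * n ^ (-(3 / 2) : ℝ) * ((1 + 2 ^ e) * (1 + n ^ (-2 * e))) := by
    intro t ht
    have hu := hpos t ht
    rw [abs_mul]
    calc _ ≤ (B * (1 - t) ^ (σ - 1)) * (A * n ^ (-(5 / 2) : ℝ) * (1 - t) ^ (α / 2 + 3 / 4)) := by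
            gcongr
            · exact bf' t ht
            · exact bR2 t ht
      _ = A * B * n ^ (-(5 / 2) : ℝ) * ((1 - t) ^ (-(1 / 2) : ℝ) * (1 - t) ^ e) := by
            rw [← Real.rpow_add hu,
              show -(1 / 2) + e = (σ - 1) + (α / 2 + 3 / 4) by rw [he]; ring,
              Real.rpow_add hu (σ - 1)]
            ring
      _ ≤ A * B * n ^ (-(5 / 2) : ℝ) * (n * ((1 + 2 ^ e) * (1 + n ^ (-2 * e)))) := by
            gcongr
            · exact u_half n _ hn (hun t ht)
            · exact hue t ht
      _ = A * B * (n ^ (-(5 / 2) : ℝ) * n) * ((1 + 2 ^ e) * (1 + n ^ (-2 * e))) := by ring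
      _ = _ := by rw [nn]
  have b3 : |∫ t in c..d, f'' t * R2 t| ≤
      A * B * n ^ (-(3 / 2) : ℝ) * (K * (1 + n ^ (-2 * e))) := by
    refine (abs_int_le _ (fun t => A * B * n ^ (-(5 / 2) : ℝ) * (1 - t) ^ (e - 3 / 2)) c d hcd ?_
      ?_).trans ?_
    · intro t ht
      have ht := Ioo_subset_Icc_self ht
      have hu := hpos t ht
      rw [abs_mul]
      calc _ ≤ (B * (1 - t) ^ (σ - 2)) * (A * n ^ (-(5 / 2) : ℝ) * (1 - t) ^ (α / 2 + 3 / 4)) := by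
              gcongr
              · exact bf'' t ht
              · exact bR2 t ht
        _ = _ := by
              rw [show e - 3 / 2 = (σ - 2) + (α / 2 + 3 / 4) by rw [he]; ring,
                Real.rpow_add hu (σ - 2)]
              ring
    · apply ContinuousOn.intervalIntegrable
      rw [uIcc_of_le hcd]
      exact continuousOn_const.mul
        (ContinuousOn.rpow_const (by fun_prop) (fun t ht => Or.inl (hpos t ht).ne'))
    · rw [intervalIntegral.integral_const_mul]
      calc _ ≤ A * B * n ^ (-(5 / 2) : ℝ) * (K * (n * (1 + n ^ (-2 * e)))) := by
              gcongr; exact hKe n c d hn hc hcd hd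
        _ = A * B * (n ^ (-(5 / 2) : ℝ) * n) * (K * (1 + n ^ (-2 * e))) := by ring
        _ = _ := by rw [nn]
  have e1 := b1 d ⟨hcd, le_rfl⟩
  have e2 := b1 c ⟨le_rfl, hcd⟩
  have e3 := b2 d ⟨hcd, le_rfl⟩
  have e4 := b2 c ⟨le_rfl, hcd⟩
  rw [← uIcc_of_le hcd] at hf hf' hcf'' hR1 hR2 hcQ hcf' hcR1
  rw [intervalIntegral.integral_mul_deriv_eq_deriv_mul hf hR1 hcf'.intervalIntegrable
    hcQ.intervalIntegrable, intervalIntegral.integral_mul_deriv_eq_deriv_mul hf' hR2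
    hcf''.intervalIntegrable hcR1.intervalIntegrable]
  have fin : A * B * (4 * (1 + 2 ^ e) + K) * (n ^ (-(3 / 2) : ℝ) * (1 + n ^ (-2 * e))) =
     4 * (A * B * n ^ (-(3 / 2) : ℝ) * ((1 + 2 ^ e) * (1 + n ^ (-2 * e)))) +
     A * B * n ^ (-(3 / 2) : ℝ) * (K * (1 + n ^ (-2 * e))) := by ring
  rw [fin]
  rw [abs_le] at e1 e2 e3 e4 b3 ⊢
  constructor <;> linarith [e1.1, e1.2, e2.1, e2.2, e3.1, e3.2, e4.1, e4.2, b3.1, b3.2]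

/-- Generic bound for C^2 functions on a compact subset of an open set. -/
lemma c2_bound (φ : ℝ → ℝ) (U S : Set ℝ) (hU : IsOpen U) (hS : IsCompact S) (hSU : S ⊆ U)
    (hφ : ContDiffOn ℝ 2 φ U) :
    ∃ B : ℝ, 0 < B ∧ (∀ t ∈ S, HasDerivAt φ (deriv φ t) t) ∧
      (∀ t ∈ S, HasDerivAt (deriv φ) (deriv (deriv φ) t) t) ∧
      ContinuousOn (deriv φ) S ∧ ContinuousOn (deriv (deriv φ)) S ∧
      (∀ t ∈ S, |φ t| ≤ B) ∧ (∀ t ∈ S, |deriv φ t| ≤ B) ∧ (∀ t ∈ S, |deriv (deriv φ) t| ≤ B) := by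
  have h1 : ContDiffOn ℝ 1 (deriv φ) U := hφ.deriv_of_isOpen hU (by norm_num)
  have h2 : ContDiffOn ℝ 0 (deriv (deriv φ)) U := h1.deriv_of_isOpen hU (by norm_num)
  have d0 : ∀ t ∈ S, HasDerivAt φ (deriv φ t) t := fun t ht =>
    ((hφ.contDiffAt (hU.mem_nhds (hSU ht))).differentiableAt (by norm_num)).hasDerivAt
  have d1 : ∀ t ∈ S, HasDerivAt (deriv φ) (deriv (deriv φ) t) t := fun t ht =>
    ((h1.contDiffAt (hU.mem_nhds (hSU ht))).differentiableAt (by norm_num)).hasDerivAt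
  have c0 := hφ.continuousOn.mono hSU
  have c1 := h1.continuousOn.mono hSU
  have c2 := h2.continuousOn.mono hSU
  obtain ⟨B0, hB0⟩ := hS.exists_bound_of_continuousOn c0
  obtain ⟨B1, hB1⟩ := hS.exists_bound_of_continuousOn c1
  obtain ⟨B2, hB2⟩ := hS.exists_bound_of_continuousOn c2
  simp only [Real.norm_eq_abs] at hB0 hB1 hB2
  refine ⟨1 + |B0| + |B1| + |B2|, by positivity, d0, d1, c1, c2, ?_, ?_, ?_⟩
  · intro t ht; linarith [hB0 t ht, le_abs_self B0, abs_nonneg B1, abs_nonneg B2]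
  · intro t ht; linarith [hB1 t ht, le_abs_self B1, abs_nonneg B0, abs_nonneg B2]
  · intro t ht; linarith [hB2 t ht, le_abs_self B2, abs_nonneg B1, abs_nonneg B0]

lemma prod_c2 (σ B : ℝ) (hB : 0 ≤ B) (φ φ' φ'' : ℝ → ℝ) (c d : ℝ) (hc : -1 ≤ c)
    (hd : d < 1) (h1 : ∀ t ∈ Icc c d, HasDerivAt φ (φ' t) t)
    (h2 : ∀ t ∈ Icc c d, HasDerivAt φ' (φ'' t) t) (h3 : ContinuousOn φ'' (Icc c d))
    (b0 : ∀ t ∈ Icc c d, |φ t| ≤ B) (b1 : ∀ t ∈ Icc c d, |φ' t| ≤ B)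
    (b2 : ∀ t ∈ Icc c d, |φ'' t| ≤ B) :
    ∃ f' f'' : ℝ → ℝ, (∀ t ∈ Icc c d, HasDerivAt (fun t => (1 - t) ^ σ * φ t) (f' t) t) ∧
      (∀ t ∈ Icc c d, HasDerivAt f' (f'' t) t) ∧ ContinuousOn f'' (Icc c d) ∧
      (∀ t ∈ Icc c d, |(1 - t) ^ σ * φ t| ≤
        B * (|σ| * |σ - 1| + 5 * |σ| + 4) * (1 - t) ^ σ) ∧
      (∀ t ∈ Icc c d, |f' t| ≤ B * (|σ| * |σ - 1| + 5 * |σ| + 4) * (1 - t) ^ (σ - 1)) ∧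
      (∀ t ∈ Icc c d, |f'' t| ≤ B * (|σ| * |σ - 1| + 5 * |σ| + 4) * (1 - t) ^ (σ - 2)) := by
  have hpos : ∀ t ∈ Icc c d, 0 < 1 - t := fun t ht => by linarith [ht.2]
  have hu2 : ∀ t ∈ Icc c d, 1 - t ≤ 2 := fun t ht => by linarith [ht.1]
  have hcp : ∀ p : ℝ, ContinuousOn (fun t : ℝ => (1 - t) ^ p) (Icc c d) := fun p =>
    ContinuousOn.rpow_const (by fun_prop) (fun t ht => Or.inl (hpos t ht).ne')
  have c0 : ContinuousOn φ (Icc c d) := fun t ht => (h1 t ht).continuousAt.continuousWithinAt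
  have c1 : ContinuousOn φ' (Icc c d) := fun t ht => (h2 t ht).continuousAt.continuousWithinAt
  have dp : ∀ p : ℝ, ∀ t ∈ Icc c d, HasDerivAt (fun t : ℝ => (1 - t) ^ p)
      (-p * (1 - t) ^ (p - 1)) t := by
    intro p t ht
    have h : HasDerivAt (fun t : ℝ => 1 - t) (-1) t := by
      simpa using (hasDerivAt_id t).const_sub 1
    refine (h.rpow_const (p := p) (Or.inl (hpos t ht).ne')).congr_deriv ?_
    ring
  refine ⟨fun t => -σ * (1 - t) ^ (σ - 1) * φ t + (1 - t) ^ σ * φ' t,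
    fun t => σ * (σ - 1) * (1 - t) ^ (σ - 2) * φ t - 2 * σ * (1 - t) ^ (σ - 1) * φ' t +
      (1 - t) ^ σ * φ'' t, ?_, ?_, ?_, ?_, ?_, ?_⟩
  · intro t ht
    exact (dp σ t ht).fun_mul (h1 t ht)
  · intro t ht
    refine ((((dp (σ - 1) t ht).const_mul (-σ)).fun_mul (h1 t ht)).fun_add
      ((dp σ t ht).fun_mul (h2 t ht))).congr_deriv ?_
    rw [show σ - 1 - 1 = σ - 2 by ring]
    ring
  · exact (((continuousOn_const.mul (hcp _)).mul c0).sub ((continuousOn_const.mul (hcp _)).mul c1)).add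
      ((hcp _).mul h3)
  · intro t ht
    have hu := hpos t ht
    have p : 0 < (1 - t) ^ σ := by positivity
    rw [abs_mul, abs_of_pos p, mul_comm]
    gcongr
    have := b0 t ht
    have h : 0 ≤ B * (|σ| * |σ - 1| + 5 * |σ|) := by positivity
    linarith
  · intro t ht
    have hu := hpos t ht
    have e1 : (1 - t) ^ σ = (1 - t) * (1 - t) ^ (σ - 1) := by
      nth_rewrite 2 [← Real.rpow_one (1 - t)]
      rw [← Real.rpow_add hu]; ring_nf
    have p : 0 < (1 - t) ^ (σ - 1) := by positivity
    simp only [e1]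
    calc _ = |-σ * φ t + (1 - t) * φ' t| * (1 - t) ^ (σ - 1) := by
            rw [← abs_of_pos p, ← abs_mul, abs_of_pos p]; ring_nf
      _ ≤ _ := by
            gcongr
            refine (abs_add_le _ _).trans ?_
            rw [abs_mul, abs_mul, abs_neg, abs_of_pos hu]
            have k1 : |σ| * |φ t| ≤ |σ| * B := by gcongr; exact b0 t ht
            have k2 : (1 - t) * |φ' t| ≤ 2 * B := by
              gcongr
              · exact hu2 t ht
              · exact b1 t ht
            have h : 0 ≤ B * (|σ| * |σ - 1| + 4 * |σ| + 2) := by positivity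
            linarith
  · intro t ht
    have hu := hpos t ht
    have e1 : (1 - t) ^ σ = (1 - t) ^ 2 * (1 - t) ^ (σ - 2) := by
      rw [← Real.rpow_natCast, ← Real.rpow_add hu]; norm_num
    have e2 : (1 - t) ^ (σ - 1) = (1 - t) * (1 - t) ^ (σ - 2) := by
      nth_rewrite 2 [← Real.rpow_one (1 - t)]
      rw [← Real.rpow_add hu]; ring_nf
    have p : 0 < (1 - t) ^ (σ - 2) := by positivity
    simp only [e1, e2]
    calc _ = |σ * (σ - 1) * φ t - 2 * σ * (1 - t) * φ' t + (1 - t) ^ 2 * φ'' t| *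
            (1 - t) ^ (σ - 2) := by
            rw [← abs_of_pos p, ← abs_mul, abs_of_pos p]; ring_nf
      _ ≤ _ := by
            gcongr
            have k0 := (abs_add_le (σ * (σ - 1) * φ t - 2 * σ * (1 - t) * φ' t)
              ((1 - t) ^ 2 * φ'' t))
            have k00 := abs_sub (σ * (σ - 1) * φ t) (2 * σ * (1 - t) * φ' t)
            have k1 : |σ * (σ - 1) * φ t| ≤ |σ| * |σ - 1| * B := by
              rw [abs_mul, abs_mul]; gcongr; exact b0 t ht
            have k2 : |2 * σ * (1 - t) * φ' t| ≤ 2 * |σ| * 2 * B := by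
              rw [abs_mul, abs_mul, abs_mul, abs_of_pos hu, abs_two]
              gcongr
              · exact hu2 t ht
              · exact b1 t ht
            have k3 : |(1 - t) ^ 2 * φ'' t| ≤ 2 ^ 2 * B := by
              rw [abs_mul, abs_pow, abs_of_pos hu]
              gcongr
              · exact hu2 t ht
              · exact b2 t ht
            have h : 0 ≤ B * |σ| := by positivity
            linarith

lemma JJ_cont (α β : ℝ) (n : ℕ) : Continuous (JJ α β n) :=
  continuous_iff_continuousAt.2 fun x => (JJ_hasDeriv α β n x).continuousAt

/-- The oscillatory part of the integrand. -/
noncomputable def GG (α β γ δ a : ℝ) (n : ℕ) (t : ℝ) : ℝ :=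
  (t - a) ^ γ * (1 - t) ^ δ * JJ α β n t

lemma GG_ii (α β γ δ a : ℝ) (n : ℕ) (hγ : -1 < γ) (hδ : -1 < δ) (ha : a ∈ Ioo (-1 : ℝ) 1) :
    IntervalIntegrable (GG α β γ δ a n) volume a 1 := by
  obtain ⟨h1, h2⟩ := ha
  have i1 : IntervalIntegrable (GG α β γ δ a n) volume a ((a + 1) / 2) := by
    have : IntervalIntegrable (fun t => (t - a) ^ γ * ((1 - t) ^ δ * JJ α β n t)) volume a
        ((a + 1) / 2) := by
      apply (ii_left a γ _ _ hγ).mul_continuousOn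
      rw [uIcc_of_le (by linarith)]
      refine ContinuousOn.mul (ContinuousOn.rpow_const (by fun_prop) ?_) (JJ_cont α β n).continuousOn
      intro t ht
      left; linarith [ht.2]
    refine this.congr ?_
    intro t _
    simp only [GG]; ring
  have i2 : IntervalIntegrable (GG α β γ δ a n) volume ((a + 1) / 2) 1 := by
    have : IntervalIntegrable (fun t => (1 - t) ^ δ * ((t - a) ^ γ * JJ α β n t)) volume
        ((a + 1) / 2) 1 := by
      apply (ii_right δ _ _ hδ).mul_continuousOn
      rw [uIcc_of_le (by linarith)]
      refine ContinuousOn.mul (ContinuousOn.rpow_const (by fun_prop) ?_) (JJ_cont α β n).continuousOn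
      intro t ht
      left; linarith [ht.1]
    refine this.congr ?_
    intro t _
    simp only [GG]; ring
  exact i1.trans i2

lemma QQ_cont (α β : ℝ) (n : ℕ) (c d : ℝ) (hc : -1 < c) (hd : d < 1) :
    ContinuousOn (fun t => (1 - t) ^ α * (1 + t) ^ β * JJ α β n t) (Icc c d) := by
  refine ContinuousOn.mul (ContinuousOn.mul (ContinuousOn.rpow_const (by fun_prop) ?_)
    (ContinuousOn.rpow_const (by fun_prop) ?_)) (JJ_cont α β n).continuousOn
  · intro t ht; left; linarith [ht.2]
  · intro t ht; left; linarith [ht.1]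

lemma ev_large (s : ℝ) (hs : 0 < s) : ∀ᶠ n : ℕ in atTop, 1 ≤ (n : ℝ) ∧ 1 / (n : ℝ) ≤ s ∧
    1 ≤ s * (n : ℝ) ^ 2 := by
  have h := (tendsto_natCast_atTop_atTop (R := ℝ)).eventually_ge_atTop (max 1 (1 / s))
  filter_upwards [h] with n hn
  have h1 := (le_max_left _ _).trans hn
  have h2 := (le_max_right _ _).trans hn
  have h0 : 0 < (n : ℝ) := by linarith
  have h3 : 1 ≤ s * n := by rw [div_le_iff₀ hs] at h2; linarith
  refine ⟨h1, ?_, ?_⟩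
  · rw [div_le_iff₀ h0]; exact h3
  · nlinarith [mul_pos hs h0]

lemma near_left (α β γ δ a b : ℝ) (hα : -1 < α) (hγ : -1 < γ) (hδ : -1 < δ)
    (ha : a ∈ Ioo (-1 : ℝ) 1) (hab : a < b) (hb : b < 1) :
    ∃ K : ℝ, 0 < K ∧ ∀ᶠ n : ℕ in atTop, ∀ c d, a ≤ c → c ≤ d → d ≤ b →
      |∫ t in c..d, GG α β γ δ a n t| ≤
        K * ((n : ℝ) ^ (-(γ + 3 / 2)) + (n : ℝ) ^ (-(3 / 2) : ℝ)) := by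
  obtain ⟨C, hC, hCn⟩ := antideriv α β a hα ha
  obtain ⟨B, hB, d1, -, c1, -, bb0, bb1, -⟩ := c2_bound
    (fun t => (1 - t) ^ (δ - α) * (1 + t) ^ (-β)) (Ioo (-1) 1) (Icc a b) isOpen_Ioo isCompact_Icc
    (fun t ht => ⟨by linarith [ht.1, ha.1], by linarith [ht.2]⟩) (by
      refine ContDiffOn.mul (ContDiffOn.rpow_const_of_ne (by fun_prop) ?_)
        (ContDiffOn.rpow_const_of_ne (by fun_prop) ?_)
      · intro t ht; linarith [ht.2]
      · intro t ht; linarith [ht.1])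
  set φ : ℝ → ℝ := fun t => (1 - t) ^ (δ - α) * (1 + t) ^ (-β) with hφ
  have hb1 : 0 < 1 - b := by linarith
  set D : ℝ := (1 - b) ^ (α / 2 - 1 / 4) + 2 ^ (α / 2 - 1 / 4) +
    ((1 - b) ^ (α / 2 + 1 / 4) + 2 ^ (α / 2 + 1 / 4)) with hD
  have hD0 : 0 < D := by positivity
  have g1 : 0 < γ + 1 := by linarith
  refine ⟨B * C * D * (1 / (γ + 1) + 4 + 4 * 2 ^ γ + 2 ^ (γ + 1) / (γ + 1)), by positivity, ?_⟩
  filter_upwards [hCn, ev_large (b - a) (by linarith), ev_large (1 - b) hb1] with n hn hn1 hn2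
  obtain ⟨R1, R2, dR1, -, hbd⟩ := hn
  obtain ⟨hn1, hn3, -⟩ := hn1
  obtain ⟨-, -, hn2⟩ := hn2
  set N : ℝ := (n : ℝ) with hN
  have hN0 : 0 < N := by linarith
  have hbd' : ∀ t ∈ Icc a b, |(1 - t) ^ α * (1 + t) ^ β * JJ α β n t| ≤
      C * N ^ (-(1 / 2) : ℝ) * D ∧ |R1 t| ≤ C * N ^ (-(3 / 2) : ℝ) * D := by
    intro t ht
    obtain ⟨q1, q2, -⟩ := hbd t ht.1 (by linarith [ht.2])
      (hn2.trans (by gcongr; exact ht.2))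
    have p1 : (1 - t) ^ (α / 2 - 1 / 4) ≤ D := by
      have := rpow_bdd (1 - b) (α / 2 - 1 / 4) (1 - t) hb1 (by linarith [ht.2])
        (by linarith [ht.1, ha.1])
      have h : 0 < (1 - b) ^ (α / 2 + 1 / 4) + 2 ^ (α / 2 + 1 / 4) := by positivity
      linarith
    have p2 : (1 - t) ^ (α / 2 + 1 / 4) ≤ D := by
      have := rpow_bdd (1 - b) (α / 2 + 1 / 4) (1 - t) hb1 (by linarith [ht.2])
        (by linarith [ht.1, ha.1])
      have h : 0 < (1 - b) ^ (α / 2 - 1 / 4) + 2 ^ (α / 2 - 1 / 4) := by positivity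
      linarith
    exact ⟨q1.trans (by gcongr), q2.trans (by gcongr)⟩
  have hGG : ∀ t ∈ Icc a b, GG α β γ δ a n t =
      (t - a) ^ γ * φ t * ((1 - t) ^ α * (1 + t) ^ β * JJ α β n t) := by
    intro t ht
    have u1 : 0 < 1 - t := by linarith [ht.2]
    have u2 : 0 < 1 + t := by linarith [ht.1, ha.1]
    have e1 : (1 - t) ^ δ = (1 - t) ^ (δ - α) * (1 - t) ^ α := by
      rw [← Real.rpow_add u1]; ring_nf
    have e2 : (1 + t) ^ (-β) * (1 + t) ^ β = 1 := by
      rw [← Real.rpow_add u2]; simp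
    simp only [GG, hφ, e1]
    linear_combination -((t - a) ^ γ * (1 - t) ^ (δ - α) * (1 - t) ^ α * JJ α β n t) * e2
  have hS : ∀ c d, a ≤ c → c ≤ d → d ≤ a + 1 / N → |∫ t in c..d, GG α β γ δ a n t| ≤
      (B * (C * N ^ (-(1 / 2) : ℝ) * D)) * ((1 / N) ^ (γ + 1) / (γ + 1)) := by
    intro c d hac hcd hd
    apply small_left _ a γ _ (1 / N) c d hγ (by positivity) hac hcd hd
    intro t ht
    have ht' : t ∈ Icc a b := ⟨by linarith [ht.1], by linarith [ht.2]⟩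
    have u : 0 < t - a := by linarith [ht.1]
    have u' : 0 < (t - a) ^ γ := by positivity
    rw [hGG t ht', abs_mul, abs_mul, abs_of_pos u']
    calc _ ≤ (t - a) ^ γ * B * (C * N ^ (-(1 / 2) : ℝ) * D) := by
          gcongr
          · exact bb0 t ht'
          · exact (hbd' t ht').1
      _ = _ := by ring
  have hT : ∀ c d, a + 1 / N ≤ c → c ≤ d → d ≤ b → |∫ t in c..d, GG α β γ δ a n t| ≤
      (C * N ^ (-(3 / 2) : ℝ) * D) * B * (4 * ((1 / N) ^ γ + 2 ^ γ) + 2 ^ (γ + 1) / (γ + 1)) := by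
    intro c d hac hcd hd
    have hN1 : 0 < 1 / N := by positivity
    have sub : Icc c d ⊆ Icc a b := Icc_subset_Icc (by linarith) hd
    have : ∫ t in c..d, GG α β γ δ a n t = ∫ t in c..d, (t - a) ^ γ * φ t *
        ((1 - t) ^ α * (1 + t) ^ β * JJ α β n t) := by
      apply intervalIntegral.integral_congr
      rw [uIcc_of_le hcd]
      exact fun t ht => hGG t (sub ht)
    rw [this]
    exact large_left φ (deriv φ) _ R1 a γ B _ (1 / N) c d hγ hB.le (by positivity) hN1 hac hcd
      (by linarith [ha.1]) (fun t ht => d1 t (sub ht)) (c1.mono sub) (fun t ht => bb0 t (sub ht))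
      (fun t ht => bb1 t (sub ht)) (fun t ht => dR1 t ⟨by linarith [ht.1, ha.1], by linarith [ht.2]⟩)
      (QQ_cont α β n c d (by linarith [ha.1]) (by linarith)) (fun t ht => (hbd' t (sub ht)).2)
  have hIntg : IntervalIntegrable (GG α β γ δ a n) volume a b :=
    (GG_ii α β γ δ a n hγ hδ ha).mono_set (by
      rw [uIcc_of_le (by linarith), uIcc_of_le (by linarith)]; exact Icc_subset_Icc le_rfl hb.le)
  intro c d hac hcd hd
  refine (comb _ a (a + 1 / N) b _ _ (by simp [hN0.le]) (by linarith) hIntg hS hT c d hac hcd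
    hd).trans ?_
  have e0 : ∀ p : ℝ, (1 / N) ^ p = N ^ (-p) := fun p => by
    rw [one_div, Real.inv_rpow hN0.le, Real.rpow_neg hN0.le]
  have e1 : N ^ (-(1 / 2) : ℝ) * N ^ (-(γ + 1)) = N ^ (-(γ + 3 / 2)) := by
    rw [← Real.rpow_add hN0]; ring_nf
  have e2 : N ^ (-(3 / 2) : ℝ) * N ^ (-γ) = N ^ (-(γ + 3 / 2)) := by
    rw [← Real.rpow_add hN0]; ring_nf
  rw [e0, e0]
  set X := N ^ (-(γ + 3 / 2)) with hX
  set Y := N ^ (-(3 / 2) : ℝ) with hY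
  have X0 : 0 < X := by positivity
  have Y0 : 0 < Y := by positivity
  calc _ = B * C * D * (1 / (γ + 1) * (N ^ (-(1 / 2) : ℝ) * N ^ (-(γ + 1))) + 4 * (Y * N ^ (-γ)) +
        (4 * 2 ^ γ + 2 ^ (γ + 1) / (γ + 1)) * Y) := by ring
    _ = B * C * D * ((1 / (γ + 1) + 4) * X + (4 * 2 ^ γ + 2 ^ (γ + 1) / (γ + 1)) * Y) := by
        rw [e1, e2]; ring
    _ ≤ B * C * D * ((1 / (γ + 1) + 4) * X + (4 * 2 ^ γ + 2 ^ (γ + 1) / (γ + 1)) * Y +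
        ((1 / (γ + 1) + 4) * Y + (4 * 2 ^ γ + 2 ^ (γ + 1) / (γ + 1)) * X)) := by
        have : 0 ≤ (1 / (γ + 1) + 4) * Y + (4 * 2 ^ γ + 2 ^ (γ + 1) / (γ + 1)) * X := by positivity
        refine mul_le_mul_of_nonneg_left ?_ (by positivity)
        linarith
    _ = _ := by ring

lemma near_right (α β γ δ a b : ℝ) (hα : -1 < α) (hγ : -1 < γ) (hδ : -1 < δ)
    (ha : a ∈ Ioo (-1 : ℝ) 1) (hab : a < b) (hb : b < 1) :
    ∃ K : ℝ, 0 < K ∧ ∀ᶠ n : ℕ in atTop, ∀ c d, b ≤ c → c ≤ d → d ≤ 1 →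
      |∫ t in c..d, GG α β γ δ a n t| ≤
        K * ((n : ℝ) ^ (-(2 * δ - α + 2)) + (n : ℝ) ^ (-(3 / 2) : ℝ)) := by
  obtain ⟨C, hC, hCn⟩ := antideriv α β a hα ha
  obtain ⟨E, hE, hEn⟩ := edge_bound α β 1 hα
  obtain ⟨B, hB, d1, d2, c1, c2, bb0, bb1, bb2⟩ := c2_bound
    (fun t => (t - a) ^ γ * (1 + t) ^ (-β)) (Ioi a) (Icc b 1) isOpen_Ioi isCompact_Icc
    (fun t ht => by simp only [mem_Ioi]; linarith [ht.1]) (by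
      refine ContDiffOn.mul (ContDiffOn.rpow_const_of_ne (by fun_prop) ?_)
        (ContDiffOn.rpow_const_of_ne (by fun_prop) ?_)
      · intro t ht; simp only [mem_Ioi] at ht; linarith
      · intro t ht; simp only [mem_Ioi] at ht; linarith [ha.1])
  set φ : ℝ → ℝ := fun t => (t - a) ^ γ * (1 + t) ^ (-β) with hφ
  obtain ⟨K, hK, hKl⟩ := large_right (δ - α) α
  have hba : 0 < b - a := by linarith
  set M : ℝ := (b - a) ^ γ + 2 ^ γ with hM
  have hM0 : 0 < M := by positivity
  have g1 : 0 < δ + 1 := by linarith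
  set B' : ℝ := B * (|δ - α| * |δ - α - 1| + 5 * |δ - α| + 4) with hB'
  have hB'0 : 0 < B' := by positivity
  refine ⟨M * E / (δ + 1) + C * B' * K, by positivity, ?_⟩
  filter_upwards [hCn, hEn, ev_large (1 - b) (by linarith)] with n hn hEn hn2
  obtain ⟨R1, R2, dR1, dR2, hbd⟩ := hn
  obtain ⟨hn1, -, hn2⟩ := hn2
  set N : ℝ := (n : ℝ) with hN
  have hN0 : 0 < N := by linarith
  have hε : 0 < 1 / N ^ 2 := by positivity
  have hεb : 1 / N ^ 2 ≤ 1 - b := by rw [div_le_iff₀ (by positivity)]; exact hn2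
  have hGG : ∀ t ∈ Ico b 1, GG α β γ δ a n t =
      ((1 - t) ^ (δ - α) * φ t) * ((1 - t) ^ α * (1 + t) ^ β * JJ α β n t) := by
    intro t ht
    have u1 : 0 < 1 - t := by linarith [ht.2]
    have u2 : 0 < 1 + t := by linarith [ht.1, ha.1]
    have e1 : (1 - t) ^ δ = (1 - t) ^ (δ - α) * (1 - t) ^ α := by
      rw [← Real.rpow_add u1]; ring_nf
    have e2 : (1 + t) ^ (-β) * (1 + t) ^ β = 1 := by
      rw [← Real.rpow_add u2]; simp
    simp only [GG, hφ, e1]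
    linear_combination -((t - a) ^ γ * (1 - t) ^ (δ - α) * (1 - t) ^ α * JJ α β n t) * e2
  have hT : ∀ c d, 1 - 1 / N ^ 2 ≤ c → c ≤ d → d ≤ 1 → |∫ t in c..d, GG α β γ δ a n t| ≤
      (M * (E * N ^ α)) * ((1 / N ^ 2) ^ (δ + 1) / (δ + 1)) := by
    intro c d hc hcd hd
    apply small_right _ δ _ (1 / N ^ 2) c d hδ (by positivity) hd hcd hc
    intro t ht
    have u : 0 < t - a := by linarith [ht.1]
    have u2 : 0 < 1 - t := by linarith [ht.2]
    have u' : 0 < (t - a) ^ γ := by positivity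
    have u2' : 0 < (1 - t) ^ δ := by positivity
    have k1 : (t - a) ^ γ ≤ M := rpow_bdd (b - a) γ (t - a) hba (by linarith [ht.1])
      (by linarith [ha.1])
    have k2 := hEn t (by linarith [ha.1]) (by linarith) (by
      rw [← le_div_iff₀ (by positivity)]; linarith [ht.1])
    rw [GG, abs_mul, abs_mul, abs_of_pos u', abs_of_pos u2']
    calc _ ≤ M * (1 - t) ^ δ * (E * N ^ α) := by gcongr
      _ = _ := by ring
  have hS : ∀ c d, b ≤ c → c ≤ d → d ≤ 1 - 1 / N ^ 2 → |∫ t in c..d, GG α β γ δ a n t| ≤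
      C * B' * K * (N ^ (-(3 / 2) : ℝ) * (1 + N ^ (-2 * (δ - α + α / 2 + 1 / 4)))) := by
    intro c d hac hcd hd
    have sub : Icc c d ⊆ Icc b 1 := Icc_subset_Icc hac (by linarith)
    have hd1 : d < 1 := by linarith
    have hun : ∀ t ∈ Icc c d, 1 ≤ (1 - t) * N ^ 2 := by
      intro t ht
      rw [← div_le_iff₀ (by positivity)]; linarith [ht.2]
    have : ∫ t in c..d, GG α β γ δ a n t = ∫ t in c..d, ((1 - t) ^ (δ - α) * φ t) *
        ((1 - t) ^ α * (1 + t) ^ β * JJ α β n t) := by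
      apply intervalIntegral.integral_congr
      rw [uIcc_of_le hcd]
      exact fun t ht => hGG t ⟨by linarith [ht.1], by linarith [ht.2]⟩
    rw [this]
    obtain ⟨f', f'', q1, q2, q3, q4, q5, q6⟩ := prod_c2 (δ - α) B hB.le φ (deriv φ)
      (deriv (deriv φ)) c d (by linarith [ha.1]) hd1 (fun t ht => d1 t (sub ht))
      (fun t ht => d2 t (sub ht)) (c2.mono sub) (fun t ht => bb0 t (sub ht))
      (fun t ht => bb1 t (sub ht)) (fun t ht => bb2 t (sub ht))
    have hm : ∀ t ∈ Icc c d, t ∈ Ioo (-1 : ℝ) 1 := fun t ht =>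
      ⟨by linarith [ht.1, ha.1], by linarith [ht.2]⟩
    have hh := fun t (ht : t ∈ Icc c d) => hbd t (by linarith [ht.1]) (hm t ht).2 (hun t ht)
    exact hKl (fun t => (1 - t) ^ (δ - α) * φ t) f' f'' _ R1 R2 C B' N c d hC.le hB'0.le hn1
      (by linarith [ha.1]) hcd (hun d ⟨hcd, le_rfl⟩) q1 q2 q3 q4 q5 q6
      (fun t ht => dR1 t (hm t ht)) (fun t ht => dR2 t (hm t ht))
      (QQ_cont α β n c d (by linarith [ha.1]) hd1)
      (fun t ht => (hh t ht).2.1) (fun t ht => (hh t ht).2.2)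
  have hIntg : IntervalIntegrable (GG α β γ δ a n) volume b 1 :=
    (GG_ii α β γ δ a n hγ hδ ha).mono_set (by
      rw [uIcc_of_le (by linarith), uIcc_of_le (by linarith)]; exact Icc_subset_Icc hab.le le_rfl)
  intro c d hac hcd hd
  refine (comb _ b (1 - 1 / N ^ 2) 1 _ _ (by linarith) (by linarith) hIntg hS hT c d hac hcd
    hd).trans ?_
  rw [one_div (N ^ 2), inv_sq_rpow N _ hn1]
  have e1 : N ^ (-(3 / 2) : ℝ) * N ^ (-2 * (δ - α + α / 2 + 1 / 4)) = N ^ (-(2 * δ - α + 2)) := by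
    rw [← Real.rpow_add hN0]; ring_nf
  have e2 : N ^ α * N ^ (-2 * (δ + 1)) = N ^ (-(2 * δ - α + 2)) := by
    rw [← Real.rpow_add hN0]; ring_nf
  set X := N ^ (-(2 * δ - α + 2)) with hX
  set Y := N ^ (-(3 / 2) : ℝ) with hY
  have X0 : 0 < X := by positivity
  have Y0 : 0 < Y := by positivity
  calc _ = C * B' * K * (Y + Y * N ^ (-2 * (δ - α + α / 2 + 1 / 4))) +
        M * E / (δ + 1) * (N ^ α * N ^ (-2 * (δ + 1))) := by ring
    _ = C * B' * K * (Y + X) + M * E / (δ + 1) * X := by rw [e1, e2]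
    _ ≤ C * B' * K * (Y + X) + M * E / (δ + 1) * (Y + X) := by gcongr; linarith
    _ = _ := by ring

lemma sup_bound (α β γ δ a : ℝ) (hα : -1 < α) (hγ : -1 < γ) (hδ : -1 < δ)
    (ha : a ∈ Ioo (-1 : ℝ) 1) :
    ∃ K : ℝ, 0 < K ∧ ∀ᶠ n : ℕ in atTop, ∀ c d, a ≤ c → c ≤ d → d ≤ 1 →
      |∫ t in c..d, GG α β γ δ a n t| ≤
        K * (n : ℝ) ^ (-(min (2 * δ - α + 2) (min (γ + 3 / 2) (3 / 2)))) := by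
  have h1 := ha.2
  obtain ⟨K1, hK1, hn1⟩ := near_left α β γ δ a ((a + 1) / 2) hα hγ hδ ha (by linarith) (by linarith)
  obtain ⟨K2, hK2, hn2⟩ := near_right α β γ δ a ((a + 1) / 2) hα hγ hδ ha (by linarith) (by linarith)
  refine ⟨2 * K1 + 2 * K2, by positivity, ?_⟩
  filter_upwards [hn1, hn2, ev_large 1 one_pos] with n hn1 hn2 hn
  intro c d hac hcd hd
  refine (comb _ a ((a + 1) / 2) 1 _ _ (by linarith) (by linarith) (GG_ii α β γ δ a n hγ hδ ha)
    hn1 hn2 c d hac hcd hd).trans ?_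
  set μ := min (2 * δ - α + 2) (min (γ + 3 / 2) (3 / 2)) with hμ
  have m1 : μ ≤ 2 * δ - α + 2 := min_le_left _ _
  have m2 : μ ≤ γ + 3 / 2 := (min_le_right _ _).trans (min_le_left _ _)
  have m3 : μ ≤ 3 / 2 := (min_le_right _ _).trans (min_le_right _ _)
  have x1 := Real.rpow_le_rpow_of_exponent_le hn.1 (neg_le_neg m1)
  have x2 := Real.rpow_le_rpow_of_exponent_le hn.1 (neg_le_neg m2)
  have x3 := Real.rpow_le_rpow_of_exponent_le hn.1 (neg_le_neg m3)
  calc _ ≤ K1 * ((n : ℝ) ^ (-μ) + (n : ℝ) ^ (-μ)) + K2 * ((n : ℝ) ^ (-μ) + (n : ℝ) ^ (-μ)) := by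
        gcongr
    _ = _ := by ring

lemma ibp_ac (G p : ℝ → ℝ) (k a b M : ℝ) (hab : a ≤ b) (hG : IntervalIntegrable G volume a b)
    (hp : IntervalIntegrable p volume a b)
    (hM : ∀ x ∈ Icc a b, |∫ t in a..x, G t| ≤ M) :
    |∫ x in a..b, G x * (k + ∫ t in a..x, p t)| ≤
      M * (|k + ∫ t in a..b, p t| + ∫ t in a..b, |p t|) := by
  have acH := hG.absolutelyContinuousOnInterval_intervalIntegral (c := a) (by simp)
  have acP := hp.absolutelyContinuousOnInterval_intervalIntegral (c := a) (by simp)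
  have key := acP.integral_mul_deriv_eq_deriv_mul acH
  have e1 : ∫ x in a..b, (∫ t in a..x, p t) * deriv (fun x => ∫ t in a..x, G t) x =
      ∫ x in a..b, G x * ∫ t in a..x, p t := by
    apply intervalIntegral.integral_congr_ae
    filter_upwards [hG.ae_hasDerivAt_integral] with x hx hx'
    rw [(hx (uIoc_subset_uIcc hx') a (by simp)).deriv, mul_comm]
  have e2 : ∫ x in a..b, deriv (fun x => ∫ t in a..x, p t) x * (∫ t in a..x, G t) =
      ∫ x in a..b, p x * ∫ t in a..x, G t := by
    apply intervalIntegral.integral_congr_ae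
    filter_upwards [hp.ae_hasDerivAt_integral] with x hx hx'
    rw [(hx (uIoc_subset_uIcc hx') a (by simp)).deriv]
  rw [e1, e2] at key
  have e3 : ∫ x in a..b, G x * (k + ∫ t in a..x, p t) =
      (k + ∫ t in a..b, p t) * (∫ t in a..b, G t) - ∫ x in a..b, p x * ∫ t in a..x, G t := by
    simp only [mul_add]
    rw [intervalIntegral.integral_add (hG.mul_const k) (hG.mul_continuousOn acP.continuousOn),
      intervalIntegral.integral_mul_const, key]
    simp
    ring
  rw [e3]
  have b1 : |∫ x in a..b, p x * ∫ t in a..x, G t| ≤ ∫ x in a..b, M * |p x| := by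
    apply abs_int_le _ _ _ _ hab _ (hp.abs.const_mul M)
    intro t ht
    rw [abs_mul, mul_comm]
    gcongr
    exact hM t (Ioo_subset_Icc_self ht)
  rw [intervalIntegral.integral_const_mul] at b1
  refine (abs_sub _ _).trans ?_
  rw [abs_mul]
  have b2 : |k + ∫ t in a..b, p t| * |∫ t in a..b, G t| ≤ |k + ∫ t in a..b, p t| * M := by
    gcongr
    exact hM b ⟨hab, le_rfl⟩
  linarith

theorem van_der_corput_jacobi_a (α β γ δ a : ℝ) (hα : -1 < α) (hβ : -1 < β)
    (hγ : -1 < γ) (hδ : -1 < δ) (ha : a ∈ Set.Ioo (-1 : ℝ) 1) :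
    ∃ C : ℝ, 0 < C ∧ ∃ N : ℕ, ∀ ψ : ℝ → ℝ, IsWAC a 1 ψ → ∀ n : ℕ, N ≤ n →
      |∫ x in a..1, (x - a) ^ γ * (1 - x) ^ δ * jacobiP α β n x * ψ x| ≤
        C * wacNorm a 1 ψ * (n : ℝ) ^ (-(min (2 * δ - α + 2) (min (γ + 3 / 2) (3 / 2)))) := by
  obtain ⟨K, hK, hev⟩ := sup_bound α β γ δ a hα hγ hδ ha
  obtain ⟨N, hN⟩ := eventually_atTop.1 hev
  refine ⟨K, hK, N, ?_⟩
  intro ψ hψ n hn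
  have h1 := ha.1
  have h2 := ha.2
  obtain ⟨hi, hf⟩ := hψ
  have hp : IntervalIntegrable (deriv ψ) volume a 1 := by
    rw [intervalIntegrable_iff_integrableOn_Ioo_of_le h2.le]
    exact hi
  have hG := GG_ii α β γ δ a n hγ hδ ha
  have e1 : ∫ x in a..1, (x - a) ^ γ * (1 - x) ^ δ * jacobiP α β n x * ψ x =
      ∫ x in a..1, GG α β γ δ a n x * (ψ a + ∫ t in a..x, deriv ψ t) := by
    apply intervalIntegral.integral_congr_ae
    have : ∀ᵐ t : ℝ, t ≠ 1 := by simp [ae_iff, measure_singleton]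
    filter_upwards [this] with x hx hx'
    rw [uIoc_of_le h2.le] at hx'
    rw [← hf x (Ioc_subset_Icc_self hx'), GG, ← jacobiP_eq α β n x
      ⟨by linarith [hx'.1], lt_of_le_of_ne hx'.2 hx⟩]
    rfl
  have hcont : ContinuousOn ψ (Icc a 1) := by
    have ac := hp.absolutelyContinuousOnInterval_intervalIntegral (c := a) (by simp)
    have c := ac.continuousOn
    rw [uIcc_of_le h2.le] at c
    exact (continuousOn_const.add c).congr hf
  have hsup : |ψ 1| ≤ ⨆ x : Set.Icc a 1, |ψ (x : ℝ)| := by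
    obtain ⟨B, hB⟩ := isCompact_Icc.exists_bound_of_continuousOn hcont
    have bdd : BddAbove (range fun x : Set.Icc a 1 => |ψ (x : ℝ)|) := by
      refine ⟨B, ?_⟩
      rintro _ ⟨x, rfl⟩
      exact hB x x.2
    exact le_ciSup bdd ⟨1, h2.le, le_rfl⟩
  have main := ibp_ac (GG α β γ δ a n) (deriv ψ) (ψ a) a 1 _ h2.le hG hp
    (fun x hx => hN n hn a x le_rfl hx.1 hx.2)
  rw [e1]
  refine main.trans ?_
  rw [← hf 1 ⟨h2.le, le_rfl⟩, wacNorm]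
  have hpow : 0 ≤ K * (n : ℝ) ^ (-(min (2 * δ - α + 2) (min (γ + 3 / 2) (3 / 2)))) := by positivity
  calc _ ≤ K * (n : ℝ) ^ (-(min (2 * δ - α + 2) (min (γ + 3 / 2) (3 / 2)))) *
        ((⨆ x : Set.Icc a 1, |ψ (x : ℝ)|) + ∫ t in a..1, |deriv ψ t|) := by
        refine mul_le_mul_of_nonneg_left ?_ hpow
        linarith
    _ = _ := by ring
end

section
/- Let α,β,γ>-1 and -1<a<b<1. Then there exist constants C>0 and N such that for every ψ∈W_AC(a,b) and every integer n≥N, |∫_a^b (x-a)^γ P_n^{(α,β)}(x) ψ(x) dx| ≤ C ‖ψ‖_{W_AC(a,b)} · n^{-min{γ+3/2, 3/2}}. -/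
open MeasureTheory Set

/-- Polynomial factors of the iterated derivatives of `(1-y)^s (1+y)^t`. -/
noncomputable def jQ (s t : ℝ) : ℕ → Polynomial ℝ
  | 0 => 1
  | (k+1) => (1 - Polynomial.X ^ 2) * Polynomial.derivative (jQ s t k) +
      (Polynomial.C (t - s) - Polynomial.C (s + t - 2 * k) * Polynomial.X) * jQ s t k

/-- The iterated derivatives of `(1-y)^s (1+y)^t`. -/
noncomputable def jG (s t : ℝ) (k : ℕ) (y : ℝ) : ℝ :=
  (1 - y) ^ (s - k) * (1 + y) ^ (t - k) * (jQ s t k).eval y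

lemma hasDerivAt_wt (p q y : ℝ) (h1 : -1 < y) (h2 : y < 1) :
    HasDerivAt (fun y : ℝ => (1 - y) ^ p * (1 + y) ^ q)
      ((1 - y) ^ (p - 1) * (1 + y) ^ (q - 1) * ((q - p) - (p + q) * y)) y := by
  have e1 : HasDerivAt (fun y : ℝ => (1 - y) ^ p) (-1 * p * (1 - y) ^ (p - 1)) y := by
    have := ((hasDerivAt_id y).const_sub 1).rpow_const (p := p) (Or.inl (by simp; linarith))
    simpa using this
  have e2 : HasDerivAt (fun y : ℝ => (1 + y) ^ q) (1 * q * (1 + y) ^ (q - 1)) y := by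
    have := ((hasDerivAt_id y).const_add 1).rpow_const (p := q) (Or.inl (by simp; linarith))
    simpa using this
  refine (e1.fun_mul e2).congr_deriv ?_
  have a1 : (1 - y) ^ p = (1 - y) ^ (p - 1) * (1 - y) := by
    rw [Real.rpow_sub_one (by linarith)]; field_simp [show (1 - y) ≠ 0 by linarith]
  have a2 : (1 + y) ^ q = (1 + y) ^ (q - 1) * (1 + y) := by
    rw [Real.rpow_sub_one (by linarith)]; field_simp [show (1 + y) ≠ 0 by linarith]
  rw [a1, a2]; ring

lemma hasDerivAt_jG (s t : ℝ) (k : ℕ) (y : ℝ) (h1 : -1 < y) (h2 : y < 1) :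
    HasDerivAt (jG s t k) (jG s t (k+1) y) y := by
  refine ((hasDerivAt_wt (s - k) (t - k) y h1 h2).fun_mul ((jQ s t k).hasDerivAt y)).congr_deriv ?_
  simp only [jG, jQ]
  have a1 : (1 - y) ^ (s - k) = (1 - y) ^ (s - k - 1) * (1 - y) := by
    rw [Real.rpow_sub_one (by linarith)]; field_simp [show (1 - y) ≠ 0 by linarith]
  have a2 : (1 + y) ^ (t - k) = (1 + y) ^ (t - k - 1) * (1 + y) := by
    rw [Real.rpow_sub_one (by linarith)]; field_simp [show (1 + y) ≠ 0 by linarith]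
  rw [a1, a2]
  push_cast
  simp only [Polynomial.eval_add, Polynomial.eval_mul, Polynomial.eval_sub, Polynomial.eval_C,
    Polynomial.eval_X, Polynomial.eval_pow, Polynomial.eval_one]
  rw [show s - (k + 1 : ℝ) = s - k - 1 by ring, show t - (k + 1 : ℝ) = t - k - 1 by ring]
  ring

lemma iteratedDeriv_jG (s t : ℝ) (k : ℕ) : ∀ y ∈ Ioo (-1 : ℝ) 1,
    iteratedDeriv k (fun y : ℝ => (1 - y) ^ s * (1 + y) ^ t) y = jG s t k y := by
  induction k with
  | zero => intro y _; simp [jG, jQ]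
  | succ k ih =>
    intro y hy
    rw [iteratedDeriv_succ]
    have : iteratedDeriv k (fun y : ℝ => (1 - y) ^ s * (1 + y) ^ t) =ᶠ[nhds y] jG s t k := by
      filter_upwards [isOpen_Ioo.mem_nhds hy] with z hz using ih z hz
    rw [this.deriv_eq, (hasDerivAt_jG s t k y hy.1 hy.2).deriv]

lemma jG_ode (s t : ℝ) (k : ℕ) : ∀ y ∈ Ioo (-1 : ℝ) 1,
    (1 - y ^ 2) * jG s t (k + 2) y = ((t - s) - (s + t) * y + 2 * (k + 1) * y) * jG s t (k + 1) y
      + (-(k + 1) * (s + t) + k * (k + 1)) * jG s t k y := by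
  have step : ∀ (f f' g g' : ℝ → ℝ), (∀ y ∈ Ioo (-1 : ℝ) 1, HasDerivAt f (f' y) y) →
      (∀ y ∈ Ioo (-1 : ℝ) 1, HasDerivAt g (g' y) y) → (∀ y ∈ Ioo (-1 : ℝ) 1, f y = g y) →
      ∀ y ∈ Ioo (-1 : ℝ) 1, f' y = g' y := by
    intro f f' g g' hf hg h y hy
    have : f =ᶠ[nhds y] g := by
      filter_upwards [isOpen_Ioo.mem_nhds hy] with z hz using h z hz
    exact ((hg y hy).congr_of_eventuallyEq this).unique (hf y hy) |>.symm
  have d1 : ∀ y : ℝ, HasDerivAt (fun y : ℝ => 1 - y ^ 2) (-2 * y) y := by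
    intro y
    refine (((hasDerivAt_id y).fun_pow 2).const_sub 1).congr_deriv ?_
    simp
  have dl : ∀ (c d y : ℝ), HasDerivAt (fun y : ℝ => c + d * y) d y := by
    intro c d y
    simpa using ((hasDerivAt_id y).const_mul d).const_add c
  induction k with
  | zero =>
    have base : ∀ y ∈ Ioo (-1 : ℝ) 1, (1 - y ^ 2) * jG s t 1 y =
        ((t - s) + (-(s + t)) * y) * jG s t 0 y := by
      intro y hy
      have a1 : (1 - y) ^ s = (1 - y) ^ (s - 1) * (1 - y) := by
        rw [Real.rpow_sub_one (by linarith [hy.2])]; field_simp [show (1 - y) ≠ 0 by linarith [hy.2]]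
      have a2 : (1 + y) ^ t = (1 + y) ^ (t - 1) * (1 + y) := by
        rw [Real.rpow_sub_one (by linarith [hy.1])]; field_simp [show (1 + y) ≠ 0 by linarith [hy.1]]
      simp [jG, jQ, a1, a2]
      ring
    intro y hy
    have := step _ _ _ _
      (fun y hy => (d1 y).mul (hasDerivAt_jG s t 1 y hy.1 hy.2))
      (fun y hy => (dl (t - s) (-(s+t)) y).mul (hasDerivAt_jG s t 0 y hy.1 hy.2)) base y hy
    norm_num at this ⊢
    linarith
  | succ k ih =>
    intro y hy
    have ih' : ∀ y ∈ Ioo (-1 : ℝ) 1,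
      (1 - y ^ 2) * jG s t (k + 2) y = ((t - s) + (2 * (k + 1) - (s + t)) * y) * jG s t (k + 1) y
      + (-(k + 1) * (s + t) + k * (k + 1)) * jG s t k y := by
      intro y hy; rw [ih y hy]; ring
    have := step _ _ _ _
      (fun y hy => (d1 y).mul (hasDerivAt_jG s t (k+2) y hy.1 hy.2))
      (fun y hy => ((dl (t - s) (2 * (k + 1) - (s + t)) y).mul
        (hasDerivAt_jG s t (k+1) y hy.1 hy.2)).add
        ((hasDerivAt_jG s t k y hy.1 hy.2).const_mul (-(k + 1) * (s + t) + k * (k + 1)))) ih' y hy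
    have e : k + 1 + 2 = k + 2 + 1 := rfl
    rw [e]
    push_cast at this ⊢
    simp only [show k + 1 + 1 = k + 2 from rfl] at this ⊢
    linear_combination this

lemma jQ_natDegree (s t : ℝ) (k : ℕ) : (jQ s t k).natDegree ≤ k ∧
    (jQ s t k).coeff k = (-1) ^ k * ∏ j ∈ Finset.range k, (s + t - j) := by
  induction k with
  | zero => simp [jQ]
  | succ k ih =>
    obtain ⟨h1, h2⟩ := ih
    constructor
    · rw [Polynomial.natDegree_le_iff_coeff_eq_zero]
      intro N hN
      have hz : ∀ m, k < m → (jQ s t k).coeff m = 0 := fun m hm =>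
        Polynomial.coeff_eq_zero_of_natDegree_lt (by omega)
      obtain ⟨M, rfl⟩ : ∃ M, N = M + 2 := ⟨N - 2, by omega⟩
      have e : jQ s t (k+1) = Polynomial.derivative (jQ s t k)
        - Polynomial.derivative (jQ s t k) * Polynomial.X ^ 2
        + (Polynomial.C (t - s) * jQ s t k
        - Polynomial.C (s + t - 2 * k) * (jQ s t k * Polynomial.X)) := by rw [jQ]; ring
      rw [e]
      simp only [Polynomial.coeff_add, Polynomial.coeff_sub, Polynomial.coeff_mul_X_pow,
        Polynomial.coeff_C_mul, Polynomial.coeff_derivative]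
      rw [show M + 2 = M + 1 + 1 from rfl, Polynomial.coeff_mul_X]
      rw [hz _ (by omega), hz (M+1+1) (by omega), hz (M+1) (by omega)]
      simp
    · have e : jQ s t (k+1) = Polynomial.derivative (jQ s t k)
        - (Polynomial.derivative (jQ s t k) * Polynomial.X) * Polynomial.X
        + (Polynomial.C (t - s) * jQ s t k
        - Polynomial.C (s + t - 2 * k) * (jQ s t k * Polynomial.X)) := by rw [jQ]; ring
      have hz : ∀ m, k < m → (jQ s t k).coeff m = 0 := fun m hm =>
        Polynomial.coeff_eq_zero_of_natDegree_lt (by omega)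
      have hd : (Polynomial.derivative (jQ s t k) * Polynomial.X).coeff k =
          k * (jQ s t k).coeff k := by
        cases k with
        | zero => simp
        | succ m => rw [Polynomial.coeff_mul_X, Polynomial.coeff_derivative]; push_cast; ring
      rw [e]
      simp only [Polynomial.coeff_add, Polynomial.coeff_sub, Polynomial.coeff_mul_X,
        Polynomial.coeff_C_mul, hd, Polynomial.coeff_derivative]
      rw [hz (k+1+1) (by omega), hz (k+1) (by omega), h2, Finset.prod_range_succ]
      ring

lemma wt_integrable (s t : ℝ) (hs : -1 < s) (ht : -1 < t) :
    IntervalIntegrable (fun y : ℝ => (1 - y) ^ s * (1 + y) ^ t) volume (-1) 1 := by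
  have i1 : IntervalIntegrable (fun y : ℝ => (1 + y) ^ t) volume (-1) 0 := by
    have := (intervalIntegral.intervalIntegrable_rpow' (a := 0) (b := 1) ht).comp_add_left 1
    simpa using this
  have i2 : IntervalIntegrable (fun y : ℝ => (1 - y) ^ s) volume 0 1 := by
    have := (intervalIntegral.intervalIntegrable_rpow' (a := 1) (b := 0) hs).comp_sub_left 1
    simpa using this
  refine IntervalIntegrable.trans (b := 0) ?_ ?_
  · refine i1.continuousOn_mul ?_
    rw [uIcc_of_le (by norm_num)]
    intro y hy
    refine ContinuousAt.continuousWithinAt ?_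
    refine ContinuousAt.rpow_const (by fun_prop) (Or.inl ?_)
    linarith [hy.2]
  · refine i2.mul_continuousOn ?_
    rw [uIcc_of_le (by norm_num)]
    intro y hy
    refine ContinuousAt.continuousWithinAt ?_
    refine ContinuousAt.rpow_const (by fun_prop) (Or.inl ?_)
    linarith [hy.1]

lemma jG_integrable (s t : ℝ) (k : ℕ) (hs : -1 < s - k) (ht : -1 < t - k) :
    IntervalIntegrable (jG s t k) volume (-1) 1 :=
  (wt_integrable _ _ hs ht).mul_continuousOn (jQ s t k).continuous.continuousOn

lemma jG_ibp (s t : ℝ) (k : ℕ) (q : Polynomial ℝ) (hs : 0 < s - k) (ht : 0 < t - k) :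
    ∫ y in (-1 : ℝ)..1, q.eval y * jG s t (k+1) y =
      - ∫ y in (-1 : ℝ)..1, (Polynomial.derivative q).eval y * jG s t k y := by
  have hc : Continuous (jG s t k) := by
    unfold jG
    refine Continuous.mul (Continuous.mul ?_ ?_) (jQ s t k).continuous
    · exact Continuous.rpow_const (by fun_prop) (fun _ => Or.inr hs.le)
    · exact Continuous.rpow_const (by fun_prop) (fun _ => Or.inr ht.le)
  rw [intervalIntegral.integral_mul_deriv_eq_deriv_mul_of_hasDerivAt (v := jG s t k)
    (u' := fun y => (Polynomial.derivative q).eval y)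
    q.continuous.continuousOn hc.continuousOn (fun x _ => q.hasDerivAt x)]
  · have e1 : jG s t k 1 = 0 := by simp [jG, Real.zero_rpow hs.ne']
    have e2 : jG s t k (-1) = 0 := by simp [jG, Real.zero_rpow ht.ne']
    rw [e1, e2]; ring
  · intro x hx
    norm_num at hx
    exact hasDerivAt_jG s t k x hx.1 hx.2
  · exact (Polynomial.derivative q).continuous.intervalIntegrable _ _
  · exact jG_integrable _ _ _ (by push_cast; linarith) (by push_cast; linarith)

lemma jG_ibp_iter (s t : ℝ) (k : ℕ) : ∀ (q : Polynomial ℝ) (_ : -1 < s - k) (_ : -1 < t - k),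
    ∫ y in (-1 : ℝ)..1, q.eval y * jG s t k y =
      (-1) ^ k * ∫ y in (-1 : ℝ)..1, (Polynomial.derivative^[k] q).eval y * jG s t 0 y := by
  induction k with
  | zero => intro q _ _; simp
  | succ k ih =>
    intro q h1 h2
    push_cast at h1 h2
    rw [jG_ibp s t k q (by linarith) (by linarith), ih _ (by linarith) (by linarith)]
    rw [Function.iterate_succ_apply]; ring

/-- Beta integral on `[-1,1]`. -/
noncomputable def jB (s t : ℝ) : ℝ := ∫ y in (-1 : ℝ)..1, (1 - y) ^ s * (1 + y) ^ t

lemma jB_nonneg (s t : ℝ) : 0 ≤ jB s t := by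
  refine intervalIntegral.integral_nonneg (by norm_num) (fun y hy => ?_)
  have h1 : 0 ≤ 1 - y := by linarith [hy.2]
  have h2 : 0 ≤ 1 + y := by linarith [hy.1]
  positivity

lemma jB_rec (s t : ℝ) (hs : -1 < s) (ht : -1 < t) :
    (s + t + 3) * (s + t + 2) * jB (s+1) (t+1) = 4 * (s + 1) * (t + 1) * jB s t := by
  set w : ℝ → ℝ := fun y => (1 - y) ^ s * (1 + y) ^ t with hw
  have hwi : IntervalIntegrable w volume (-1) 1 := wt_integrable s t hs ht
  have hw1 : IntervalIntegrable (fun y => y * w y) volume (-1) 1 :=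
    hwi.continuousOn_mul continuousOn_id
  have hw2 : IntervalIntegrable (fun y => y ^ 2 * w y) volume (-1) 1 :=
    hwi.continuousOn_mul (by fun_prop)
  have eB : jB s t = ∫ y in (-1 : ℝ)..1, w y := rfl
  have key : ∀ y ∈ uIcc (-1 : ℝ) 1, (1 - y) ^ (s+1) * (1 + y) ^ (t+1) = (1 - y ^ 2) * w y := by
    intro y hy
    rw [uIcc_of_le (by norm_num)] at hy
    rw [hw]
    simp only
    rw [Real.rpow_add_one' (by linarith [hy.2]) (by linarith),
      Real.rpow_add_one' (by linarith [hy.1]) (by linarith)]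
    ring
  have g1 : ∀ y, jG (s+1) (t+1) 1 y = ((t - s) - (s + t + 2) * y) * w y := by
    intro y
    simp [jG, jQ, hw]; ring
  have g0 : ∀ y ∈ uIcc (-1 : ℝ) 1, jG (s+1) (t+1) 0 y = (1 - y ^ 2) * w y := by
    intro y hy
    rw [← key y hy]; simp [jG, jQ]
  have eB1 : jB (s+1) (t+1) = (∫ y in (-1 : ℝ)..1, w y) - ∫ y in (-1 : ℝ)..1, y ^ 2 * w y := by
    rw [jB, intervalIntegral.integral_congr key, ← intervalIntegral.integral_sub hwi hw2]
    congr 1; ext y; ring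
  have r1 := jG_ibp (s+1) (t+1) 0 1 (by simp; linarith) (by simp; linarith)
  have r2 := jG_ibp (s+1) (t+1) 0 Polynomial.X (by simp; linarith) (by simp; linarith)
  simp only [zero_add, g1, Polynomial.eval_one, one_mul, Polynomial.derivative_one,
    Polynomial.eval_zero, zero_mul, intervalIntegral.integral_zero, neg_zero] at r1
  simp only [zero_add, g1, Polynomial.eval_X, Polynomial.derivative_X, Polynomial.eval_one,
    one_mul] at r2
  rw [intervalIntegral.integral_congr g0] at r2
  have q1 : ∫ y in (-1 : ℝ)..1, ((t - s) - (s + t + 2) * y) * w y =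
      (t - s) * (∫ y in (-1 : ℝ)..1, w y) - (s + t + 2) * ∫ y in (-1 : ℝ)..1, y * w y := by
    rw [← intervalIntegral.integral_const_mul, ← intervalIntegral.integral_const_mul,
      ← intervalIntegral.integral_sub (hwi.const_mul _) (hw1.const_mul _)]
    congr 1; ext y; ring
  have q2 : ∫ y in (-1 : ℝ)..1, y * (((t - s) - (s + t + 2) * y) * w y) =
      (t - s) * (∫ y in (-1 : ℝ)..1, y * w y) - (s + t + 2) * ∫ y in (-1 : ℝ)..1, y ^ 2 * w y := by
    rw [← intervalIntegral.integral_const_mul, ← intervalIntegral.integral_const_mul,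
      ← intervalIntegral.integral_sub (hw1.const_mul _) (hw2.const_mul _)]
    congr 1; ext y; ring
  have q3 : ∫ y in (-1 : ℝ)..1, (1 - y ^ 2) * w y =
      (∫ y in (-1 : ℝ)..1, w y) - ∫ y in (-1 : ℝ)..1, y ^ 2 * w y := by
    rw [← intervalIntegral.integral_sub hwi hw2]
    congr 1; ext y; ring
  rw [q1] at r1
  rw [q2, q3] at r2
  rw [eB, eB1]
  generalize (∫ y in (-1 : ℝ)..1, w y) = I0 at *
  generalize (∫ y in (-1 : ℝ)..1, y * w y) = I1 at *
  generalize (∫ y in (-1 : ℝ)..1, y ^ 2 * w y) = I2 at *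
  linear_combination (s + t + 2) * r2 + (t - s) * r1

lemma jQ_norm (s t : ℝ) (n : ℕ) (hs : -1 < s - n) (ht : -1 < t - n) :
    ∫ y in (-1 : ℝ)..1, (jQ s t n).eval y * jG s t n y =
      n.factorial * (∏ j ∈ Finset.range n, (s + t - j)) * jB s t := by
  rw [jG_ibp_iter s t n _ hs ht]
  obtain ⟨h1, h2⟩ := jQ_natDegree s t n
  have e : Polynomial.derivative^[n] (jQ s t n) =
      Polynomial.C (n.factorial * (jQ s t n).coeff n) := by
    have hd : (Polynomial.derivative^[n] (jQ s t n)).natDegree ≤ 0 :=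
      (Polynomial.natDegree_iterate_derivative _ _).trans (by omega)
    rw [Polynomial.eq_C_of_natDegree_le_zero hd, Polynomial.coeff_iterate_derivative]
    simp [Nat.descFactorial_self]
  rw [e, h2]
  simp only [Polynomial.eval_C, intervalIntegral.integral_const_mul]
  have e0 : ∀ y, jG s t 0 y = (1 - y) ^ s * (1 + y) ^ t := by intro y; simp [jG, jQ]
  simp only [e0]
  rw [← jB]
  have : ((-1 : ℝ) ^ n) * (-1) ^ n = 1 := by rw [← mul_pow]; norm_num
  linear_combination (n.factorial * (∏ j ∈ Finset.range n, (s + t - j)) * jB s t) * this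

lemma jacobi_norm_bound (α β : ℝ) (hα : -1 < α) (hβ : -1 < β) :
    ∃ M : ℝ, 0 < M ∧ ∃ N : ℕ, 1 ≤ N ∧ ∀ n : ℕ, N ≤ n →
      n * (((-1 : ℝ) ^ n / (2 ^ n * (n.factorial : ℝ))) ^ 2 *
        ∫ y in (-1 : ℝ)..1, (jQ (n + α) (n + β) n).eval y * jG (n + α) (n + β) n y) ≤ M := by
  set σ := α + β with hσ
  set D : ℕ → ℝ := fun n => ∏ j ∈ Finset.range n, (2 * n + σ - j) with hD
  set h : ℕ → ℝ := fun n => D n * jB (n + α) (n + β) / (4 ^ n * n.factorial) with hh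
  have hform : ∀ n : ℕ, ((-1 : ℝ) ^ n / (2 ^ n * (n.factorial : ℝ))) ^ 2 *
        ∫ y in (-1 : ℝ)..1, (jQ (n + α) (n + β) n).eval y * jG (n + α) (n + β) n y = h n := by
    intro n
    rw [jQ_norm _ _ _ (by linarith) (by linarith)]
    simp only [hh, hD]
    rw [show (n + α + (n + β) : ℝ) = 2 * n + σ by rw [hσ]; ring]
    have : (n.factorial : ℝ) ≠ 0 := by positivity
    have e1 : ((-1 : ℝ) ^ n) ^ 2 = 1 := by rw [← pow_mul, mul_comm, pow_mul]; norm_num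
    have e2 : ((2 : ℝ) ^ n) ^ 2 = 4 ^ n := by rw [← pow_mul, mul_comm, pow_mul]; norm_num
    rw [div_pow, mul_pow, e1, e2]
    field_simp
  have Dpos : ∀ n : ℕ, 1 ≤ n → 0 < D n := by
    intro n hn
    refine Finset.prod_pos (fun j hj => ?_)
    have : (j : ℝ) + 1 ≤ n := by exact_mod_cast Finset.mem_range.mp hj
    have : (1 : ℝ) ≤ n := by exact_mod_cast hn
    linarith
  have hnn : ∀ n : ℕ, 1 ≤ n → 0 ≤ h n := by
    intro n hn
    have := (Dpos n hn).le
    have := jB_nonneg (n + α) (n + β)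
    simp only [hh]; positivity
  have Drec : ∀ n : ℕ, (n + 1 + σ) * D (n+1) = (2 * n + σ + 1) * (2 * n + σ + 2) * D n := by
    intro n
    simp only [hD]
    rw [Finset.prod_range_succ']
    have e : ∀ k : ℕ, (2 * ((n + 1 : ℕ) : ℝ) + σ - ((k + 1 : ℕ) : ℝ)) = 2 * n + 1 + σ - k := by
      intro k; push_cast; ring
    simp only [e]
    have f1 := Finset.prod_range_succ (fun k : ℕ => (2 * n + 1 + σ - k : ℝ)) n
    have f2 := Finset.prod_range_succ' (fun k : ℕ => (2 * n + 1 + σ - k : ℝ)) n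
    have e' : ∀ k : ℕ, (2 * (n : ℝ) + 1 + σ - ((k + 1 : ℕ) : ℝ)) = 2 * n + σ - k := by
      intro k; push_cast; ring
    simp only [e'] at f2
    rw [f1] at f2
    push_cast at f2 ⊢
    linear_combination (2 * n + σ + 2) * f2
  have hrec : ∀ n : ℕ, (2 * n + σ + 3) * h (n+1) * ((n + 1) * (n + 1 + σ)) =
      (2 * n + σ + 1) * h n * ((n + α + 1) * (n + β + 1)) := by
    intro n
    have hn0 : (0 : ℝ) ≤ n := by positivity
    have b := jB_rec (n + α) (n + β) (by linarith) (by linarith)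
    have d := Drec n
    have e1 : ((n + 1 : ℕ) : ℝ) + α = n + α + 1 := by push_cast; ring
    have e2 : ((n + 1 : ℕ) : ℝ) + β = n + β + 1 := by push_cast; ring
    simp only [hh]
    rw [e1, e2, Nat.factorial_succ, pow_succ]
    have f0 : (n.factorial : ℝ) ≠ 0 := by positivity
    have f1 : (n + 1 : ℝ) ≠ 0 := by positivity
    push_cast
    generalize jB (n + α + 1) (n + β + 1) = B' at *
    generalize jB (n + α) (n + β) = B at *
    generalize D (n + 1) = D' at *
    generalize D n = D0 at *
    field_simp
    rw [show (n + α + (n + β) : ℝ) = 2 * n + σ by rw [hσ]; ring] at b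
    linear_combination (2 * n + σ + 3) * B' * d + (2 * n + σ + 1) * D0 * b
  set K := |α * β| with hK
  have hK0 : 0 ≤ K := abs_nonneg _
  set g : ℕ → ℝ := fun n => (2 * n + σ + 1) * h n with hg
  have gnn : ∀ n : ℕ, 1 ≤ n → 0 ≤ g n := by
    intro n hn
    have : (1 : ℝ) ≤ n := by exact_mod_cast hn
    exact mul_nonneg (by linarith) (hnn n hn)
  have main : ∀ n : ℕ, 2 ≤ n → g n * Real.exp (K / (n - 1)) ≤ g 2 * Real.exp K := by
    intro n hn
    induction n, hn using Nat.le_induction with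
    | base => norm_num
    | succ n hn ih =>
      refine le_trans ?_ ih
      have hn2 : (2 : ℝ) ≤ n := by exact_mod_cast hn
      have p1 : 0 < (n : ℝ) - 1 := by linarith
      have p2 : (n : ℝ) - 1 ≤ n + 1 + σ := by linarith
      have step : g (n+1) ≤ g n * (1 + K / (n * (n - 1))) := by
        have r := hrec n
        have p3 : 0 < (n + 1 : ℝ) * (n + 1 + σ) := by
          apply mul_pos <;> linarith
        have e : g (n+1) = g n * (1 + α * β / ((n + 1) * (n + 1 + σ))) := by
          simp only [hg]
          have p3' : (n + 1 : ℝ) * (n + 1 + σ) ≠ 0 := p3.ne'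
          generalize h (n + 1) = H' at *
          generalize h n = H at *
          rw [← mul_left_inj' p3']
          have : H * (α * β / ((n + 1) * (n + 1 + σ))) * ((n + 1) * (n + 1 + σ)) = H * (α * β) := by
            rw [mul_assoc, div_mul_cancel₀ _ p3']
          push_cast
          linear_combination r - (2 * n + σ + 1) * this + (2 * n + σ + 1) * H * (n + 1) * hσ
        rw [e]
        refine mul_le_mul_of_nonneg_left ?_ (gnn n (by omega))
        gcongr
        · exact le_abs_self _
        · linarith
      have ex : 1 + K / (n * (n - 1)) ≤ Real.exp (K / (n * (n - 1))) := by
        rw [add_comm]; exact Real.add_one_le_exp _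
      have := mul_le_mul_of_nonneg_left ex (gnn n (by omega))
      have q : g (n+1) ≤ g n * Real.exp (K / (n * (n - 1))) := step.trans this
      calc g (n+1) * Real.exp (K / ((n + 1 : ℕ) - 1))
          ≤ g n * Real.exp (K / (n * (n - 1))) * Real.exp (K / ((n + 1 : ℕ) - 1)) := by gcongr
        _ = g n * Real.exp (K / (n - 1)) := by
          rw [mul_assoc, ← Real.exp_add]
          congr 2
          push_cast
          have : (n : ℝ) ≠ 0 := by positivity
          have : (n : ℝ) - 1 ≠ 0 := p1.ne'
          rw [add_sub_cancel_right]
          field_simp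
          ring
  refine ⟨g 2 * Real.exp K + 1, ?_, 2, by norm_num, ?_⟩
  · have := gnn 2 (by norm_num); positivity
  · intro n hn
    rw [hform]
    have hn2 : (2 : ℝ) ≤ n := by exact_mod_cast hn
    have m := main n hn
    have : 1 ≤ Real.exp (K / (n - 1)) := Real.one_le_exp (by apply div_nonneg hK0; linarith)
    have m2 : g n ≤ g n * Real.exp (K / (n - 1)) := le_mul_of_one_le_right (gnn n (by omega)) this
    have m3 : n * h n ≤ g n := by
      simp only [hg]
      exact mul_le_mul_of_nonneg_right (by linarith) (hnn n (by omega))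
    linarith

lemma ode_energy (a b c0 c1 : ℝ) (ha : -1 < a) (hab : a < b) (hb : b < 1) :
    ∃ C : ℝ, 0 < C ∧ ∃ N : ℝ, 1 ≤ N ∧ ∀ (n Λ : ℝ) (v v1 v2 : ℝ → ℝ), N ≤ n → n ^ 2 / 4 ≤ Λ →
      (∀ x ∈ Icc a b, HasDerivAt v (v1 x) x) → (∀ x ∈ Icc a b, HasDerivAt v1 (v2 x) x) →
      (∀ x ∈ Icc a b, (1 - x ^ 2) * v2 x + (c0 + c1 * x) * v1 x + Λ * v x = 0) →
      ∀ x ∈ Icc a b, Λ * v x ^ 2 + (1 - x ^ 2) * v1 x ^ 2 ≤ C * (Λ * ∫ y in a..b, v y ^ 2) := by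
  set δ := (1 - b) * (1 + a) with hδ
  have hδ0 : 0 < δ := mul_pos (by linarith) (by linarith)
  have hδx : ∀ x ∈ Icc a b, δ ≤ 1 - x ^ 2 := by
    intro x hx
    have : 1 - x ^ 2 = (1 - x) * (1 + x) := by ring
    rw [this, hδ]
    exact mul_le_mul (by linarith [hx.2]) (by linarith [hx.1]) (by linarith) (by linarith [hx.2])
  set K := |c0| + |c1| + 2 with hK
  have hK0 : 0 < K := by positivity
  have hKx : ∀ x ∈ Icc a b, |c0 + c1 * x + x| ≤ K ∧ |2 * x + (c0 + c1 * x)| ≤ K := by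
    intro x hx
    have hx1 : |x| ≤ 1 := abs_le.2 ⟨by linarith [hx.1], by linarith [hx.2]⟩
    have h1 : |c1 * x| ≤ |c1| := by
      rw [abs_mul]; exact mul_le_of_le_one_right (abs_nonneg _) hx1
    constructor
    · calc |c0 + c1 * x + x| ≤ |c0| + |c1 * x| + |x| := abs_add_three _ _ _
        _ ≤ K := by rw [hK]; linarith
    · have h2 : |2 * x| ≤ 2 := by rw [abs_mul]; norm_num; linarith
      calc |2 * x + (c0 + c1 * x)| ≤ |2 * x| + (|c0| + |c1 * x|) :=
            (abs_add_le _ _).trans (by gcongr; exact abs_add_le _ _)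
        _ ≤ K := by rw [hK]; linarith
  set M := 2 * K / δ with hM
  have hM0 : 0 < M := by positivity
  set R := Real.exp (M * (b - a)) with hR
  have hR0 : 0 < R := Real.exp_pos _
  set K2 := 4 + 1 / δ with hK2
  have hK20 : 0 < K2 := by positivity
  set K3 := K2 * R * (2 + (b - a) * K) with hK3
  have hba : 0 < b - a := by linarith
  have hK30 : 0 < K3 := by positivity
  refine ⟨4 * R ^ 2 / (b - a), by positivity, 1 + 2 * R * K3 / (b - a), ?_, ?_⟩
  · have : 0 < 2 * R * K3 / (b - a) := by positivity
    linarith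
  intro n Λ v v1 v2 hn hΛ hv hv1 hode
  have hn0 : 0 < n := by
    have : 0 < 2 * R * K3 / (b - a) := by positivity
    linarith
  have hΛ0 : 0 < Λ := lt_of_lt_of_le (by positivity) hΛ
  set E : ℝ → ℝ := fun x => Λ * v x ^ 2 + (1 - x ^ 2) * v1 x ^ 2 with hE
  have d1 : ∀ y : ℝ, HasDerivAt (fun y : ℝ => 1 - y ^ 2) (-2 * y) y := by
    intro y
    refine (((hasDerivAt_id y).fun_pow 2).const_sub 1).congr_deriv ?_
    simp
  have hvc : ContinuousOn v (Icc a b) := HasDerivAt.continuousOn hv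
  have hv1c : ContinuousOn v1 (Icc a b) := HasDerivAt.continuousOn hv1
  have hEd : ∀ x ∈ Icc a b, HasDerivAt E (-2 * (c0 + c1 * x + x) * v1 x ^ 2) x := by
    intro x hx
    refine ((((hv x hx).fun_pow 2).const_mul Λ).fun_add
      ((d1 x).fun_mul ((hv1 x hx).fun_pow 2))).congr_deriv ?_
    have := hode x hx
    norm_num
    linear_combination 2 * v1 x * this
  have hEc : ContinuousOn E (Icc a b) := HasDerivAt.continuousOn hEd
  have hv1E : ∀ x ∈ Icc a b, δ * v1 x ^ 2 ≤ E x := by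
    intro x hx
    have := mul_le_mul_of_nonneg_right (hδx x hx) (sq_nonneg (v1 x))
    have : 0 ≤ Λ * v x ^ 2 := by positivity
    simp only [hE]; linarith
  have hE0 : ∀ x ∈ Icc a b, 0 ≤ E x := fun x hx => le_trans (by positivity) (hv1E x hx)
  have hEb : ∀ x ∈ Icc a b, |-2 * (c0 + c1 * x + x) * v1 x ^ 2| ≤ M * E x := by
    intro x hx
    rw [abs_mul, abs_mul, abs_of_nonneg (sq_nonneg (v1 x))]
    have h1 := (hKx x hx).1
    have h2 := hv1E x hx
    calc |(-2 : ℝ)| * |c0 + c1 * x + x| * v1 x ^ 2 ≤ 2 * K * v1 x ^ 2 := by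
          gcongr; norm_num
      _ = M * (δ * v1 x ^ 2) := by rw [hM]; field_simp
      _ ≤ M * E x := by gcongr
  have hexp : ∀ (m x : ℝ), HasDerivAt (fun x : ℝ => Real.exp (m * x)) (Real.exp (m * x) * m) x := by
    intro m x
    simpa using ((hasDerivAt_id x).const_mul m).exp
  have mono : MonotoneOn (fun x => E x * Real.exp (M * x)) (Icc a b) := by
    have hd : ∀ x ∈ Icc a b, HasDerivAt (fun x => E x * Real.exp (M * x)) _ x :=
      fun x hx => (hEd x hx).fun_mul (hexp M x)
    refine monotoneOn_of_deriv_nonneg (convex_Icc a b) (HasDerivAt.continuousOn hd)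
      (fun x hx => (hd x (interior_subset hx)).differentiableAt.differentiableWithinAt) ?_
    intro x hx
    have hx := interior_subset hx
    rw [(hd x hx).deriv]
    have := neg_le_of_abs_le (hEb x hx)
    have e := Real.exp_pos (M * x)
    nlinarith
  have anti : AntitoneOn (fun x => E x * Real.exp (-M * x)) (Icc a b) := by
    have hd : ∀ x ∈ Icc a b, HasDerivAt (fun x => E x * Real.exp (-M * x)) _ x :=
      fun x hx => (hEd x hx).fun_mul (hexp (-M) x)
    refine antitoneOn_of_deriv_nonpos (convex_Icc a b) (HasDerivAt.continuousOn hd)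
      (fun x hx => (hd x (interior_subset hx)).differentiableAt.differentiableWithinAt) ?_
    intro x hx
    have hx := interior_subset hx
    rw [(hd x hx).deriv]
    have := le_of_abs_le (hEb x hx)
    have e := Real.exp_pos (-M * x)
    nlinarith
  have comp : ∀ x ∈ Icc a b, ∀ y ∈ Icc a b, E x ≤ R * E y := by
    intro x hx y hy
    rcases le_total x y with h | h
    · have := mono hx hy h
      simp only at this
      have e : E x ≤ E y * Real.exp (M * (y - x)) := by
        rw [mul_sub, Real.exp_sub, ← mul_div_assoc, le_div_iff₀ (Real.exp_pos _)]; exact this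
      refine e.trans ?_
      rw [mul_comm]
      refine mul_le_mul_of_nonneg_right ?_ (hE0 y hy)
      rw [hR]; gcongr
      · exact hy.2
      · exact hx.1
    · have := anti hy hx h
      simp only at this
      have e : E x ≤ E y * Real.exp (M * (x - y)) := by
        rw [show M * (x - y) = -M * y - -M * x by ring, Real.exp_sub, ← mul_div_assoc,
          le_div_iff₀ (Real.exp_pos _)]; exact this
      refine e.trans ?_
      rw [mul_comm]
      refine mul_le_mul_of_nonneg_right ?_ (hE0 y hy)
      rw [hR]; gcongr
      · exact hx.2
      · exact hy.1
  have haI : a ∈ Icc a b := ⟨le_rfl, hab.le⟩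
  have hbI : b ∈ Icc a b := ⟨hab.le, le_rfl⟩
  set e0 := E a with he0
  have he00 : 0 ≤ e0 := hE0 a haI
  have hvv : ∀ x ∈ Icc a b, |v x * v1 x| ≤ K2 * R * e0 / n := by
    intro x hx
    rw [le_div_iff₀ hn0]
    have h1 : n ^ 2 * v x ^ 2 ≤ 4 * E x := by
      have : 0 ≤ (1 - x ^ 2) * v1 x ^ 2 :=
        mul_nonneg (hδ0.le.trans (hδx x hx)) (sq_nonneg _)
      have := mul_le_mul_of_nonneg_right hΛ (sq_nonneg (v x))
      simp only [hE]; linarith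
    have h2 : v1 x ^ 2 ≤ 1 / δ * E x := by
      rw [one_div, inv_mul_eq_div, le_div_iff₀ hδ0, mul_comm]; exact hv1E x hx
    have h3 : |v x * v1 x| * n ≤ n ^ 2 * v x ^ 2 + v1 x ^ 2 := by
      rw [abs_mul, ← sq_abs (v x), ← sq_abs (v1 x)]
      nlinarith [sq_nonneg (n * |v x| - |v1 x|), sq_nonneg (n * |v x|), sq_nonneg (|v1 x|)]
    calc _ ≤ K2 * E x := by rw [hK2]; linarith
      _ ≤ K2 * (R * e0) := by gcongr; exact comp x hx a haI
      _ = _ := by ring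
  set F : ℝ → ℝ := fun x => (1 - x ^ 2) * (v x * v1 x) with hF
  set F' : ℝ → ℝ := fun x => (1 - x ^ 2) * v1 x ^ 2 - (2 * x + (c0 + c1 * x)) * (v x * v1 x)
    - Λ * v x ^ 2 with hF'
  have hFd : ∀ x ∈ Icc a b, HasDerivAt F (F' x) x := by
    intro x hx
    refine ((d1 x).fun_mul ((hv x hx).fun_mul (hv1 x hx))).congr_deriv ?_
    have := hode x hx
    simp only [hF']
    linear_combination v x * this
  have hF'c : ContinuousOn F' (Icc a b) := by
    simp only [hF']; fun_prop
  have hFb : ∀ x ∈ Icc a b, |F x| ≤ K2 * R * e0 / n := by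
    intro x hx
    simp only [hF]
    rw [abs_mul, abs_of_nonneg (hδ0.le.trans (hδx x hx))]
    refine le_trans ?_ (hvv x hx)
    exact mul_le_of_le_one_left (abs_nonneg _) (by nlinarith [sq_nonneg x])
  have hIntg : ∫ x in a..b, F' x = F b - F a :=
    intervalIntegral.integral_eq_sub_of_hasDerivAt (by rwa [uIcc_of_le hab.le])
      (by apply ContinuousOn.intervalIntegrable; rwa [uIcc_of_le hab.le])
  have hFi : IntervalIntegrable F' volume a b := by
    apply ContinuousOn.intervalIntegrable; rwa [uIcc_of_le hab.le]
  have hvi : IntervalIntegrable (fun x => v x ^ 2) volume a b := by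
    apply ContinuousOn.intervalIntegrable; rw [uIcc_of_le hab.le]; fun_prop
  set T := K * (K2 * R * e0 / n) with hT
  have ineq : ∫ x in a..b, (e0 / R) ≤ ∫ x in a..b, (2 * Λ * v x ^ 2 + F' x + T) := by
    refine intervalIntegral.integral_mono_on hab.le (by simp)
      (((hvi.const_mul _).add hFi).add (by simp)) ?_
    intro x hx
    have h1 : e0 / R ≤ E x := by
      rw [div_le_iff₀ hR0, mul_comm]; exact comp a haI x hx
    have h2 : (2 * x + (c0 + c1 * x)) * (v x * v1 x) ≤ T := by
      refine (le_abs_self _).trans ?_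
      rw [abs_mul]
      exact mul_le_mul (hKx x hx).2 (hvv x hx) (abs_nonneg _) hK0.le
    simp only [hE] at h1
    simp only [hF']
    linarith
  rw [intervalIntegral.integral_add ((hvi.const_mul _).add hFi) (by simp),
    intervalIntegral.integral_add (hvi.const_mul _) hFi, hIntg,
    intervalIntegral.integral_const_mul] at ineq
  simp only [intervalIntegral.integral_const, smul_eq_mul] at ineq
  set H := ∫ y in a..b, v y ^ 2 with hH
  have hbb := le_of_abs_le (hFb b hbI)
  have haa := neg_le_of_abs_le (hFb a haI)
  have h5 : (b - a) * (e0 / R) ≤ 2 * Λ * H + K3 * e0 / n := by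
    have : K3 * e0 / n = K2 * R * e0 / n + K2 * R * e0 / n + (b - a) * T := by
      rw [hK3, hT]; ring
    linarith
  have h6 : K3 * e0 / n ≤ (b - a) * (e0 / R) / 2 := by
    have h7 : 2 * R * K3 ≤ n * (b - a) := by
      rw [← div_le_iff₀ hba]; linarith
    rw [div_le_iff₀ hn0]
    have := mul_le_mul_of_nonneg_right h7 (show 0 ≤ e0 / R / 2 by positivity)
    calc K3 * e0 = 2 * R * K3 * (e0 / R / 2) := by field_simp
      _ ≤ _ := this
      _ = _ := by ring
  have h8 : e0 ≤ 4 * R / (b - a) * (Λ * H) := by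
    have : (b - a) * (e0 / R) ≤ 4 * (Λ * H) := by linarith
    rw [← mul_div_assoc, div_le_iff₀ hR0] at this
    rw [div_mul_eq_mul_div, le_div_iff₀ hba]
    linarith
  intro x hx
  calc E x ≤ R * e0 := comp x hx a haI
    _ ≤ R * (4 * R / (b - a) * (Λ * H)) := by gcongr
    _ = _ := by ring

lemma ode_osc (a b c0 c1 : ℝ) (hab : a < b) (ω ω' : ℝ → ℝ)
    (hω : ∀ x ∈ Icc a b, HasDerivAt ω (ω' x) x) (hω' : ContinuousOn ω' (Icc a b)) :
    ∃ C : ℝ, 0 < C ∧ ∀ (Λ B : ℝ) (v v1 v2 : ℝ → ℝ), 0 ≤ B → 0 < Λ →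
      (∀ x ∈ Icc a b, HasDerivAt v (v1 x) x) → (∀ x ∈ Icc a b, HasDerivAt v1 (v2 x) x) →
      (∀ x ∈ Icc a b, (1 - x ^ 2) * v2 x + (c0 + c1 * x) * v1 x + Λ * v x = 0) →
      (∀ x ∈ Icc a b, |v1 x| ≤ B) →
      ∀ c ∈ Icc a b, ∀ d ∈ Icc a b, |∫ x in c..d, ω x * v x| ≤ C * B / Λ := by
  have hωc : ContinuousOn ω (Icc a b) := HasDerivAt.continuousOn hω
  set p : ℝ → ℝ := fun x => ω x * (1 - x ^ 2) with hp
  set q : ℝ → ℝ := fun x => ω' x * (1 - x ^ 2) - 2 * x * ω x - ω x * (c0 + c1 * x) with hq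
  have hpc : ContinuousOn p (Icc a b) := by simp only [hp]; fun_prop
  have hqc : ContinuousOn q (Icc a b) := by simp only [hq]; fun_prop
  obtain ⟨Cp, hCp⟩ := isCompact_Icc.exists_bound_of_continuousOn hpc
  obtain ⟨Cq, hCq⟩ := isCompact_Icc.exists_bound_of_continuousOn hqc
  have haI : a ∈ Icc a b := ⟨le_rfl, hab.le⟩
  have hCp0 : 0 ≤ Cp := (norm_nonneg _).trans (hCp a haI)
  have hCq0 : 0 ≤ Cq := (norm_nonneg _).trans (hCq a haI)
  have hba : 0 < b - a := by linarith
  refine ⟨2 * Cp + Cq * (b - a) + 1, by positivity, ?_⟩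
  intro Λ B v v1 v2 hB hΛ hv hv1 hode hv1B c hc d hd
  have hsub : uIcc c d ⊆ Icc a b := by
    rw [← uIcc_of_le hab.le] at hc hd ⊢
    exact uIcc_subset_uIcc hc hd
  have hvc : ContinuousOn v (Icc a b) := HasDerivAt.continuousOn hv
  have hv1c : ContinuousOn v1 (Icc a b) := HasDerivAt.continuousOn hv1
  have hder : ∀ x ∈ uIcc c d, HasDerivAt (fun x => p x * v1 x) (q x * v1 x - Λ * (ω x * v x)) x := by
    intro x hx
    have hx := hsub hx
    have d1 : HasDerivAt (fun y : ℝ => 1 - y ^ 2) (-2 * x) x := by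
      refine (((hasDerivAt_id x).fun_pow 2).const_sub 1).congr_deriv ?_
      simp
    refine (((hω x hx).fun_mul d1).fun_mul (hv1 x hx)).congr_deriv ?_
    have := hode x hx
    simp only [hq]
    linear_combination ω x * this
  have i1 : IntervalIntegrable (fun x => q x * v1 x) volume c d :=
    (ContinuousOn.mono (by fun_prop) hsub).intervalIntegrable
  have i2 : IntervalIntegrable (fun x => ω x * v x) volume c d :=
    (ContinuousOn.mono (by fun_prop) hsub).intervalIntegrable
  have h := intervalIntegral.integral_eq_sub_of_hasDerivAt hder (i1.sub (i2.const_mul Λ))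
  rw [intervalIntegral.integral_sub i1 (i2.const_mul Λ), intervalIntegral.integral_const_mul] at h
  have hpb : ∀ x ∈ Icc a b, |p x * v1 x| ≤ Cp * B := by
    intro x hx; rw [abs_mul]
    exact mul_le_mul (hCp x hx) (hv1B x hx) (abs_nonneg _) hCp0
  have hqb : |∫ x in c..d, q x * v1 x| ≤ Cq * B * (b - a) := by
    have := intervalIntegral.norm_integral_le_of_norm_le_const (f := fun x => q x * v1 x)
      (a := c) (b := d) (C := Cq * B) (by
        intro x hx
        have hx := hsub (uIoc_subset_uIcc hx)
        rw [norm_mul]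
        exact mul_le_mul (hCq x hx) (hv1B x hx) (norm_nonneg _) hCq0)
    refine this.trans ?_
    gcongr
    rw [abs_le]; constructor <;> linarith [hc.1, hc.2, hd.1, hd.2]
  rw [le_div_iff₀ hΛ]
  have e : |∫ x in c..d, ω x * v x| * Λ = |(∫ x in c..d, q x * v1 x) - (p d * v1 d - p c * v1 c)| := by
    rw [← h, sub_sub_cancel, abs_mul, abs_of_pos hΛ, mul_comm]
  rw [e]
  have h1 := hpb c hc
  have h2 := hpb d hd
  rw [abs_le] at *
  constructor <;> nlinarith

lemma wt_pos (p q x : ℝ) (h1 : -1 < x) (h2 : x < 1) : 0 < (1 - x) ^ p * (1 + x) ^ q :=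
  mul_pos (Real.rpow_pos_of_pos (by linarith) _) (Real.rpow_pos_of_pos (by linarith) _)

lemma jacobi_bounds (α β a b : ℝ) (hα : -1 < α) (hβ : -1 < β)
    (ha : -1 < a) (hab : a < b) (hb : b < 1) :
    ∃ C : ℝ, 0 < C ∧ ∃ N : ℕ, 1 ≤ N ∧ ∀ n : ℕ, N ≤ n →
      ContinuousOn (jacobiP α β n) (Icc a b) ∧
      (∀ x ∈ Icc a b, |jacobiP α β n x| ≤ C / √(n : ℝ)) ∧
      (∀ c ∈ Icc a b, ∀ d ∈ Icc a b, |∫ x in c..d, jacobiP α β n x| ≤ C / (n * √(n : ℝ))) := by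
  have hsub : ∀ x ∈ Icc a b, x ∈ Ioo (-1 : ℝ) 1 := fun x hx =>
    ⟨by linarith [hx.1], by linarith [hx.2]⟩
  obtain ⟨M, hM, N1, hN1, hMn⟩ := jacobi_norm_bound α β hα hβ
  obtain ⟨C1, hC1, N2, hN2, hen⟩ := ode_energy a b (α - β) (α + β - 2) ha hab hb
  set ω : ℝ → ℝ := fun x => (1 - x) ^ (-α) * (1 + x) ^ (-β) with hω
  set ω' : ℝ → ℝ := fun y =>
    (1 - y) ^ (-α - 1) * (1 + y) ^ (-β - 1) * ((-β - -α) - (-α + -β) * y) with hω'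
  have hwc : ∀ p q : ℝ, ContinuousOn (fun y : ℝ => (1 - y) ^ p * (1 + y) ^ q) (Icc a b) :=
    fun p q => HasDerivAt.continuousOn
      (fun x hx => hasDerivAt_wt p q x (hsub x hx).1 (hsub x hx).2)
  have hωd : ∀ x ∈ Icc a b, HasDerivAt ω (ω' x) x :=
    fun x hx => hasDerivAt_wt _ _ x (hsub x hx).1 (hsub x hx).2
  have hωc' : ContinuousOn ω' (Icc a b) := (hwc _ _).mul (by fun_prop)
  have hωc : ContinuousOn ω (Icc a b) := hwc _ _
  obtain ⟨C2, hC2, hosc⟩ := ode_osc a b (α - β) (α + β - 2) hab ω ω' hωd hωc'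
  obtain ⟨W, hW⟩ := isCompact_Icc.exists_bound_of_continuousOn (hwc α β)
  obtain ⟨W2, hW2⟩ := isCompact_Icc.exists_bound_of_continuousOn hωc
  have haI : a ∈ Icc a b := ⟨le_rfl, hab.le⟩
  have hW0 : 0 ≤ W := (norm_nonneg _).trans (hW a haI)
  have hW20 : 0 ≤ W2 := (norm_nonneg _).trans (hW2 a haI)
  set δ := (1 - b) * (1 + a) with hδ
  have hδ0 : 0 < δ := mul_pos (by linarith) (by linarith)
  have hδx : ∀ x ∈ Icc a b, δ ≤ 1 - x ^ 2 := by
    intro x hx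
    have : 1 - x ^ 2 = (1 - x) * (1 + x) := by ring
    rw [this, hδ]
    exact mul_le_mul (by linarith [hx.2]) (by linarith [hx.1]) (by linarith) (by linarith [hx.2])
  set S := C1 * (W * M) with hS
  have hS0 : 0 ≤ S := by positivity
  obtain ⟨N3, hN3⟩ := exists_nat_ge (max N2 (2 * |α + β|))
  refine ⟨W2 * √S + C2 * √(4 * S / δ) + 1, by positivity, max N1 N3, by omega, ?_⟩
  intro n hn
  have hnN1 : N1 ≤ n := (le_max_left _ _).trans hn
  have hnN3 : (N3 : ℝ) ≤ n := by exact_mod_cast (le_max_right _ _).trans hn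
  have hnN2 : N2 ≤ n := (le_max_left _ _).trans (hN3.trans hnN3)
  have hnσ : 2 * |α + β| ≤ n := (le_max_right _ _).trans (hN3.trans hnN3)
  have hn1 : (1 : ℝ) ≤ n := by exact_mod_cast hN1.trans hnN1
  have hn0 : (0 : ℝ) < n := by linarith
  set Λ : ℝ := (n + 1) * (n + (α + β)) with hΛ
  have hΛn : (n : ℝ) ^ 2 / 4 ≤ Λ := by
    have := neg_abs_le (α + β)
    rw [hΛ]
    nlinarith
  have hΛ0 : 0 < Λ := lt_of_lt_of_le (by positivity) hΛn
  set cn : ℝ := (-1 : ℝ) ^ n / (2 ^ n * (n.factorial : ℝ)) with hcn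
  set v : ℝ → ℝ := fun x => cn * jG (n + α) (n + β) n x with hv
  set v1 : ℝ → ℝ := fun x => cn * jG (n + α) (n + β) (n+1) x with hv1
  set v2 : ℝ → ℝ := fun x => cn * jG (n + α) (n + β) (n+2) x with hv2
  have hvd : ∀ x ∈ Icc a b, HasDerivAt v (v1 x) x := fun x hx =>
    (hasDerivAt_jG _ _ n x (hsub x hx).1 (hsub x hx).2).const_mul cn
  have hv1d : ∀ x ∈ Icc a b, HasDerivAt v1 (v2 x) x := fun x hx =>
    (hasDerivAt_jG _ _ (n+1) x (hsub x hx).1 (hsub x hx).2).const_mul cn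
  have hode : ∀ x ∈ Icc a b,
      (1 - x ^ 2) * v2 x + (α - β + (α + β - 2) * x) * v1 x + Λ * v x = 0 := by
    intro x hx
    have := jG_ode (n + α) (n + β) n x (hsub x hx)
    simp only [hv, hv1, hv2, hΛ]
    linear_combination cn * this
  have hvc : ContinuousOn v (Icc a b) := HasDerivAt.continuousOn hvd
  have hP : ∀ x ∈ Icc a b, jacobiP α β n x = ω x * v x := by
    intro x hx
    simp only [jacobiP, hω, hv]
    rw [iteratedDeriv_jG _ _ n x (hsub x hx)]
    ring
  have hH : ∫ y in a..b, v y ^ 2 ≤ W * M / n := by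
    set f : ℝ → ℝ := fun y => W * cn ^ 2 *
      ((jQ (n + α) (n + β) n).eval y * jG (n + α) (n + β) n y) with hf
    have hfi : IntervalIntegrable f volume (-1) 1 :=
      ((jG_integrable _ _ n (by linarith) (by linarith)).continuousOn_mul
        (jQ (n + α) (n + β) n).continuous.continuousOn).const_mul _
    have hfi' : IntervalIntegrable f volume a b := by
      refine hfi.mono_set ?_
      rw [uIcc_of_le hab.le, uIcc_of_le (by norm_num)]
      exact Icc_subset_Icc ha.le hb.le
    have hgw : ∀ y : ℝ, jG (n + α) (n + β) n y =
        (1 - y) ^ α * (1 + y) ^ β * (jQ (n + α) (n + β) n).eval y := by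
      intro y; simp [jG]
    have s1 : ∫ y in a..b, v y ^ 2 ≤ ∫ y in a..b, f y := by
      refine intervalIntegral.integral_mono_on hab.le
        (ContinuousOn.intervalIntegrable (by rw [uIcc_of_le hab.le]; fun_prop)) hfi' ?_
      intro x hx
      have hw := hW x hx
      rw [Real.norm_of_nonneg (wt_pos α β x (hsub x hx).1 (hsub x hx).2).le] at hw
      have hw0 := (wt_pos α β x (hsub x hx).1 (hsub x hx).2).le
      simp only [hv, hf, hgw]
      generalize (1 - x) ^ α * (1 + x) ^ β = w at *
      generalize (jQ (n + α) (n + β) n).eval x = q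
      calc (cn * (w * q)) ^ 2 = w * (cn ^ 2 * (q * (w * q))) := by ring
        _ ≤ W * (cn ^ 2 * (q * (w * q))) := by
          refine mul_le_mul_of_nonneg_right hw ?_
          have : q * (w * q) = w * q ^ 2 := by ring
          rw [this]; positivity
        _ = _ := by ring
    have s2 : ∫ y in a..b, f y ≤ ∫ y in (-1 : ℝ)..1, f y := by
      refine intervalIntegral.integral_mono_interval ha.le hab.le hb.le ?_ hfi
      filter_upwards [ae_restrict_mem measurableSet_Ioc] with x hx
      simp only [hf, hgw, Pi.zero_apply]
      have h1 : 0 ≤ 1 - x := by linarith [hx.2]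
      have h2 : 0 ≤ 1 + x := by linarith [hx.1]
      generalize (jQ (n + α) (n + β) n).eval x = q
      have : W * cn ^ 2 * (q * ((1 - x) ^ α * (1 + x) ^ β * q)) =
        W * cn ^ 2 * q ^ 2 * ((1 - x) ^ α * (1 + x) ^ β) := by ring
      rw [this]; positivity
    have s3 : ∫ y in (-1 : ℝ)..1, f y ≤ W * M / n := by
      simp only [hf]
      rw [intervalIntegral.integral_const_mul, le_div_iff₀ hn0]
      have := mul_le_mul_of_nonneg_left (hMn n hnN1) hW0
      rw [← hcn] at this
      linarith
    linarith
  have hE : ∀ x ∈ Icc a b, Λ * v x ^ 2 + (1 - x ^ 2) * v1 x ^ 2 ≤ S * Λ / n := by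
    intro x hx
    refine (hen n Λ v v1 v2 hnN2 hΛn hvd hv1d hode x hx).trans ?_
    calc C1 * (Λ * ∫ y in a..b, v y ^ 2) ≤ C1 * (Λ * (W * M / n)) := by gcongr
      _ = _ := by rw [hS]; ring
  have hvb : ∀ x ∈ Icc a b, |v x| ≤ √S / √(n : ℝ) := by
    intro x hx
    rw [← Real.sqrt_div hS0]
    refine Real.abs_le_sqrt ?_
    have h1 := hE x hx
    have : 0 ≤ (1 - x ^ 2) * v1 x ^ 2 := mul_nonneg (hδ0.le.trans (hδx x hx)) (sq_nonneg _)
    have h2 : Λ * v x ^ 2 ≤ Λ * (S / n) := by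
      have : S * Λ / n = Λ * (S / n) := by ring
      linarith
    exact le_of_mul_le_mul_left h2 hΛ0
  set T := √(4 * S / δ) / (n * √(n : ℝ)) with hT
  have hT0 : 0 ≤ T := by positivity
  have hv1b : ∀ x ∈ Icc a b, |v1 x| ≤ Λ * T := by
    intro x hx
    refine abs_le_of_sq_le_sq ?_ (by positivity)
    have hT2 : T ^ 2 = 4 * S / δ / n ^ 3 := by
      rw [hT, div_pow, mul_pow, Real.sq_sqrt hn0.le, Real.sq_sqrt (by positivity)]
      congr 1
    rw [mul_pow Λ T, hT2]
    have h1 := hE x hx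
    have h2 : 0 ≤ Λ * v x ^ 2 := by positivity
    have h3 := mul_le_mul_of_nonneg_right (hδx x hx) (sq_nonneg (v1 x))
    have h4 : δ * v1 x ^ 2 ≤ S * Λ / n := by linarith
    have h5 : v1 x ^ 2 ≤ S * Λ / n / δ := by rw [le_div_iff₀ hδ0]; linarith
    refine h5.trans ?_
    calc S * Λ / n / δ = (n ^ 2 / 4) * (Λ * (4 * S / δ / n ^ 3)) := by field_simp
      _ ≤ Λ * (Λ * (4 * S / δ / n ^ 3)) := by gcongr
      _ = _ := by ring
  refine ⟨(hωc.mul hvc).congr hP, ?_, ?_⟩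
  · intro x hx
    rw [hP x hx, abs_mul]
    calc |ω x| * |v x| ≤ W2 * (√S / √(n : ℝ)) :=
          mul_le_mul (hW2 x hx) (hvb x hx) (abs_nonneg _) hW20
      _ = (W2 * √S) / √(n : ℝ) := by ring
      _ ≤ _ := by
        gcongr
        have : 0 ≤ C2 * √(4 * S / δ) := by positivity
        linarith
  · intro c hc d hd
    have hsub2 : uIcc c d ⊆ Icc a b := by
      rw [← uIcc_of_le hab.le] at hc hd ⊢
      exact uIcc_subset_uIcc hc hd
    rw [intervalIntegral.integral_congr (fun x hx => hP x (hsub2 hx))]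
    refine (hosc Λ (Λ * T) v v1 v2 (by positivity) hΛ0 hvd hv1d hode hv1b c hc d hd).trans ?_
    calc C2 * (Λ * T) / Λ = (C2 * √(4 * S / δ)) / (n * √(n : ℝ)) := by
          rw [hT]; field_simp
      _ ≤ _ := by
        gcongr
        have : 0 ≤ W2 * √S := by positivity
        linarith


lemma shift_rpow_integrable (γ a c d : ℝ) (hγ : -1 < γ) :
    IntervalIntegrable (fun t : ℝ => (t - a) ^ γ) volume c d := by
  have h := (intervalIntegral.intervalIntegrable_rpow' (a := c - a) (b := d - a) hγ).comp_sub_right a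
  simpa using h

lemma phi_small (γ a b x M : ℝ) (P : ℝ → ℝ) (hγ : -1 < γ)
    (hx : x ∈ Icc a b) (hM : ∀ t ∈ Icc a b, |P t| ≤ M) :
    |∫ t in a..x, (t - a) ^ γ * P t| ≤ M * ((x - a) ^ (γ + 1) / (γ + 1)) := by
  have h1 : ‖∫ t in a..x, (t - a) ^ γ * P t‖ ≤ ∫ t in a..x, (t - a) ^ γ * M := by
    apply intervalIntegral.norm_integral_le_of_norm_le hx.1
    · refine Filter.Eventually.of_forall fun t ht => ?_
      have h0 : 0 ≤ (t - a) ^ γ := Real.rpow_nonneg (by linarith [ht.1]) _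
      rw [norm_mul, Real.norm_of_nonneg h0, Real.norm_eq_abs]
      exact mul_le_mul_of_nonneg_left (hM t ⟨ht.1.le, ht.2.trans hx.2⟩) h0
    · exact (shift_rpow_integrable γ a a x hγ).mul_const M
  rw [intervalIntegral.integral_mul_const,
    intervalIntegral.integral_comp_sub_right (fun t : ℝ => t ^ γ) a, sub_self,
    integral_rpow (Or.inl hγ), Real.zero_rpow (by linarith), sub_zero, mul_comm] at h1
  exact h1

lemma phi_large (γ a b c x ε : ℝ) (P : ℝ → ℝ) (hac : a < c) (hcx : c ≤ x) (hxb : x ≤ b)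
    (hP : ContinuousOn P (Icc a b))
    (hε : ∀ t ∈ Icc c x, |∫ s in c..t, P s| ≤ ε) :
    |∫ t in c..x, (t - a) ^ γ * P t| ≤ ε * (2 * (x - a) ^ γ + (c - a) ^ γ) := by
  have hε0 : 0 ≤ ε := (abs_nonneg _).trans (hε c ⟨le_rfl, hcx⟩)
  have hu : uIcc c x = Icc c x := uIcc_of_le hcx
  have hPc : ContinuousOn P (uIcc c x) := by
    rw [hu]; exact hP.mono (Icc_subset_Icc hac.le hxb)
  have hPi : IntervalIntegrable P volume c x := hPc.intervalIntegrable
  have hne : ∀ t ∈ Icc c x, t - a ≠ 0 := fun t ht => by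
    have := ht.1
    intro h; linarith
  have hpow : ∀ r : ℝ, ContinuousOn (fun t : ℝ => (t - a) ^ r) (uIcc c x) := fun r => by
    rw [hu]
    exact ContinuousOn.rpow_const (by fun_prop) (fun t ht => Or.inl (hne t ht))
  have hder : ∀ t ∈ Icc c x, HasDerivAt (fun t : ℝ => (t - a) ^ γ) (γ * (t - a) ^ (γ - 1)) t :=
    fun t ht => by
      have h := ((hasDerivAt_id t).sub_const a).rpow_const (p := γ) (Or.inl (hne t ht))
      refine h.congr_deriv ?_
      simp
  have hd' : IntervalIntegrable (fun t : ℝ => γ * (t - a) ^ (γ - 1)) volume c x :=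
    ((hpow (γ - 1)).intervalIntegrable).const_mul γ
  have hibp := intervalIntegral.integral_mul_deriv_eq_deriv_mul_of_hasDerivAt
    (u := fun t : ℝ => (t - a) ^ γ) (v := fun t => ∫ s in c..t, P s)
    (u' := fun t : ℝ => γ * (t - a) ^ (γ - 1)) (v' := P) (a := c) (b := x)
    (hpow γ)
    (intervalIntegral.continuousOn_primitive_interval' hPi (by simp))
    (fun t ht => by
      rw [min_eq_left hcx, max_eq_right hcx] at ht
      exact hder t ⟨ht.1.le, ht.2.le⟩)
    (fun t ht => by
      rw [min_eq_left hcx, max_eq_right hcx] at ht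
      have hn : Icc a b ∈ nhds t := Icc_mem_nhds (by linarith [ht.1]) (by linarith [ht.2])
      refine intervalIntegral.integral_hasDerivAt_right ?_ ?_ (hP.continuousAt hn)
      · exact hPi.mono_set (by
          rw [hu, uIcc_of_le ht.1.le]; exact Icc_subset_Icc le_rfl ht.2.le)
      · exact (hP.mono Ioo_subset_Icc_self).stronglyMeasurableAtFilter isOpen_Ioo t
          ⟨by linarith [ht.1], by linarith [ht.2]⟩)
    hd' hPi
  have hftc : ∫ t in c..x, γ * (t - a) ^ (γ - 1) = (x - a) ^ γ - (c - a) ^ γ :=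
    intervalIntegral.integral_eq_sub_of_hasDerivAt (fun t ht => hder t (hu ▸ ht)) hd'
  have hA : 0 ≤ (x - a) ^ γ := Real.rpow_nonneg (by linarith) _
  have hB : 0 ≤ (c - a) ^ γ := Real.rpow_nonneg (by linarith) _
  have hrem : |∫ t in c..x, γ * (t - a) ^ (γ - 1) * ∫ s in c..t, P s| ≤
      ε * ((x - a) ^ γ + (c - a) ^ γ) := by
    have h1 : ‖∫ t in c..x, γ * (t - a) ^ (γ - 1) * ∫ s in c..t, P s‖ ≤
        ∫ t in c..x, (|γ| * (t - a) ^ (γ - 1)) * ε := by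
      apply intervalIntegral.norm_integral_le_of_norm_le hcx
      · refine Filter.Eventually.of_forall fun t ht => ?_
        have h0 : 0 ≤ (t - a) ^ (γ - 1) := Real.rpow_nonneg (by linarith [ht.1]) _
        rw [norm_mul, norm_mul, Real.norm_of_nonneg h0, Real.norm_eq_abs, Real.norm_eq_abs]
        exact mul_le_mul_of_nonneg_left (hε t ⟨ht.1.le, ht.2⟩) (by positivity)
      · exact (((hpow (γ - 1)).intervalIntegrable).const_mul |γ|).mul_const ε
    rw [intervalIntegral.integral_mul_const, mul_comm] at h1
    refine h1.trans (mul_le_mul_of_nonneg_left ?_ hε0)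
    rcases abs_cases γ with ⟨h, _⟩ | ⟨h, _⟩
    · rw [h, hftc]; linarith
    · rw [h]
      have : ∫ t in c..x, -γ * (t - a) ^ (γ - 1) = -((x - a) ^ γ - (c - a) ^ γ) := by
        rw [← hftc, ← intervalIntegral.integral_neg]
        simp
      rw [this]; linarith
  rw [hibp]
  have hlast : |(x - a) ^ γ * ∫ s in c..x, P s| ≤ ε * (x - a) ^ γ := by
    rw [abs_mul, abs_of_nonneg hA, mul_comm]
    exact mul_le_mul_of_nonneg_right (hε x ⟨hcx, le_rfl⟩) hA
  simp only [intervalIntegral.integral_same, mul_zero, sub_zero]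
  calc _ ≤ |(x - a) ^ γ * ∫ s in c..x, P s| +
      |∫ t in c..x, γ * (t - a) ^ (γ - 1) * ∫ s in c..t, P s| := abs_sub _ _
    _ ≤ _ := by linarith

lemma phi_bound (γ a b C : ℝ) (hγ : -1 < γ) (hab : a < b) (hC : 0 < C) :
    ∃ K : ℝ, 0 < K ∧ ∀ (n : ℕ) (P : ℝ → ℝ), 1 ≤ n → ContinuousOn P (Icc a b) →
      (∀ x ∈ Icc a b, |P x| ≤ C / √(n : ℝ)) →
      (∀ c ∈ Icc a b, ∀ d ∈ Icc a b, |∫ x in c..d, P x| ≤ C / (n * √(n : ℝ))) →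
      ∀ x ∈ Icc a b, |∫ t in a..x, (t - a) ^ γ * P t| ≤
        K * (n : ℝ) ^ (-(min (γ + 3 / 2) (3 / 2))) := by
  have hγ1 : 0 < γ + 1 := by linarith
  have hba : 0 < b - a := by linarith
  set K1 := C / (γ + 1) with hK1
  set m := max 1 ((b - a) ^ γ) with hm
  have hK1p : 0 < K1 := by positivity
  have hm1 : 1 ≤ m := le_max_left _ _
  refine ⟨K1 + C * (2 * m + 1), by positivity, ?_⟩
  intro n P hn hP hb1 hb2 x hx
  have hn1 : (1 : ℝ) ≤ n := by exact_mod_cast hn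
  have hn0 : (0 : ℝ) < n := by linarith
  set E := (n : ℝ) ^ (-(min (γ + 3 / 2) (3 / 2))) with hE
  have hEp : 0 < E := Real.rpow_pos_of_pos hn0 _
  have hsq : C / √(n : ℝ) = C * (n : ℝ) ^ (-(1 / 2) : ℝ) := by
    rw [Real.sqrt_eq_rpow, Real.rpow_neg hn0.le, div_eq_mul_inv]
  have hsq3 : C / (n * √(n : ℝ)) = C * (n : ℝ) ^ (-(3 / 2) : ℝ) := by
    have h : (n : ℝ) * √(n : ℝ) = (n : ℝ) ^ (3 / 2 : ℝ) := by
      rw [Real.sqrt_eq_rpow]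
      nth_rewrite 1 [← Real.rpow_one (n : ℝ)]
      rw [← Real.rpow_add hn0]; norm_num
    rw [h, Real.rpow_neg hn0.le, div_eq_mul_inv]
  -- small part
  have small : ∀ y ∈ Icc a b, y - a ≤ 1 / n → |∫ t in a..y, (t - a) ^ γ * P t| ≤ K1 * E := by
    intro y hy hyn
    have h1 := phi_small γ a b y _ P hγ hy hb1
    have h2 : (y - a) ^ (γ + 1) ≤ (n : ℝ) ^ (-(γ + 1)) := by
      rw [Real.rpow_neg hn0.le, ← Real.inv_rpow hn0.le]
      exact Real.rpow_le_rpow (by linarith [hy.1]) (by simpa using hyn) hγ1.le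
    have h3 : (n : ℝ) ^ (-(1 / 2) : ℝ) * (n : ℝ) ^ (-(γ + 1)) ≤ E := by
      rw [← Real.rpow_add hn0]
      apply Real.rpow_le_rpow_of_exponent_le hn1
      have := min_le_left (γ + 3 / 2) (3 / 2)
      linarith
    calc _ ≤ _ := h1
      _ = K1 * ((n : ℝ) ^ (-(1 / 2) : ℝ) * (y - a) ^ (γ + 1)) := by
        rw [hsq, hK1]; field_simp
      _ ≤ K1 * ((n : ℝ) ^ (-(1 / 2) : ℝ) * (n : ℝ) ^ (-(γ + 1))) := by gcongr
      _ ≤ K1 * E := by gcongr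
  have hrest : 0 ≤ C * (2 * m + 1) * E := by positivity
  by_cases hxn : x - a ≤ 1 / n
  · have := small x hx hxn
    rw [add_mul]; linarith
  push Not at hxn
  set c := a + 1 / (n : ℝ) with hc
  have hinv : 0 < 1 / (n : ℝ) := by positivity
  have hac : a < c := by linarith
  have hcx : c ≤ x := by linarith
  have hcm : c ∈ Icc a b := ⟨hac.le, hcx.trans hx.2⟩
  have hIntg : ∀ u ∈ Icc a b, ∀ v ∈ Icc a b,
      IntervalIntegrable (fun t : ℝ => (t - a) ^ γ * P t) volume u v := fun u hu v hv =>
    (shift_rpow_integrable γ a u v hγ).mul_continuousOn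
      (hP.mono (uIcc_subset_Icc hu hv))
  rw [← intervalIntegral.integral_add_adjacent_intervals
    (hIntg a ⟨le_rfl, hab.le⟩ c hcm) (hIntg c hcm x hx)]
  have hs := small c hcm (by rw [hc]; linarith)
  have hl := phi_large γ a b c x (C / (n * √(n : ℝ))) P hac hcx hx.2 hP
    (fun t ht => hb2 c hcm t ⟨hac.le.trans ht.1, ht.2.trans hx.2⟩)
  have hEeq : (n : ℝ) ^ (-(3 / 2) : ℝ) * (n : ℝ) ^ (-(min γ 0)) = E := by
    rw [← Real.rpow_add hn0, hE]
    congr 1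
    rcases le_total γ 0 with h | h
    · rw [min_eq_left h, min_eq_left (by linarith)]; ring
    · rw [min_eq_right h, min_eq_right (by linarith)]; ring
  have hcg : (c - a) ^ γ ≤ (n : ℝ) ^ (-(min γ 0)) := by
    have : c - a = (n : ℝ)⁻¹ := by rw [hc]; simp
    rw [this, Real.inv_rpow hn0.le, ← Real.rpow_neg hn0.le]
    apply Real.rpow_le_rpow_of_exponent_le hn1
    linarith [min_le_left γ 0]
  have hxg : (x - a) ^ γ ≤ m * (n : ℝ) ^ (-(min γ 0)) := by
    rcases le_total γ 0 with h | h
    · have h1 : (x - a) ^ γ ≤ (c - a) ^ γ :=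
        Real.rpow_le_rpow_of_nonpos (by linarith) (by linarith) h
      have h2 : 0 ≤ (n : ℝ) ^ (-(min γ 0)) := Real.rpow_nonneg hn0.le _
      nlinarith
    · rw [min_eq_right h, neg_zero, Real.rpow_zero, mul_one]
      exact (Real.rpow_le_rpow (by linarith [hx.1]) (by linarith [hx.2]) h).trans
        (le_max_right _ _)
  have hl2 : C / (n * √(n : ℝ)) * (2 * (x - a) ^ γ + (c - a) ^ γ) ≤ C * (2 * m + 1) * E := by
    rw [hsq3, ← hEeq]
    have h0 : 0 ≤ C * (n : ℝ) ^ (-(3 / 2) : ℝ) := by positivity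
    calc _ ≤ C * (n : ℝ) ^ (-(3 / 2) : ℝ) *
          (2 * (m * (n : ℝ) ^ (-(min γ 0))) + (n : ℝ) ^ (-(min γ 0))) := by gcongr
      _ = _ := by ring
  refine (abs_add_le _ _).trans ?_
  rw [add_mul]
  linarith

lemma final_bound (γ a b M : ℝ) (P ψ : ℝ → ℝ) (hγ : -1 < γ) (hab : a < b)
    (hP : ContinuousOn P (Icc a b))
    (hM : ∀ x ∈ Icc a b, |∫ t in a..x, (t - a) ^ γ * P t| ≤ M) (hψ : IsWAC a b ψ) :
    |∫ x in a..b, (x - a) ^ γ * P x * ψ x| ≤ M * wacNorm a b ψ := by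
  obtain ⟨hi, hψ⟩ := hψ
  have hu : uIcc a b = Icc a b := uIcc_of_le hab.le
  have hM0 : 0 ≤ M := (abs_nonneg _).trans (hM a ⟨le_rfl, hab.le⟩)
  have hii : IntervalIntegrable (deriv ψ) volume a b := by
    rw [intervalIntegrable_iff_integrableOn_Ioo_of_le hab.le]; exact hi
  have hgi : IntervalIntegrable (fun t : ℝ => (t - a) ^ γ * P t) volume a b :=
    (shift_rpow_integrable γ a a b hγ).mul_continuousOn (by rwa [hu])
  have hΦ := hgi.absolutelyContinuousOnInterval_intervalIntegral (c := a) (by simp)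
  have hΨ := hii.absolutelyContinuousOnInterval_intervalIntegral (c := a) (by simp)
  have hd1 := hgi.ae_hasDerivAt_integral
  have hd2 := hii.ae_hasDerivAt_integral
  have hibp := hΨ.integral_mul_deriv_eq_deriv_mul hΦ
  have hΦb : ∫ x in a..b, (x - a) ^ γ * P x * ψ x =
      ψ b * (∫ t in a..b, (t - a) ^ γ * P t) -
      ∫ x in a..b, deriv ψ x * ∫ t in a..x, (t - a) ^ γ * P t := by
    have e1 : ∫ x in a..b, (∫ v in a..x, deriv ψ v) *
        deriv (fun x => ∫ t in a..x, (t - a) ^ γ * P t) x =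
        ∫ x in a..b, ((x - a) ^ γ * P x * ψ x - ψ a * ((x - a) ^ γ * P x)) := by
      apply intervalIntegral.integral_congr_ae
      filter_upwards [hd1] with x hx hxm
      have hx' : x ∈ uIcc a b := uIoc_subset_uIcc hxm
      rw [(hx hx' a (by simp)).deriv, hψ x (hu ▸ hx')]
      ring
    have e2 : ∫ x in a..b, deriv (fun x => ∫ v in a..x, deriv ψ v) x *
        (∫ t in a..x, (t - a) ^ γ * P t) =
        ∫ x in a..b, deriv ψ x * ∫ t in a..x, (t - a) ^ γ * P t := by
      apply intervalIntegral.integral_congr_ae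
      filter_upwards [hd2] with x hx hxm
      have hx' : x ∈ uIcc a b := uIoc_subset_uIcc hxm
      rw [(hx hx' a (by simp)).deriv]
    have hψc : ContinuousOn ψ (uIcc a b) :=
      (continuousOn_const.add hΨ.continuousOn).congr (fun x hx => hψ x (hu ▸ hx))
    rw [e1, e2, intervalIntegral.integral_sub (hgi.mul_continuousOn hψc) (hgi.const_mul _),
      intervalIntegral.integral_const_mul] at hibp
    simp only [intervalIntegral.integral_same, mul_zero, sub_zero] at hibp
    rw [hψ b ⟨hab.le, le_rfl⟩]
    linarith
  have hψc : ContinuousOn ψ (Icc a b) := by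
    rw [← hu]
    exact (continuousOn_const.add hΨ.continuousOn).congr (fun x hx => hψ x (hu ▸ hx))
  have hsup : |ψ b| ≤ ⨆ x : Icc a b, |ψ (x : ℝ)| := by
    obtain ⟨B, hB⟩ := isCompact_Icc.exists_bound_of_continuousOn hψc
    exact le_ciSup (f := fun x : Icc a b => |ψ (x : ℝ)|)
      ⟨B, by rintro _ ⟨y, rfl⟩; exact hB y y.2⟩ ⟨b, hab.le, le_rfl⟩
  have hrem : |∫ x in a..b, deriv ψ x * ∫ t in a..x, (t - a) ^ γ * P t| ≤
      M * ∫ t in a..b, |deriv ψ t| := by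
    rw [← intervalIntegral.integral_const_mul]
    rw [← Real.norm_eq_abs]
    refine intervalIntegral.norm_integral_le_of_norm_le hab.le
      (Filter.Eventually.of_forall fun t ht => ?_) (hii.abs.const_mul M)
    rw [norm_mul, mul_comm, Real.norm_eq_abs, Real.norm_eq_abs]
    exact mul_le_mul_of_nonneg_right (hM t ⟨ht.1.le, ht.2⟩) (abs_nonneg _)
  have hfst : |ψ b * (∫ t in a..b, (t - a) ^ γ * P t)| ≤
      M * ⨆ x : Icc a b, |ψ (x : ℝ)| := by
    rw [abs_mul, mul_comm]
    exact mul_le_mul (hM b ⟨hab.le, le_rfl⟩) hsup (abs_nonneg _) hM0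
  rw [hΦb, wacNorm, mul_add]
  exact (abs_sub _ _).trans (add_le_add hfst hrem)

theorem van_der_corput_jacobi_ab (α β γ a b : ℝ) (hα : -1 < α) (hβ : -1 < β)
    (hγ : -1 < γ) (ha : -1 < a) (hab : a < b) (hb : b < 1) :
    ∃ C : ℝ, 0 < C ∧ ∃ N : ℕ, ∀ ψ : ℝ → ℝ, IsWAC a b ψ → ∀ n : ℕ, N ≤ n →
      |∫ x in a..b, (x - a) ^ γ * jacobiP α β n x * ψ x| ≤
        C * wacNorm a b ψ * (n : ℝ) ^ (-(min (γ + 3 / 2) (3 / 2))) := by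
  obtain ⟨C, hC, N, hN, h⟩ := jacobi_bounds α β a b hα hβ ha hab hb
  obtain ⟨K, hK, hb'⟩ := phi_bound γ a b C hγ hab hC
  refine ⟨K, hK, N, fun ψ hψ n hn => ?_⟩
  obtain ⟨h1, h2, h3⟩ := h n hn
  have := final_bound γ a b _ (jacobiP α β n) ψ hγ hab h1
    (hb' n (jacobiP α β n) (hN.trans hn) h1 h2 h3) hψ
  linarith
end
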